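/- Gaussian estimates for the general parabolic equation (Theorem 1.5): Let μ ≥ 1 and a, r : ℝ → ℝ continuous with 1/μ ≤ a(x) ≤ μ and |r(x)| ≤ μ for all x; let γ > γ̲; let φ := φ_γ and φ̃ := φ̃_γ be generalized principal eigenfunctions; let φ̇ : ℝ → ℝ be differentiable with φ̇(0) = 0, x ↦ a(x)φ̇'(x) differentiable with (aφ̇')' + (r − γ)φ̇ = φ pointwise on ℝ, and with x ↦ φ̇(x)/(x·φ(x)) bounded on ℝ∖{0}; set W := a(0)(φ̃'(0)φ(0) − φ'(0)φ̃(0)) and T_γ(x) := −W·φ̇(x)/φ(x). Then for every fundamental solution U of the equation u_t − (a(x)u_x)_x = r(x)u there exists a constant C > 0 such that for all t > 0 and all x, y ∈ ℝ: (1/(C t^{1/2}))·(φ(x)/φ(y))·exp(−C|T_γ(x) − T_γ(y) − W t|²/t + γt) ≤ U(t,x,y) ≤ (C/t^{1/2})·(φ(x)/φ(y))·exp(−|T_γ(x) − T_γ(y) − W t|²/(Ct) + γt). -/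

import Mathlib

open MeasureTheory Filter

/-- The generalized principal eigenvalue `γ̲`: the supremum over nonzero compactly
supported `C¹` functions `φ` of the Rayleigh quotient
`(∫ (r φ² − a (φ')²))/(∫ φ²)`. -/
noncomputable def gammaBar (a r : ℝ → ℝ) : ℝ :=
  sSup {c : ℝ | ∃ φ : ℝ → ℝ, ContDiff ℝ 1 φ ∧ HasCompactSupport φ ∧ φ ≠ 0 ∧
    c = (∫ x : ℝ, (r x * φ x ^ 2 - a x * deriv φ x ^ 2)) / ∫ x : ℝ, φ x ^ 2}

/-- A generalized principal eigenfunction `φ` (with explicit derivative `φ'`):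
positive, `φ(0) = 1`, `(aφ')' + (r − γ)φ = 0` pointwise, and `φ → 0` along the
filter `l` (`atTop` for `φ_γ`, `atBot` for `φ̃_γ`). -/
def IsGenPrincEig (a r : ℝ → ℝ) (γ : ℝ) (l : Filter ℝ) (φ φ' : ℝ → ℝ) : Prop :=
  (∀ x, 0 < φ x) ∧ φ 0 = 1 ∧
  (∀ x, HasDerivAt φ (φ' x) x) ∧
  (∀ x, HasDerivAt (fun y => a y * φ' y) ((γ - r x) * φ x) x) ∧
  Tendsto φ l (nhds 0)

/-- A fundamental solution `U` of the general parabolic equation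
`u_t − (a(x)u_x)_x = r(x)u`: for each `y`, `(t,x) ↦ U(t,x,y)` is a nonnegative classical
solution on `(0,∞) × ℝ`, `∫ U(t,x,y)ψ(x)dx → ψ(y)` as `t → 0⁺` for every bounded
continuous `ψ`, and the semigroup property holds. -/
def IsFundSolOrig (a r : ℝ → ℝ) (U : ℝ → ℝ → ℝ → ℝ) : Prop :=
  (∀ y : ℝ, ∃ Ut Ux q : ℝ → ℝ → ℝ, ∀ t ∈ Set.Ioi (0 : ℝ), ∀ x : ℝ,
    0 ≤ U t x y ∧
    HasDerivAt (fun τ => U τ x y) (Ut t x) t ∧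
    HasDerivAt (fun ξ => U t ξ y) (Ux t x) x ∧
    HasDerivAt (fun ξ => a ξ * Ux t ξ) (q t x) x ∧
    Ut t x = q t x + r x * U t x y) ∧
  (∀ y : ℝ, ∀ ψ : ℝ → ℝ, Continuous ψ → (∃ B : ℝ, ∀ x, |ψ x| ≤ B) →
    Tendsto (fun t => ∫ x : ℝ, U t x y * ψ x) (nhdsWithin 0 (Set.Ioi 0)) (nhds (ψ y))) ∧
  (∀ s t : ℝ, 0 < s → 0 < t → ∀ x y : ℝ,
    U (t + s) x y = ∫ z : ℝ, U t x z * U s z y)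

/-! ### Part 1 -/
/-- abstract maximum principle -/
theorem abs_max_principle {X : Type*} [TopologicalSpace X] (S : Set X)
    (w : ℝ → X → ℝ) (t κ : ℝ) (ht : 0 ≤ t)
    (hlsc : LowerSemicontinuousOn (fun p : ℝ × X => w p.1 p.2) (Set.Icc 0 t ×ˢ S))
    (h0 : ∀ p ∈ S, 0 ≤ w 0 p)
    (hinf : ∃ K : Set X, IsCompact K ∧ K ⊆ S ∧ ∀ s ∈ Set.Icc 0 t, ∀ p ∈ S, p ∉ K → 0 ≤ w s p)
    (hneg : ∀ s, 0 < s → s ≤ t → ∀ p ∈ S, w s p < 0 → (∀ q ∈ S, w s p ≤ w s q) →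
      ∃ d, HasDerivAt (fun σ => w σ p) d s ∧ κ * w s p ≤ d) :
    ∀ s ∈ Set.Icc 0 t, ∀ p ∈ S, 0 ≤ w s p := by
  obtain ⟨K, hK, hKS, hKw⟩ := hinf
  by_contra hcon
  push Not at hcon
  obtain ⟨s1, hs1, p1, hp1, hw1⟩ := hcon
  have hp1K : p1 ∈ K := by
    by_contra h
    exact absurd (hKw s1 hs1 p1 hp1 h) (not_le.mpr hw1)
  have hcompact : IsCompact (Set.Icc (0:ℝ) t ×ˢ K) := isCompact_Icc.prod hK
  -- multiply by exponential weight
  have hl2 : LowerSemicontinuousOn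
      (fun p : ℝ × X => Real.exp (-(κ + 1) * p.1) * w p.1 p.2) (Set.Icc 0 t ×ˢ K) := by
    have hl1 : LowerSemicontinuousOn (fun p : ℝ × X => w p.1 p.2) (Set.Icc 0 t ×ˢ K) :=
      hlsc.mono (Set.prod_mono le_rfl hKS)
    intro p hp y hy
    have hE : 0 < Real.exp (-(κ + 1) * p.1) := Real.exp_pos _
    simp only at hy
    -- choose c with y / E < c < w p
    have h1 : y / Real.exp (-(κ + 1) * p.1) < w p.1 p.2 := by
      rw [div_lt_iff₀ hE]; linarith
    obtain ⟨c, hc1, hc2⟩ := exists_between h1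
    have h2 := hl1 p hp c hc2
    have hcont : ContinuousAt (fun q : ℝ × X => Real.exp (-(κ + 1) * q.1) * c) p := by fun_prop
    have h3 : y < Real.exp (-(κ + 1) * p.1) * c := by
      rw [div_lt_iff₀ hE] at hc1; linarith
    have h4 : ∀ᶠ q in nhdsWithin p (Set.Icc (0:ℝ) t ×ˢ K),
        y < Real.exp (-(κ + 1) * q.1) * c :=
      nhdsWithin_le_nhds (hcont.eventually_const_lt h3)
    filter_upwards [h2, h4] with q hq1 hq2
    exact hq2.trans (mul_lt_mul_of_pos_left hq1 (Real.exp_pos _))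
  obtain ⟨⟨s, p⟩, hsp, hmin⟩ := hl2.exists_isMinOn (Set.nonempty_of_mem (Set.mk_mem_prod hs1 hp1K)) hcompact
  have hspS : p ∈ S := hKS hsp.2
  have hminval : ∀ s' ∈ Set.Icc (0:ℝ) t, ∀ q ∈ K,
      Real.exp (-(κ + 1) * s) * w s p ≤ Real.exp (-(κ + 1) * s') * w s' q :=
    fun s' hs' q hq => hmin (show (s', q) ∈ Set.Icc (0:ℝ) t ×ˢ K from ⟨hs', hq⟩)
  have hneg0 : Real.exp (-(κ + 1) * s) * w s p < 0 :=
    (hminval s1 hs1 p1 hp1K).trans_lt (mul_neg_of_pos_of_neg (Real.exp_pos _) hw1)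
  have hwneg : w s p < 0 := by
    by_contra h
    push Not at h
    exact absurd (mul_nonneg (Real.exp_pos (-(κ + 1) * s)).le h) (not_le.mpr hneg0)
  have hs0 : 0 < s := by
    rcases lt_or_eq_of_le hsp.1.1 with h | h
    · exact h
    · exfalso
      have := h0 p hspS
      simp only at h
      rw [h] at this
      linarith
  have hminS : ∀ q ∈ S, w s p ≤ w s q := by
    intro q hq
    by_cases hqK : q ∈ K
    · have := hminval s hsp.1 q hqK
      exact le_of_mul_le_mul_left this (Real.exp_pos _)
    · exact hwneg.le.trans (hKw s hsp.1 q hq hqK)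
  obtain ⟨d, hd, hdk⟩ := hneg s hs0 hsp.1.2 p hspS hwneg hminS
  have hD : HasDerivAt (fun σ => Real.exp (-(κ + 1) * σ) * w σ p)
      (Real.exp (-(κ + 1) * s) * (-(κ + 1)) * w s p + Real.exp (-(κ + 1) * s) * d) s := by
    have := ((hasDerivAt_id s).const_mul (-(κ + 1))).exp
    simp only [id, mul_one] at this
    exact this.mul hd
  have hle : Real.exp (-(κ + 1) * s) * (-(κ + 1)) * w s p + Real.exp (-(κ + 1) * s) * d ≤ 0 := by
    have hd1 := hD.hasDerivWithinAt (s := Set.Iic s)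
    have hslope := hasDerivWithinAt_iff_tendsto_slope.mp hd1
    have hset : Set.Iic s \ {s} = Set.Iio s := by ext z; simp [lt_iff_le_and_ne]
    rw [hset] at hslope
    refine le_of_tendsto hslope ?_
    have : ∀ᶠ σ in nhdsWithin s (Set.Iio s), σ ∈ Set.Ioo 0 s := Ioo_mem_nhdsLT hs0
    filter_upwards [this] with σ hσ
    rw [slope_def_field]
    have h1 := hminval σ ⟨hσ.1.le, hσ.2.le.trans hsp.1.2⟩ p hsp.2
    apply div_nonpos_of_nonneg_of_nonpos <;> linarith [hσ.2]
  have hE := Real.exp_pos (-(κ + 1) * s)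
  have : Real.exp (-(κ + 1) * s) * (-(κ + 1) * w s p + d) > 0 := by
    apply mul_pos hE; nlinarith
  nlinarith

/-- second derivative test for the divergence-form operator at a local minimum -/
theorem second_deriv_nonneg {a F F' : ℝ → ℝ} {Q x : ℝ}
    (ha : ∀ z, 0 < a z) (hF : ∀ᶠ z in nhds x, HasDerivAt F (F' z) z)
    (hQ : HasDerivAt (fun z => a z * F' z) Q x)
    (hmin : IsLocalMin F x) : 0 ≤ Q := by
  by_contra hQn
  push Not at hQn
  have hF0 : F' x = 0 := hmin.hasDerivAt_eq_zero hF.self_of_nhds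
  have hd1 := hQ.hasDerivWithinAt (s := Set.Ici x)
  have hslope := hasDerivWithinAt_iff_tendsto_slope.mp hd1
  have hset : Set.Ici x \ {x} = Set.Ioi x := by ext z; simp [lt_iff_le_and_ne]
  rw [hset] at hslope
  have h1 : ∀ᶠ z in nhdsWithin x (Set.Ioi x), slope (fun z => a z * F' z) x z < 0 :=
    hslope.eventually_lt_const hQn
  have h2 : ∀ᶠ z in nhdsWithin x (Set.Ioi x), F' z < 0 := by
    filter_upwards [h1, self_mem_nhdsWithin] with z hz hzx
    rw [slope_def_field, hF0, mul_zero, sub_zero] at hz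
    have hzx' : 0 < z - x := sub_pos.mpr hzx
    have h3 : a z * F' z < 0 := by
      by_contra h
      push Not at h
      exact absurd (div_nonneg h hzx'.le) (not_le.mpr hz)
    by_contra h
    push Not at h
    exact absurd (mul_nonneg (ha z).le h) (not_le.mpr h3)
  obtain ⟨b, hb, hb2⟩ := mem_nhdsGT_iff_exists_Ioo_subset.mp h2
  obtain ⟨l, u, hlu, hlu2⟩ := mem_nhds_iff_exists_Ioo_subset.mp (hF.and hmin)
  -- pick z in (x, min b u)
  obtain ⟨z, hz1, hz2⟩ := exists_between (lt_min hb hlu.2)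
  have hz2b := lt_of_lt_of_le hz2 (min_le_left _ _)
  have hz2u := lt_of_lt_of_le hz2 (min_le_right _ _)
  have hin : ∀ v, x ≤ v → v ≤ z → HasDerivAt F (F' v) v ∧ F x ≤ F v := fun v h1 h2 =>
    hlu2 ⟨hlu.1.trans_le h1, h2.trans_lt hz2u⟩
  obtain ⟨c, hc, hc2⟩ := exists_hasDerivAt_eq_slope F F' hz1
    (fun v hv => (hin v hv.1 hv.2).1.continuousAt.continuousWithinAt)
    (fun v hv => (hin v hv.1.le hv.2.le).1)
  have h5 : F' c < 0 := hb2 ⟨hc.1, hc.2.trans hz2b⟩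
  rw [hc2] at h5
  have h6 := (hin z hz1.le le_rfl).2
  have : 0 ≤ (F z - F x) / (z - x) := div_nonneg (by linarith) (by linarith)
  linarith

/-! ### Part 2 -/
/-- the semigroup identity involves genuine integrals -/
theorem nojunk {V : ℝ → ℝ → ℝ} {f F θ : ℝ → ℝ} {c M : ℝ}
    (hV : ∀ x z, 0 ≤ V x z) (hVc : ∀ z, Continuous (fun x => V x z))
    (hf : ∀ z, 0 ≤ f z) (hfc : Continuous f) (hF : ∀ x, 0 ≤ F x) (hFc : Continuous F)
    (hθ : ∀ x, 0 < θ x) (hθc : Continuous θ) (hc : 0 ≤ c)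
    (hFV : ∀ x, F x = ∫ z, V x z * f z)
    (h1 : ∫⁻ x, ENNReal.ofReal (θ x * F x) = ENNReal.ofReal M)
    (h2 : ∫⁻ z, ENNReal.ofReal (c * θ z * f z) = ENNReal.ofReal M)
    (h3 : ∀ z, ∫⁻ x, ENNReal.ofReal (θ x * V x z) = ENNReal.ofReal (c * θ z)) (x : ℝ) :
    Integrable (fun z => V x z * f z) := by
  set P : Set ℝ := {x | 0 < F x} with hP
  have hPo : IsOpen P := isOpen_lt continuous_const hFc
  have hPm : MeasurableSet P := hPo.measurableSet
  have hintg : ∀ x ∈ P, Integrable (fun z => V x z * f z) := by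
    intro x hx
    by_contra h
    have := hFV x
    rw [integral_undef h] at this
    have hx' : 0 < F x := hx
    linarith
  have hlint : ∀ x ∈ P, ∫⁻ z, ENNReal.ofReal (V x z * f z) = ENNReal.ofReal (F x) := by
    intro x hx
    rw [hFV x, ofReal_integral_eq_lintegral_ofReal (hintg x hx)
      (Eventually.of_forall fun z => mul_nonneg (hV x z) (hf z))]
  -- countable dense set
  obtain ⟨D, hDc, hDd⟩ := TopologicalSpace.exists_countable_dense P
  have hae : ∀ x : P, AEMeasurable (fun z => V x z * f z) volume :=
    fun x => (hintg x x.2).aestronglyMeasurable.aemeasurable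
  set N0 : Set ℝ := ⋃ x ∈ D, {z | ¬ (V x z * f z = (hae x).mk _ z)} with hN0
  have hN0z : volume N0 = 0 := by
    rw [hN0, measure_biUnion_null_iff hDc]
    intro x _
    exact (hae x).ae_eq_mk
  set N : Set ℝ := toMeasurable volume N0 with hN
  have hNm : MeasurableSet N := measurableSet_toMeasurable _ _
  have hNz : volume N = 0 := by rw [hN, measure_toMeasurable, hN0z]
  have hN0N : N0 ⊆ N := subset_toMeasurable _ _
  set g : P → ℝ → ℝ := fun x => Nᶜ.indicator (fun z => V x z * f z) with hg
  have hgc : ∀ z, Continuous fun x : P => g x z := by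
    intro z
    by_cases hz : z ∈ N
    · simp only [hg]
      have : ∀ x : P, Nᶜ.indicator (fun z => V x z * f z) z = 0 := fun x =>
        Set.indicator_of_notMem (by simpa using hz) _
      simp only [this]; exact continuous_const
    · have : ∀ x : P, Nᶜ.indicator (fun z => V x z * f z) z = V x z * f z := fun x =>
        Set.indicator_of_mem (by simpa using hz) _
      simp only [hg, this]
      exact ((hVc z).comp continuous_subtype_val).mul continuous_const
  have hgD : ∀ x ∈ D, Measurable (g x) := by
    intro x hx
    have : g x = Nᶜ.indicator ((hae x).mk _) := by
      ext z
      by_cases hz : z ∈ N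
      · simp [hg, hz]
      · simp only [hg]
        rw [Set.indicator_of_mem (by simpa using hz), Set.indicator_of_mem (by simpa using hz)]
        by_contra hne
        exact hz (hN0N (Set.mem_biUnion hx hne))
    rw [this]
    exact (hae x).measurable_mk.indicator hNm.compl
  have hgm : ∀ x, Measurable (g x) := by
    intro x
    obtain ⟨u, hu, hux⟩ := mem_closure_iff_seq_limit.mp (hDd x)
    refine measurable_of_tendsto_metrizable (fun n => hgD (u n) (hu n)) ?_
    rw [tendsto_pi_nhds]
    intro z
    exact ((hgc z).tendsto x).comp hux
  have hgu : Measurable (Function.uncurry g) :=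
    measurable_uncurry_of_continuous_of_measurable hgc hgm
  have hNae : ∀ᵐ z ∂(volume : Measure ℝ), z ∉ N := measure_eq_zero_iff_ae_notMem.mp hNz
  have hgae : ∀ x : P, ∀ z, z ∉ N → g x z = V x z * f z := fun x z hz =>
    Set.indicator_of_mem (by simpa using hz) _
  -- Tonelli
  let ν : Measure P := volume.comap Subtype.val
  have hsf : SFinite ν := by
    have : SigmaFinite ν := by
      refine SigmaFinite.of_map ν (f := Subtype.val) measurable_subtype_coe.aemeasurable ?_
      rw [map_comap_subtype_coe hPm]
      infer_instance
    infer_instance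
  have hT : ∫⁻ x : P, ∫⁻ z, ENNReal.ofReal (θ x * g x z) ∂volume ∂ν
      = ∫⁻ z, ∫⁻ x : P, ENNReal.ofReal (θ x * g x z) ∂ν ∂volume := by
    apply lintegral_lintegral_swap
    apply Measurable.aemeasurable
    apply ENNReal.measurable_ofReal.comp
    exact ((hθc.measurable.comp measurable_subtype_coe).comp measurable_fst).mul hgu
  have hL : ∫⁻ x : P, ∫⁻ z, ENNReal.ofReal (θ x * g x z) ∂volume ∂ν = ENNReal.ofReal M := by
    have : ∀ x : P, ∫⁻ z, ENNReal.ofReal (θ x * g x z) ∂volume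
        = ENNReal.ofReal (θ x * F x) := by
      intro x
      simp_rw [ENNReal.ofReal_mul (hθ x).le]
      rw [lintegral_const_mul' _ _ ENNReal.ofReal_ne_top, ← hlint x x.2]
      congr 1
      apply lintegral_congr_ae
      filter_upwards [hNae] with z hz
      rw [hgae x z hz]
    simp_rw [this]
    rw [lintegral_subtype_comap hPm (fun x => ENNReal.ofReal (θ x * F x)), ← h1,
      ← lintegral_indicator hPm]
    apply lintegral_congr
    intro x
    by_cases hx : x ∈ P
    · simp [hx]
    · have : F x = 0 := le_antisymm (not_lt.mp hx) (hF x)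
      simp [hx, this]
  have hR : ∫⁻ z, ENNReal.ofReal (f z) * ∫⁻ x in P, ENNReal.ofReal (θ x * V x z)
      = ENNReal.ofReal M := by
    rw [← hL, hT]
    apply lintegral_congr_ae
    filter_upwards [hNae] with z hz
    rw [← lintegral_subtype_comap hPm (fun x => ENNReal.ofReal (θ x * V x z)),
      ← lintegral_const_mul']
    · apply lintegral_congr
      intro x
      rw [hgae x z hz, ← ENNReal.ofReal_mul (hf z)]
      congr 1; ring
    · exact ENNReal.ofReal_ne_top
  have hle : ∀ z, ∫⁻ x in P, ENNReal.ofReal (θ x * V x z) ≤ ENNReal.ofReal (c * θ z) := by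
    intro z
    rw [← h3 z]
    exact setLIntegral_le_lintegral _ _
  have heq : (fun z => ENNReal.ofReal (f z) * ∫⁻ x in P, ENNReal.ofReal (θ x * V x z))
      =ᵐ[volume] (fun z => ENNReal.ofReal (c * θ z * f z)) := by
    apply ae_eq_of_ae_le_of_lintegral_le
    · refine Eventually.of_forall fun z => ?_
      simp only
      rw [mul_comm (c * θ z), ENNReal.ofReal_mul (hf z)]
      gcongr
      exact hle z
    · rw [hR]; exact ENNReal.ofReal_ne_top
    · apply Measurable.aemeasurable
      apply ENNReal.measurable_ofReal.comp
      exact ((continuous_const.mul hθc).mul hfc).measurable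
    · rw [hR, h2]
  -- vanishing outside the closure of P
  have hvan : ∀ᵐ z ∂(volume : Measure ℝ), ∀ x, x ∉ closure P → V x z * f z = 0 := by
    filter_upwards [heq] with z hz
    intro x hx
    by_cases hfz : f z = 0
    · simp [hfz]
    have hfz' : 0 < f z := lt_of_le_of_ne (hf z) (Ne.symm hfz)
    have hE : ∫⁻ x in P, ENNReal.ofReal (θ x * V x z) = ∫⁻ x, ENNReal.ofReal (θ x * V x z) := by
      rw [h3 z]
      have hz' := hz
      rw [mul_comm (c * θ z), ENNReal.ofReal_mul (hf z)] at hz'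
      exact (ENNReal.mul_right_inj (by simpa using hfz') ENNReal.ofReal_ne_top).mp hz'
    have hcompl : ∫⁻ x in Pᶜ, ENNReal.ofReal (θ x * V x z) = 0 := by
      have := lintegral_add_compl (μ := volume) (fun x => ENNReal.ofReal (θ x * V x z)) hPm
      rw [hE] at this
      have hfin : ∫⁻ x, ENNReal.ofReal (θ x * V x z) ≠ ⊤ := by
        rw [h3 z]; exact ENNReal.ofReal_ne_top
      by_contra hne
      exact absurd this (ENNReal.lt_add_right hfin hne).ne'
    have hcl : ∫⁻ x in (closure P)ᶜ, ENNReal.ofReal (θ x * V x z) = 0 :=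
      le_antisymm ((lintegral_mono_set (Set.compl_subset_compl.mpr subset_closure)).trans
        hcompl.le) (zero_le)
    have hVx : V x z = 0 := by
      by_contra hne
      have hVpos : 0 < V x z := lt_of_le_of_ne (hV x z) (Ne.symm hne)
      have hmeas : Measurable fun x => ENNReal.ofReal (θ x * V x z) :=
        ENNReal.measurable_ofReal.comp (hθc.mul (hVc z)).measurable
      rw [lintegral_eq_zero_iff hmeas] at hcl
      have hopen : IsOpen ((closure P)ᶜ ∩ {x | 0 < θ x * V x z}) :=
        isClosed_closure.isOpen_compl.inter (isOpen_lt continuous_const (hθc.mul (hVc z)))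
      have hne' : ((closure P)ᶜ ∩ {x | 0 < θ x * V x z}).Nonempty :=
        ⟨x, hx, mul_pos (hθ x) hVpos⟩
      have hpos := hopen.measure_pos volume hne'
      rw [EventuallyEq, ae_restrict_iff' isClosed_closure.isOpen_compl.measurableSet] at hcl
      have : volume ((closure P)ᶜ ∩ {x | 0 < θ x * V x z}) = 0 := by
        refine measure_mono_null ?_ hcl
        intro v hv
        simp only [Set.mem_compl_iff, Set.mem_ofPred_eq]
        intro h
        have := h hv.1
        simp only [Pi.zero_apply, ENNReal.ofReal_eq_zero] at this
        exact absurd hv.2 (not_lt.mpr this)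
      exact absurd this hpos.ne'
    rw [hVx, zero_mul]
  by_cases hx : x ∈ P
  · exact hintg x hx
  have hFx : F x = 0 := le_antisymm (not_lt.mp hx) (hF x)
  by_cases hxc : x ∈ closure P
  · obtain ⟨u, hu, hux⟩ := mem_closure_iff_seq_limit.mp hxc
    have hlim : ∀ z, Tendsto (fun n => V (u n) z * f z) atTop (nhds (V x z * f z)) := fun z =>
      (((hVc z).tendsto x).comp hux).mul_const _
    have hm : AEMeasurable (fun z => V x z * f z) volume :=
      aemeasurable_of_tendsto_metrizable_ae atTop
        (fun n => (hintg (u n) (hu n)).aestronglyMeasurable.aemeasurable)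
        (Eventually.of_forall hlim)
    refine ⟨hm.aestronglyMeasurable, ?_⟩
    rw [hasFiniteIntegral_iff_ofReal (Eventually.of_forall fun z => mul_nonneg (hV x z) (hf z))]
    have hfat := lintegral_liminf_le' (μ := volume) (u := atTop)
      (f := fun n z => ENNReal.ofReal (V (u n) z * f z))
      (fun n => (hintg (u n) (hu n)).aestronglyMeasurable.aemeasurable.ennreal_ofReal)
    have e1 : ∀ z, liminf (fun n => ENNReal.ofReal (V (u n) z * f z)) atTop
        = ENNReal.ofReal (V x z * f z) := fun z =>
      (ENNReal.tendsto_ofReal (hlim z)).liminf_eq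
    have e2 : liminf (fun n => ∫⁻ z, ENNReal.ofReal (V (u n) z * f z)) atTop
        = ENNReal.ofReal (F x) := by
      apply Tendsto.liminf_eq
      simp_rw [fun n => hlint (u n) (hu n)]
      exact ENNReal.tendsto_ofReal ((hFc.tendsto x).comp hux)
    simp_rw [e1] at hfat
    rw [e2] at hfat
    exact hfat.trans_lt ENNReal.ofReal_lt_top
  · refine (integrable_zero ℝ ℝ volume).congr ?_
    filter_upwards [hvan] with z hz
    exact (hz x hxc).symm

/-! ### Part 3 -/
theorem fund_integrable {U : ℝ → ℝ → ℝ → ℝ} {θ : ℝ → ℝ} {γ : ℝ}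
    (hnn : ∀ t, 0 < t → ∀ x y, 0 ≤ U t x y)
    (hcx : ∀ t, 0 < t → ∀ y, Continuous fun x => U t x y)
    (hθ : ∀ x, 0 < θ x) (hθc : Continuous θ)
    (hadj : ∀ t : ℝ, 0 < t → ∀ y : ℝ, ∫ x : ℝ, θ x * U t x y = Real.exp (γ * t) * θ y)
    {t : ℝ} (ht : 0 < t) (y : ℝ) : Integrable (fun x => θ x * U t x y) := by
  by_contra h
  have h1 := hadj t ht y
  rw [integral_undef h] at h1
  have := mul_pos (Real.exp_pos (γ * t)) (hθ y)
  linarith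

theorem fund_lintegral {U : ℝ → ℝ → ℝ → ℝ} {θ : ℝ → ℝ} {γ : ℝ}
    (hnn : ∀ t, 0 < t → ∀ x y, 0 ≤ U t x y)
    (hcx : ∀ t, 0 < t → ∀ y, Continuous fun x => U t x y)
    (hθ : ∀ x, 0 < θ x) (hθc : Continuous θ)
    (hadj : ∀ t : ℝ, 0 < t → ∀ y : ℝ, ∫ x : ℝ, θ x * U t x y = Real.exp (γ * t) * θ y)
    {t : ℝ} (ht : 0 < t) (y : ℝ) :
    ∫⁻ x, ENNReal.ofReal (θ x * U t x y) = ENNReal.ofReal (Real.exp (γ * t) * θ y) := by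
  rw [← hadj t ht y, ofReal_integral_eq_lintegral_ofReal
    (fund_integrable hnn hcx hθ hθc hadj ht y)
    (Eventually.of_forall fun x => mul_nonneg (hθ x).le (hnn t ht x y))]

theorem fund_semigroup_integrable {U : ℝ → ℝ → ℝ → ℝ} {θ : ℝ → ℝ} {γ : ℝ}
    (hnn : ∀ t, 0 < t → ∀ x y, 0 ≤ U t x y)
    (hcx : ∀ t, 0 < t → ∀ y, Continuous fun x => U t x y)
    (hθ : ∀ x, 0 < θ x) (hθc : Continuous θ)
    (hadj : ∀ t : ℝ, 0 < t → ∀ y : ℝ, ∫ x : ℝ, θ x * U t x y = Real.exp (γ * t) * θ y)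
    (hsg : ∀ s t : ℝ, 0 < s → 0 < t → ∀ x y : ℝ, U (t + s) x y = ∫ z : ℝ, U t x z * U s z y)
    {s t : ℝ} (hs : 0 < s) (ht : 0 < t) (x y : ℝ) :
    Integrable (fun z => U t x z * U s z y) := by
  have hts : 0 < t + s := by linarith
  refine nojunk (V := fun x z => U t x z) (f := fun z => U s z y) (F := fun x => U (t + s) x y)
    (θ := θ) (c := Real.exp (γ * t)) (M := Real.exp (γ * (t + s)) * θ y)
    (hnn t ht) (hcx t ht) (fun z => hnn s hs z y) (hcx s hs y) (fun x => hnn _ hts x y)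
    (hcx _ hts y) hθ hθc (Real.exp_pos _).le (fun x => hsg s t hs ht x y) ?_ ?_ ?_ x
  · exact fund_lintegral hnn hcx hθ hθc hadj hts y
  · have h := fund_lintegral hnn hcx hθ hθc hadj hs y
    simp_rw [mul_assoc, ENNReal.ofReal_mul (Real.exp_pos (γ * t)).le]
    rw [lintegral_const_mul' _ _ ENNReal.ofReal_ne_top, h, ← ENNReal.ofReal_mul (Real.exp_pos _).le,
      ← mul_assoc, ← Real.exp_add]
    congr 3; ring
  · intro z
    exact fund_lintegral hnn hcx hθ hθc hadj ht z

theorem fund_lsc {U : ℝ → ℝ → ℝ → ℝ} {θ : ℝ → ℝ} {γ : ℝ}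
    (hnn : ∀ t, 0 < t → ∀ x y, 0 ≤ U t x y)
    (hcx : ∀ t, 0 < t → ∀ y, Continuous fun x => U t x y)
    (hct : ∀ t, 0 < t → ∀ x y, ContinuousAt (fun τ => U τ x y) t)
    (hθ : ∀ x, 0 < θ x) (hθc : Continuous θ)
    (hadj : ∀ t : ℝ, 0 < t → ∀ y : ℝ, ∫ x : ℝ, θ x * U t x y = Real.exp (γ * t) * θ y)
    (hsg : ∀ s t : ℝ, 0 < s → 0 < t → ∀ x y : ℝ, U (t + s) x y = ∫ z : ℝ, U t x z * U s z y)
    (y : ℝ) :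
    LowerSemicontinuousOn (fun p : ℝ × ℝ => U p.1 p.2 y) (Set.Ioi 0 ×ˢ Set.univ) := by
  rintro ⟨τ, x⟩ ⟨hτ, -⟩ c hc
  simp only [Set.mem_Ioi] at hτ hc
  have key : ∀ᶠ q : ℝ × ℝ in nhds (τ, x), c < U q.1 q.2 y := by
    by_contra hcon
    have hfr : ∃ᶠ q : ℝ × ℝ in nhds (τ, x), ¬ (c < U q.1 q.2 y) := by
      rw [Filter.Frequently]; simpa using hcon
    have hτ2 : τ / 2 < τ := by linarith
    have hev : ∀ᶠ q : ℝ × ℝ in nhds (τ, x), τ / 2 < q.1 :=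
      continuous_fst.continuousAt.eventually_const_lt hτ2
    obtain ⟨u, hu, hu2⟩ := exists_seq_forall_of_frequently (hfr.and_eventually hev)
    have ht : 0 < τ / 2 := by linarith
    have hu1 : Tendsto (fun n => (u n).1) atTop (nhds τ) := (continuous_fst.tendsto _).comp hu
    have hu1' : Tendsto (fun n => (u n).1 - τ / 2) atTop (nhds (τ / 2)) := by
      have := hu1.sub_const (τ / 2)
      simpa [sub_half] using this
    have hux : Tendsto (fun n => (u n).2) atTop (nhds x) := (continuous_snd.tendsto _).comp hu
    have hI : ∀ n, Integrable (fun z => U (τ / 2) (u n).2 z * U ((u n).1 - τ / 2) z y) := fun n =>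
      fund_semigroup_integrable hnn hcx hθ hθc hadj hsg (by linarith [(hu2 n).2]) ht _ _
    have hval : ∀ n, ∫⁻ z, ENNReal.ofReal (U (τ / 2) (u n).2 z * U ((u n).1 - τ / 2) z y)
        = ENNReal.ofReal (U (u n).1 (u n).2 y) := by
      intro n
      have hpos : 0 < (u n).1 - τ / 2 := by linarith [(hu2 n).2]
      have := hsg ((u n).1 - τ / 2) (τ / 2) hpos ht (u n).2 y
      rw [add_sub_cancel] at this
      rw [this, ofReal_integral_eq_lintegral_ofReal (hI n)
        (Eventually.of_forall fun z => mul_nonneg (hnn _ ht _ _) (hnn _ hpos _ _))]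
    have hval0 : ∫⁻ z, ENNReal.ofReal (U (τ / 2) x z * U (τ / 2) z y)
        = ENNReal.ofReal (U τ x y) := by
      have := hsg (τ / 2) (τ / 2) ht ht x y
      rw [add_halves] at this
      rw [this, ofReal_integral_eq_lintegral_ofReal
        (fund_semigroup_integrable hnn hcx hθ hθc hadj hsg ht ht _ _)
        (Eventually.of_forall fun z => mul_nonneg (hnn _ ht _ _) (hnn _ ht _ _))]
    have hfat := lintegral_liminf_le' (μ := volume) (u := atTop)
      (f := fun n z => ENNReal.ofReal (U (τ / 2) (u n).2 z * U ((u n).1 - τ / 2) z y))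
      (fun n => (hI n).aestronglyMeasurable.aemeasurable.ennreal_ofReal)
    have e1 : ∀ z, liminf (fun n => ENNReal.ofReal
        (U (τ / 2) (u n).2 z * U ((u n).1 - τ / 2) z y)) atTop
        = ENNReal.ofReal (U (τ / 2) x z * U (τ / 2) z y) := fun z =>
      (ENNReal.tendsto_ofReal ((((hcx _ ht z).tendsto x).comp hux).mul
        ((hct _ ht z y).tendsto.comp hu1'))).liminf_eq
    simp_rw [e1, hval] at hfat
    rw [hval0] at hfat
    have hle : liminf (fun n => ENNReal.ofReal (U (u n).1 (u n).2 y)) atTop ≤ ENNReal.ofReal c := by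
      refine (liminf_le_liminf (Eventually.of_forall fun n =>
        ENNReal.ofReal_le_ofReal (not_lt.mp (hu2 n).1))).trans ?_
      simp
    have h0c : 0 ≤ c := (hnn _ (ht.trans (hu2 0).2) _ _).trans (not_lt.mp (hu2 0).1)
    have := (ENNReal.ofReal_le_ofReal_iff h0c).mp (hfat.trans hle)
    linarith
  exact nhdsWithin_le_nhds key

/-! ### Part 4 -/
/-- positive solution of `(a u')' = q u` -/
structure PosSol (a q u u' : ℝ → ℝ) : Prop where
  pos : ∀ x, 0 < u x
  d1 : ∀ x, HasDerivAt u (u' x) x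
  d2 : ∀ x, HasDerivAt (fun y => a y * u' y) (q x * u x) x

theorem PosSol.neg {a q u u' : ℝ → ℝ} (h : PosSol a q u u') :
    PosSol (fun x => a (-x)) (fun x => q (-x)) (fun x => u (-x)) (fun x => -u' (-x)) where
  pos x := h.pos _
  d1 x := by
    refine ((h.d1 (-x)).comp x (hasDerivAt_neg x)).congr_deriv ?_
    simp
  d2 x := by
    have := ((h.d2 (-x)).comp x (hasDerivAt_neg x)).neg
    have e : (fun y => a (-y) * -u' (-y)) = -((fun y => a y * u' y) ∘ Neg.neg) := by
      ext y; simp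
    rw [e]
    simpa using this

theorem PosSol.cont {a q u u' : ℝ → ℝ} (h : PosSol a q u u') : Continuous u :=
  continuous_iff_continuousAt.mpr fun x => (h.d1 x).continuousAt

theorem PosSol.cont' {a q u u' : ℝ → ℝ} (h : PosSol a q u u') (ha : Continuous a)
    (hapos : ∀ x, 0 < a x) : Continuous u' := by
  have h1 : Continuous fun y => a y * u' y :=
    continuous_iff_continuousAt.mpr fun x => (h.d2 x).continuousAt
  have h2 : u' = fun y => (a y * u' y) / a y := by
    ext y; field_simp [(hapos y).ne']
  rw [h2]
  exact h1.div ha fun y => (hapos y).ne'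

theorem PosSol.lower {a q u u' : ℝ → ℝ} (h : PosSol a q u u') {μ k P : ℝ} (hμ : 1 ≤ μ)
    (ha : ∀ x, 1 / μ ≤ a x ∧ a x ≤ μ) (hq : ∀ x, |q x| ≤ k) (hP : 0 < P) (hP2 : 2 * k * μ ≤ P ^ 2)
    (x : ℝ) : -P * u x ≤ a x * u' x := by
  have hμ0 : 0 < μ := by linarith
  have hapos : ∀ x, 0 < a x := fun x => lt_of_lt_of_le (by positivity) (ha x).1
  by_contra hcon
  push Not at hcon
  set p : ℝ → ℝ := fun x => a x * u' x / u x with hp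
  have hpd : ∀ x, HasDerivAt p (q x - p x ^ 2 / a x) x := by
    intro x
    have := (h.d2 x).div (h.d1 x) (h.pos x).ne'
    refine this.congr_deriv ?_
    have h1 := (h.pos x).ne'
    have h2 := (hapos x).ne'
    simp only [hp]
    field_simp
  have hp0 : p x < -P := by
    simp only [hp]; rw [div_lt_iff₀ (h.pos x)]; exact hcon
  have hder : ∀ z, p z ≤ p x → q z - p z ^ 2 / a z ≤ - (p z ^ 2) / (2 * μ) := by
    intro z hz
    have h1 : P ^ 2 ≤ p z ^ 2 := by nlinarith
    have h2 : p z ^ 2 / μ ≤ p z ^ 2 / a z := by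
      apply div_le_div_of_nonneg_left (sq_nonneg _) (hapos z) (ha z).2
    have h3 := (abs_le.mp (hq z)).2
    have h4 : k ≤ p z ^ 2 / (2 * μ) := by
      rw [le_div_iff₀ (by positivity)]; nlinarith
    have h5 : p z ^ 2 / μ = p z ^ 2 / (2 * μ) + p z ^ 2 / (2 * μ) := by field_simp; ring
    rw [neg_div]
    linarith
  have hpc : Continuous p := continuous_iff_continuousAt.mpr fun x => (hpd x).continuousAt
  have hle : ∀ b, ∀ z ∈ Set.Icc x b, p z ≤ p x := by
    intro b
    refine image_le_of_deriv_right_lt_deriv_boundary (f := p) (B := fun _ => p x)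
      (B' := fun _ => 0) hpc.continuousOn (fun z _ => (hpd z).hasDerivWithinAt) le_rfl
      (fun z => hasDerivAt_const z _) ?_
    intro z _ hz
    have := hder z hz.le
    have h2 : 0 < p z ^ 2 := by
      rw [hz]; nlinarith
    have : - (p z ^ 2) / (2 * μ) < 0 := by
      rw [neg_div, neg_lt_zero]; positivity
    linarith
  have hneg : ∀ z, x ≤ z → p z < -P := fun z hz => (hle z z ⟨hz, le_rfl⟩).trans_lt hp0
  -- 1/p is increasing fast
  set b := x + 2 * μ / P with hb
  have hxb : x < b := by rw [hb]; have : 0 < 2 * μ / P := by positivity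
                         linarith
  obtain ⟨c, hc, hc2⟩ := exists_hasDerivAt_eq_slope (fun z => (p z)⁻¹)
    (fun z => - (q z - p z ^ 2 / a z) / p z ^ 2) hxb
    (fun z hz => (hpc.continuousAt.inv₀ (by linarith [hneg z hz.1])).continuousWithinAt)
    (fun z hz => (hpd z).inv (by linarith [hneg z hz.1.le]))
  have h1 := hder c (hle c c ⟨hc.1.le, le_rfl⟩)
  have hpc2 : 0 < p c ^ 2 := by
    have := hneg c hc.1.le
    nlinarith
  have h2 : 1 / (2 * μ) ≤ - (q c - p c ^ 2 / a c) / p c ^ 2 := by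
    rw [le_div_iff₀ hpc2]
    have : 1 / (2 * μ) * p c ^ 2 = - (- (p c ^ 2) / (2 * μ)) := by field_simp
    rw [this]; linarith
  rw [hc2, le_div_iff₀ (by linarith)] at h2
  have h3 : 1 / (2 * μ) * (b - x) = 1 / P := by
    rw [hb]; field_simp; ring
  rw [h3] at h2
  have h4 : (p b)⁻¹ < 0 := inv_lt_zero.mpr (by linarith [hneg b hxb.le])
  have h5 : -(1 / P) < (p x)⁻¹ := by
    have : (-P)⁻¹ < (p x)⁻¹ := (inv_lt_inv_of_neg (by linarith) (by linarith)).mpr hp0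
    rw [inv_neg] at this
    simpa using this
  linarith

theorem PosSol.bound {a q u u' : ℝ → ℝ} (h : PosSol a q u u') {μ k P : ℝ} (hμ : 1 ≤ μ)
    (ha : ∀ x, 1 / μ ≤ a x ∧ a x ≤ μ) (hq : ∀ x, |q x| ≤ k) (hP : 0 < P) (hP2 : 2 * k * μ ≤ P ^ 2)
    (x : ℝ) : |a x * u' x| ≤ P * u x := by
  rw [abs_le]
  constructor
  · have := h.lower hμ ha hq hP hP2 x
    linarith
  · have := h.neg.lower hμ (fun x => ha (-x)) (fun x => hq (-x)) hP hP2 (-x)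
    simp only [neg_neg] at this
    linarith

/-- exponential Harnack bound -/
theorem PosSol.harnack {a q u u' : ℝ → ℝ} (h : PosSol a q u u') {μ P : ℝ} (hμ : 1 ≤ μ)
    (ha : ∀ x, 1 / μ ≤ a x ∧ a x ≤ μ) (hb : ∀ x, |a x * u' x| ≤ P * u x)
    (x w : ℝ) : u x ≤ u w * Real.exp (P * μ * |x - w|) := by
  have hμ0 : 0 < μ := by linarith
  have hapos : ∀ x, 0 < a x := fun x => lt_of_lt_of_le (by positivity) (ha x).1
  have hd : ∀ z, HasDerivAt (fun z => Real.log (u z)) (u' z / u z) z := fun z =>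
    (h.d1 z).log (h.pos z).ne'
  have hbd : ∀ z, ‖u' z / u z‖ ≤ P * μ := by
    intro z
    rw [Real.norm_eq_abs, abs_div, abs_of_pos (h.pos z), div_le_iff₀ (h.pos z)]
    have h1 := hb z
    rw [abs_mul, abs_of_pos (hapos z)] at h1
    have h2 : 1 / μ * |u' z| ≤ a z * |u' z| :=
      mul_le_mul_of_nonneg_right (ha z).1 (abs_nonneg _)
    have h3 : 1 / μ * |u' z| ≤ P * u z := h2.trans h1
    rw [div_mul_eq_mul_div, one_mul, div_le_iff₀ hμ0] at h3
    linarith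
  have := Convex.norm_image_sub_le_of_norm_hasDerivWithin_le (s := Set.univ)
    (fun z _ => (hd z).hasDerivWithinAt) (fun z _ => hbd z) convex_univ
    (Set.mem_univ w) (Set.mem_univ x)
  rw [Real.norm_eq_abs, Real.norm_eq_abs] at this
  have h2 := (abs_le.mp this).2
  rw [← Real.log_le_log_iff (h.pos x) (mul_pos (h.pos w) (Real.exp_pos _)),
    Real.log_mul (h.pos w).ne' (Real.exp_pos _).ne', Real.log_exp]
  linarith

theorem wronskian_const {a q u u' v v' : ℝ → ℝ} (hu : PosSol a q u u') (hv : PosSol a q v v')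
    (x : ℝ) : a x * (v' x * u x - u' x * v x) = a 0 * (v' 0 * u 0 - u' 0 * v 0) := by
  have hd : ∀ x, HasDerivAt (fun x => (a x * v' x) * u x - (a x * u' x) * v x) 0 x := by
    intro x
    refine (((hv.d2 x).mul (hu.d1 x)).sub ((hu.d2 x).mul (hv.d1 x))).congr_deriv ?_
    ring
  have := is_const_of_deriv_eq_zero (fun x => (hd x).differentiableAt) (fun x => (hd x).deriv) x 0
  linarith

/-! ### Part 5 -/
theorem hcs_of_zero {f g : ℝ → ℝ} (h : HasCompactSupport f) (hg : ∀ x, f x = 0 → g x = 0) :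
    HasCompactSupport g :=
  h.mono fun x hx hf => hx (hg x hf)

theorem rayleigh_ineq {μ : ℝ} (hμ : 1 ≤ μ) {a r : ℝ → ℝ}
    (hac : Continuous a) (hrc : Continuous r)
    (ha : ∀ x, 1 / μ ≤ a x ∧ a x ≤ μ) (hr : ∀ x, |r x| ≤ μ)
    {γ : ℝ} {ψ : ℝ → ℝ} (hψ : ContDiff ℝ 1 ψ) (hψc : HasCompactSupport ψ) :
    (γ - gammaBar a r) * ∫ x, ψ x ^ 2 ≤
      ∫ x, (a x * deriv ψ x ^ 2 + (γ - r x) * ψ x ^ 2) := by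
  have hμ0 : 0 < μ := by linarith
  have hapos : ∀ x, 0 < a x := fun x => lt_of_lt_of_le (by positivity) (ha x).1
  have key : ∀ ψ : ℝ → ℝ, ContDiff ℝ 1 ψ → HasCompactSupport ψ →
      Integrable (fun x => ψ x ^ 2) ∧ Integrable (fun x => r x * ψ x ^ 2) ∧
      Integrable (fun x => a x * deriv ψ x ^ 2) := by
    intro ψ hψ hψc
    have hd : Continuous (deriv ψ) := hψ.continuous_deriv le_rfl
    have hdc : HasCompactSupport (deriv ψ) := hψc.deriv
    refine ⟨?_, ?_, ?_⟩
    · exact (hψ.continuous.pow 2).integrable_of_hasCompactSupport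
        (hcs_of_zero hψc fun x hx => by simp [hx])
    · exact (hrc.mul (hψ.continuous.pow 2)).integrable_of_hasCompactSupport
        (hcs_of_zero hψc fun x hx => by simp [hx])
    · exact (hac.mul (hd.pow 2)).integrable_of_hasCompactSupport
        (hcs_of_zero hdc fun x hx => by simp [hx])
  have hpos : ∀ ψ : ℝ → ℝ, ContDiff ℝ 1 ψ → HasCompactSupport ψ → ψ ≠ 0 →
      0 < ∫ x, ψ x ^ 2 := by
    intro ψ hψ hψc hne
    obtain ⟨x0, hx0⟩ := Function.ne_iff.mp hne
    exact (hψ.continuous.pow 2).integral_pos_of_hasCompactSupport_nonneg_nonzero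
      (hcs_of_zero hψc fun x hx => by simp [hx]) (fun x => sq_nonneg _)
      (x := x0) (by simpa using hx0)
  have hbdd : BddAbove {c : ℝ | ∃ φ : ℝ → ℝ, ContDiff ℝ 1 φ ∧ HasCompactSupport φ ∧ φ ≠ 0 ∧
      c = (∫ x : ℝ, (r x * φ x ^ 2 - a x * deriv φ x ^ 2)) / ∫ x : ℝ, φ x ^ 2} := by
    refine ⟨μ, ?_⟩
    rintro c ⟨φ, h1, h2, h3, rfl⟩
    rw [div_le_iff₀ (hpos φ h1 h2 h3), ← integral_const_mul]
    obtain ⟨i1, i2, i3⟩ := key φ h1 h2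
    apply integral_mono (i2.sub i3) (i1.const_mul μ)
    intro x
    have := (abs_le.mp (hr x)).2
    have h4 : 0 ≤ a x * deriv φ x ^ 2 := mul_nonneg (hapos x).le (sq_nonneg _)
    have h5 : r x * φ x ^ 2 ≤ μ * φ x ^ 2 := mul_le_mul_of_nonneg_right this (sq_nonneg _)
    simp only [Pi.sub_apply]
    linarith
  obtain ⟨i1, i2, i3⟩ := key ψ hψ hψc
  have hsplit : ∫ x, (a x * deriv ψ x ^ 2 + (γ - r x) * ψ x ^ 2)
      = γ * (∫ x, ψ x ^ 2) - ∫ x, (r x * ψ x ^ 2 - a x * deriv ψ x ^ 2) := by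
    rw [← integral_const_mul, ← integral_sub (i1.const_mul γ)
      (show Integrable (fun x => r x * ψ x ^ 2 - a x * deriv ψ x ^ 2) from i2.sub i3)]
    congr 1; ext x; ring
  rw [hsplit]
  by_cases h0 : ψ = 0
  · simp [h0]
  have hp := hpos ψ hψ hψc h0
  have hle : (∫ x : ℝ, (r x * ψ x ^ 2 - a x * deriv ψ x ^ 2)) / ∫ x : ℝ, ψ x ^ 2
      ≤ gammaBar a r := le_csSup hbdd ⟨ψ, hψ, hψc, h0, rfl⟩
  rw [div_le_iff₀ hp] at hle
  linarith

theorem hardy_ineq {μ : ℝ} (hμ : 1 ≤ μ) {a r : ℝ → ℝ}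
    (hac : Continuous a) (hrc : Continuous r)
    (ha : ∀ x, 1 / μ ≤ a x ∧ a x ≤ μ) (hr : ∀ x, |r x| ≤ μ)
    {γ : ℝ} {u u' : ℝ → ℝ} (hu : PosSol a (fun x => γ - r x) u u')
    {η η' : ℝ → ℝ} (hη : ∀ x, HasDerivAt η (η' x) x) (hη' : Continuous η')
    (hηc : HasCompactSupport η) :
    (γ - gammaBar a r) * ∫ x, u x ^ 2 * η x ^ 2 ≤ ∫ x, a x * u x ^ 2 * η' x ^ 2 := by
  have hμ0 : 0 < μ := by linarith
  have hapos : ∀ x, 0 < a x := fun x => lt_of_lt_of_le (by positivity) (ha x).1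
  have hd : ∀ x, HasDerivAt (fun x => u x * η x) (u' x * η x + u x * η' x) x := fun x =>
    (hu.d1 x).mul (hη x)
  have hηcont : Continuous η := continuous_iff_continuousAt.mpr fun x => (hη x).continuousAt
  have hu'c := hu.cont' hac hapos
  have huc := hu.cont
  have hderiv : deriv (fun x => u x * η x) = fun x => u' x * η x + u x * η' x := by
    ext x; exact (hd x).deriv
  have hη'c : HasCompactSupport η' := by
    have : η' = deriv η := by ext x; exact (hη x).deriv.symm
    rw [this]; exact hηc.deriv
  have hC1 : ContDiff ℝ 1 (fun x => u x * η x) := by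
    rw [contDiff_one_iff_deriv]
    refine ⟨fun x => (hd x).differentiableAt, ?_⟩
    rw [hderiv]
    exact (hu'c.mul hηcont).add (huc.mul hη')
  have hR := rayleigh_ineq hμ hac hrc ha hr (γ := γ) hC1 (hcs_of_zero hηc fun x hx => by simp [hx])
  have h1 : ∫ x, (u x * η x) ^ 2 = ∫ x, u x ^ 2 * η x ^ 2 := by
    congr 1; ext x; ring
  -- the exact derivative term
  have hbc : Continuous fun x => a x * u' x := hac.mul hu'c
  have hG : ∀ x, HasDerivAt (fun x => (a x * u' x) * u x * η x ^ 2)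
      ((γ - r x) * u x ^ 2 * η x ^ 2 + a x * u' x ^ 2 * η x ^ 2
        + 2 * a x * u' x * u x * η x * η' x) x := by
    intro x
    refine (((hu.d2 x).mul (hu.d1 x)).mul ((hη x).pow 2)).congr_deriv ?_
    simp; ring
  have hGi : ∫ x, ((γ - r x) * u x ^ 2 * η x ^ 2 + a x * u' x ^ 2 * η x ^ 2
        + 2 * a x * u' x * u x * η x * η' x) = 0 := by
    apply integral_eq_zero_of_hasDerivAt_of_integrable hG
    · apply Continuous.integrable_of_hasCompactSupport
      · fun_prop
      · have : (fun x => (γ - r x) * u x ^ 2 * η x ^ 2 + a x * u' x ^ 2 * η x ^ 2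
          + 2 * a x * u' x * u x * η x * η' x) = fun x => η x *
            ((γ - r x) * u x ^ 2 * η x + a x * u' x ^ 2 * η x + 2 * a x * u' x * u x * η' x) := by
          ext x; ring
        rw [this]; exact hηc.mul_right
    · apply Continuous.integrable_of_hasCompactSupport
      · fun_prop
      · have : (fun x => (a x * u' x) * u x * η x ^ 2) = fun x => η x *
            ((a x * u' x) * u x * η x) := by ext x; ring
        rw [this]; exact hηc.mul_right
  have hGI : Integrable (fun x => ((γ - r x) * u x ^ 2 * η x ^ 2 + a x * u' x ^ 2 * η x ^ 2
        + 2 * a x * u' x * u x * η x * η' x)) := by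
    apply Continuous.integrable_of_hasCompactSupport
    · fun_prop
    · have : (fun x => (γ - r x) * u x ^ 2 * η x ^ 2 + a x * u' x ^ 2 * η x ^ 2
          + 2 * a x * u' x * u x * η x * η' x) = fun x => η x *
            ((γ - r x) * u x ^ 2 * η x + a x * u' x ^ 2 * η x + 2 * a x * u' x * u x * η' x) := by
        ext x; ring
      rw [this]; exact hηc.mul_right
  have hI2 : Integrable (fun x => a x * u x ^ 2 * η' x ^ 2) := by
    apply Continuous.integrable_of_hasCompactSupport
    · fun_prop
    · have : (fun x => a x * u x ^ 2 * η' x ^ 2) = fun x => η' x * (a x * u x ^ 2 * η' x) := by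
        ext x; ring
      rw [this]; exact hη'c.mul_right
  have h2 : ∫ x, (a x * deriv (fun x => u x * η x) x ^ 2 + (γ - r x) * (u x * η x) ^ 2)
      = ∫ x, a x * u x ^ 2 * η' x ^ 2 := by
    rw [hderiv]
    have : ∀ x, a x * (u' x * η x + u x * η' x) ^ 2 + (γ - r x) * (u x * η x) ^ 2
      = ((γ - r x) * u x ^ 2 * η x ^ 2 + a x * u' x ^ 2 * η x ^ 2
        + 2 * a x * u' x * u x * η x * η' x) + a x * u x ^ 2 * η' x ^ 2 := by
      intro x; ring
    simp_rw [this]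
    rw [integral_add hGI hI2, hGi, zero_add]
  rw [h1, h2] at hR
  exact hR

/-! ### Part 6 -/
theorem exists_cutoff : ∃ b b' : ℝ → ℝ, (∀ x, HasDerivAt b (b' x) x) ∧ Continuous b' ∧
    (∀ x, 0 ≤ b x ∧ b x ≤ 1) ∧ (∀ x, |x| ≤ 1 → b x = 1) ∧
    (∀ x, 2 ≤ |x| → b x = 0 ∧ b' x = 0) ∧ ∃ Cb, 0 < Cb ∧ ∀ x, |b' x| ≤ Cb := by
  let f : ContDiffBump (0 : ℝ) := ⟨1, 2, one_pos, one_lt_two⟩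
  have hc : ContDiff ℝ 1 (f : ℝ → ℝ) := f.contDiff
  have hd : ∀ x, HasDerivAt (f : ℝ → ℝ) (deriv f x) x := fun x =>
    (hc.differentiable (by norm_num) x).hasDerivAt
  have hcd : Continuous (deriv (f : ℝ → ℝ)) := hc.continuous_deriv le_rfl
  have hz : ∀ x : ℝ, 2 ≤ |x| → f x = 0 := fun x hx => by
    apply f.zero_of_le_dist
    simpa [Real.dist_eq] using hx
  obtain ⟨C, hC⟩ := f.hasCompactSupport.deriv.exists_bound_of_continuous hcd
  refine ⟨f, deriv f, hd, hcd, fun x => ⟨f.nonneg, f.le_one⟩, ?_, ?_, |C| + 1, by positivity, ?_⟩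
  · intro x hx
    apply f.one_of_mem_closedBall
    simpa [Real.dist_eq] using hx
  · intro x hx
    refine ⟨hz x hx, ?_⟩
    have hmin : IsLocalMin (f : ℝ → ℝ) x := by
      refine Eventually.of_forall fun y => ?_
      rw [hz x hx]; exact f.nonneg
    exact hmin.deriv_eq_zero
  · intro x
    have := hC x
    rw [Real.norm_eq_abs] at this
    linarith [le_abs_self C]

/-- data of the two eigenfunctions -/
structure Pair (μ γ ε0 P W : ℝ) (a r φ φ' φt φt' : ℝ → ℝ) : Prop where
  hμ : 1 ≤ μ
  hac : Continuous a
  hrc : Continuous r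
  ha : ∀ x, 1 / μ ≤ a x ∧ a x ≤ μ
  hr : ∀ x, |r x| ≤ μ
  hφ : PosSol a (fun x => γ - r x) φ φ'
  hφt : PosSol a (fun x => γ - r x) φt φt'
  lim : Tendsto φ atTop (nhds 0)
  limt : Tendsto φt atBot (nhds 0)
  one : φ 0 = 1
  onet : φt 0 = 1
  wr : ∀ x, a x * (φt' x * φ x - φ' x * φt x) = W
  hP : 0 < P
  bd : ∀ x, |a x * φ' x| ≤ P * φ x
  bdt : ∀ x, |a x * φt' x| ≤ P * φt x
  hε0 : 0 < ε0
  hardy : ∀ η η' : ℝ → ℝ, (∀ x, HasDerivAt η (η' x) x) → Continuous η' → HasCompactSupport η →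
    ε0 * ∫ x, φ x ^ 2 * η x ^ 2 ≤ ∫ x, a x * φ x ^ 2 * η' x ^ 2

section
variable {μ γ ε0 P W : ℝ} {a r φ φ' φt φt' : ℝ → ℝ}

theorem Pair.μpos (h : Pair μ γ ε0 P W a r φ φ' φt φt') : 0 < μ := by
  have := h.hμ; linarith

theorem Pair.apos (h : Pair μ γ ε0 P W a r φ φ' φt φt') (x : ℝ) : 0 < a x :=
  lt_of_lt_of_le (by have := h.μpos; positivity) (h.ha x).1

theorem Pair.ratio (h : Pair μ γ ε0 P W a r φ φ' φt φt') (x : ℝ) :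
    HasDerivAt (fun x => φt x / φ x) (W / (a x * φ x ^ 2)) x := by
  refine ((h.hφt.d1 x).div (h.hφ.d1 x) (h.hφ.pos x).ne').congr_deriv ?_
  have h1 := (h.hφ.pos x).ne'
  have h2 := (h.apos x).ne'
  rw [← h.wr x]
  field_simp

theorem bounded_of_tendsto {f : ℝ → ℝ} (hf : Continuous f) (hl : Tendsto f atTop (nhds 0)) :
    ∃ K, 0 < K ∧ ∀ x, 0 ≤ x → |f x| ≤ K := by
  have hev : ∀ᶠ x in atTop, |f x| < 1 := by
    have := (continuous_abs.tendsto (0:ℝ)).comp hl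
    rw [abs_zero] at this
    exact this.eventually_lt_const one_pos
  obtain ⟨A, hA⟩ := eventually_atTop.mp hev
  obtain ⟨C, hC⟩ := (isCompact_Icc (a := (0:ℝ)) (b := A)).exists_bound_of_continuousOn
    hf.continuousOn
  refine ⟨|C| + 1, by positivity, fun x hx => ?_⟩
  by_cases hxA : A ≤ x
  · have := hA x hxA
    have := abs_nonneg C
    linarith
  · have := hC x ⟨hx, (not_le.mp hxA).le⟩
    rw [Real.norm_eq_abs] at this
    linarith [le_abs_self C]

theorem Pair.Wpos (h : Pair μ γ ε0 P W a r φ φ' φt φt') : 0 < W := by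
  by_contra hW
  push Not at hW
  have hanti : Antitone (fun x => φt x / φ x) := by
    apply antitone_of_hasDerivAt_nonpos h.ratio
    intro x
    apply div_nonpos_of_nonpos_of_nonneg hW
    have := h.apos x
    positivity
  have hφle : ∀ x, x ≤ 0 → φ x ≤ φt x := by
    intro x hx
    have := hanti hx
    simp only [h.one, h.onet, div_one] at this
    rwa [le_div_iff₀ (h.hφ.pos x), one_mul] at this
  obtain ⟨K1, hK1, hb1⟩ := bounded_of_tendsto h.hφ.cont h.lim
  obtain ⟨K2, hK2, hb2⟩ := bounded_of_tendsto (f := fun x => φt (-x))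
    (h.hφt.cont.comp continuous_neg) (h.limt.comp tendsto_neg_atTop_atBot)
  set K := K1 + K2 with hK
  have hφK : ∀ x, φ x ≤ K := by
    intro x
    rcases le_total 0 x with hx | hx
    · have := hb1 x hx
      have := le_abs_self (φ x)
      linarith
    · have h1 := hb2 (-x) (by linarith)
      rw [neg_neg] at h1
      have := le_abs_self (φt x)
      have := hφle x hx
      linarith
  obtain ⟨b, b', hb, hb'c, hb01, hb1', hb2', Cb, hCb, hCb'⟩ := exists_cutoff
  have hbc : Continuous b := continuous_iff_continuousAt.mpr fun x => (hb x).continuousAt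
  have hφc := h.hφ.cont
  set I1 := ∫ x in Set.Icc (-1:ℝ) 1, φ x ^ 2 with hI1
  have hI1pos : 0 < I1 := by
    rw [hI1, integral_Icc_eq_integral_Ioc, ← intervalIntegral.integral_of_le (by norm_num)]
    apply intervalIntegral.intervalIntegral_pos_of_pos
    · exact (hφc.pow 2).intervalIntegrable _ _
    · intro x; have := h.hφ.pos x; positivity
    · norm_num
  have hkey : ∀ N : ℝ, 1 ≤ N → ε0 * I1 ≤ 4 * μ * K ^ 2 * Cb ^ 2 / N := by
    intro N hN
    have hN0 : 0 < N := by linarith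
    have hd : ∀ x, HasDerivAt (fun x => b (x / N)) (b' (x / N) * (1 / N)) x := fun x =>
      (hb (x / N)).comp x ((hasDerivAt_id x).div_const N)
    have hsupp : ∀ x, x ∉ Set.Icc (-2 * N) (2 * N) → 2 ≤ |x / N| := by
      intro x hx
      rw [abs_div, abs_of_pos hN0, le_div_iff₀ hN0]
      by_contra hlt
      push Not at hlt
      exact hx ⟨by linarith [(abs_lt.mp hlt).1], (abs_lt.mp hlt).2.le⟩
    have hcs : HasCompactSupport (fun x => b (x / N)) :=
      HasCompactSupport.intro isCompact_Icc fun x hx => (hb2' _ (hsupp x hx)).1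
    have hcs' : HasCompactSupport (fun x => b' (x / N)) :=
      HasCompactSupport.intro isCompact_Icc fun x hx => (hb2' _ (hsupp x hx)).2
    have hcN : Continuous fun x : ℝ => x / N := continuous_id.div_const N
    have hH := h.hardy _ _ hd ((hb'c.comp hcN).mul continuous_const) hcs
    have hintg : Integrable fun x => φ x ^ 2 * b (x / N) ^ 2 :=
      ((hφc.pow 2).mul ((hbc.comp hcN).pow 2)).integrable_of_hasCompactSupport
        (hcs_of_zero hcs fun x hx => by simp [hx])
    have hlow : I1 ≤ ∫ x, φ x ^ 2 * b (x / N) ^ 2 := by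
      have e : I1 = ∫ x in Set.Icc (-1:ℝ) 1, φ x ^ 2 * b (x / N) ^ 2 := by
        apply setIntegral_congr_fun measurableSet_Icc
        intro x hx
        have : b (x / N) = 1 := by
          apply hb1'
          rw [abs_div, abs_of_pos hN0, div_le_one hN0]
          exact (abs_le.mpr ⟨by linarith [hx.1], hx.2⟩).trans hN
        simp [this]
      rw [e]
      exact setIntegral_le_integral hintg (Eventually.of_forall fun x => by positivity)
    have hup : ∫ x, a x * φ x ^ 2 * (b' (x / N) * (1 / N)) ^ 2 ≤ 4 * μ * K ^ 2 * Cb ^ 2 / N := by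
      have e : ∫ x, a x * φ x ^ 2 * (b' (x / N) * (1 / N)) ^ 2
          = ∫ x in Set.Icc (-2 * N) (2 * N), a x * φ x ^ 2 * (b' (x / N) * (1 / N)) ^ 2 := by
        rw [setIntegral_eq_integral_of_forall_compl_eq_zero]
        intro x hx
        simp [(hb2' _ (hsupp x hx)).2]
      rw [e]
      have hle : ∫ x in Set.Icc (-2 * N) (2 * N), a x * φ x ^ 2 * (b' (x / N) * (1 / N)) ^ 2
          ≤ ∫ x in Set.Icc (-2 * N) (2 * N), μ * K ^ 2 * Cb ^ 2 / N ^ 2 := by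
        apply setIntegral_mono_on
        · apply Continuous.integrableOn_Icc
          have := h.hac
          fun_prop
        · exact continuous_const.integrableOn_Icc
        · exact measurableSet_Icc
        · intro x _
          have h1 : b' (x / N) ^ 2 ≤ Cb ^ 2 := sq_le_sq' (abs_le.mp (hCb' _)).1 (abs_le.mp (hCb' _)).2
          have h2 : φ x ^ 2 ≤ K ^ 2 := by
            have := hφK x; have := h.hφ.pos x; gcongr
          have h3 := (h.ha x).2
          have h4 := h.apos x
          have h5 := h.μpos
          calc a x * φ x ^ 2 * (b' (x / N) * (1 / N)) ^ 2
              = a x * φ x ^ 2 * b' (x / N) ^ 2 / N ^ 2 := by ring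
            _ ≤ μ * K ^ 2 * Cb ^ 2 / N ^ 2 := by gcongr
      refine hle.trans (le_of_eq ?_)
      rw [setIntegral_const]
      simp only [Measure.real, Real.volume_Icc, smul_eq_mul]
      rw [ENNReal.toReal_ofReal (by linarith)]
      field_simp
      ring
    calc ε0 * I1 ≤ ε0 * ∫ x, φ x ^ 2 * b (x / N) ^ 2 :=
          mul_le_mul_of_nonneg_left hlow h.hε0.le
      _ ≤ _ := hH.trans hup
  set C := 4 * μ * K ^ 2 * Cb ^ 2 with hC
  have hCpos : 0 < C := by have := h.μpos; positivity
  have hpos : 0 < ε0 * I1 := mul_pos h.hε0 hI1pos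
  have := hkey (max 1 (2 * C / (ε0 * I1))) (le_max_left _ _)
  have h2 : C / (max 1 (2 * C / (ε0 * I1))) ≤ C / (2 * C / (ε0 * I1)) := by
    apply div_le_div_of_nonneg_left hCpos.le (by positivity) (le_max_right _ _)
  have h3 : C / (2 * C / (ε0 * I1)) = ε0 * I1 / 2 := by field_simp
  linarith

theorem Pair.m_lower (h : Pair μ γ ε0 P W a r φ φ' φt φt') (x : ℝ) :
    W / (2 * P) ≤ φ x * φt x := by
  have h1 := h.wr x
  have h2 := (abs_le.mp (h.bd x)).1
  have h3 := (abs_le.mp (h.bdt x)).2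
  have h4 := h.hφ.pos x
  have h5 := h.hφt.pos x
  rw [div_le_iff₀ (by have := h.hP; positivity)]
  nlinarith

theorem Pair.theta_deriv (h : Pair μ γ ε0 P W a r φ φ' φt φt') (x : ℝ) :
    HasDerivAt (fun x => Real.log (φt x / φ x)) (W / (a x * (φ x * φt x))) x := by
  have h4 := (h.hφ.pos x).ne'
  have h5 := (h.hφt.pos x).ne'
  have h6 := (h.apos x).ne'
  refine ((h.ratio x).log (by positivity)).congr_deriv ?_
  field_simp

end

/-! ### Part 7 -/
section
variable {μ γ ε0 P W : ℝ} {a r φ φ' φt φt' : ℝ → ℝ}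

theorem Pair.theta_top (h : Pair μ γ ε0 P W a r φ φ' φt φt') :
    Tendsto (fun x => Real.log (φt x / φ x)) atTop atTop := by
  apply Real.tendsto_log_atTop.comp
  have hm0 : 0 < W / (2 * P) := div_pos h.Wpos (by have := h.hP; positivity)
  have h1 : Tendsto (fun x => φ x ^ 2) atTop (nhdsWithin 0 (Set.Ioi 0)) := by
    rw [tendsto_nhdsWithin_iff]
    refine ⟨by simpa using h.lim.pow 2, Eventually.of_forall fun x => ?_⟩
    have := h.hφ.pos x
    simp only [Set.mem_Ioi]; positivity
  have h2 := (tendsto_inv_nhdsGT_zero.comp h1).const_mul_atTop hm0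
  refine tendsto_atTop_mono (fun x => ?_) h2
  have h3 := h.hφ.pos x
  have := h.m_lower x
  simp only [Function.comp]
  rw [le_div_iff₀ h3]
  calc W / (2 * P) * (φ x ^ 2)⁻¹ * φ x ≤ (φ x * φt x) * (φ x ^ 2)⁻¹ * φ x := by gcongr
    _ = φt x := by field_simp

theorem Pair.theta_bot (h : Pair μ γ ε0 P W a r φ φ' φt φt') :
    Tendsto (fun x => Real.log (φt x / φ x)) atBot atBot := by
  have hm0 : 0 < W / (2 * P) := div_pos h.Wpos (by have := h.hP; positivity)
  have h1 : Tendsto (fun x => φt x ^ 2) atBot (nhdsWithin 0 (Set.Ioi 0)) := by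
    rw [tendsto_nhdsWithin_iff]
    refine ⟨by simpa using h.limt.pow 2, Eventually.of_forall fun x => ?_⟩
    have := h.hφt.pos x
    simp only [Set.mem_Ioi]; positivity
  have h2 := (tendsto_inv_nhdsGT_zero.comp h1).const_mul_atTop hm0
  have h4 : Tendsto (fun x => φ x / φt x) atBot atTop := by
    refine tendsto_atTop_mono (fun x => ?_) h2
    have h3 := h.hφt.pos x
    have := h.m_lower x
    simp only [Function.comp]
    rw [le_div_iff₀ h3]
    calc W / (2 * P) * (φt x ^ 2)⁻¹ * φt x ≤ (φ x * φt x) * (φt x ^ 2)⁻¹ * φt x := by gcongr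
      _ = φ x := by field_simp
  have h5 := tendsto_neg_atTop_atBot.comp (Real.tendsto_log_atTop.comp h4)
  refine h5.congr fun x => ?_
  simp only [Function.comp]
  rw [← Real.log_inv, inv_div]

theorem Pair.m_upper (h : Pair μ γ ε0 P W a r φ φ' φt φt') :
    ∃ m1, 0 < m1 ∧ ∀ x, φ x * φt x ≤ m1 := by
  obtain ⟨b, b', hb, hb'c, hb01, hb1', hb2', Cb, hCb, hCb'⟩ := exists_cutoff
  have hbc : Continuous b := continuous_iff_continuousAt.mpr fun x => (hb x).continuousAt
  have hW := h.Wpos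
  have hμ0 := h.μpos
  have hP := h.hP
  have hε := h.hε0
  have hφc := h.hφ.cont
  have hφtc := h.hφt.cont
  set E := Real.exp (P * μ) with hE
  have hE0 : 0 < E := Real.exp_pos _
  refine ⟨W * μ * E ^ 2 + 4 * W * (1 / 2 + Cb) ^ 2 * E ^ 2 / ε0, by positivity, fun x0 => ?_⟩
  set M := φ x0 * φt x0 with hM
  have hMpos : 0 < M := mul_pos (h.hφ.pos _) (h.hφt.pos _)
  by_cases hcase : M ≤ W * μ * E ^ 2
  · have : 0 ≤ 4 * W * (1 / 2 + Cb) ^ 2 * E ^ 2 / ε0 := by positivity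
    linarith
  push Not at hcase
  set θ : ℝ → ℝ := fun x => Real.log (φt x / φ x) with hθ
  set θ' : ℝ → ℝ := fun x => W / (a x * (φ x * φt x)) with hθ'
  have hθd : ∀ x, HasDerivAt θ (θ' x) x := h.theta_deriv
  have hθc : Continuous θ := continuous_iff_continuousAt.mpr fun x => (hθd x).continuousAt
  have hmpos : ∀ x, 0 < φ x * φt x := fun x => mul_pos (h.hφ.pos _) (h.hφt.pos _)
  have hθ'pos : ∀ x, 0 < θ' x := fun x => div_pos hW (mul_pos (h.apos x) (hmpos x))
  have hθ'c : Continuous θ' := by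
    apply continuous_const.div (h.hac.mul (hφc.mul hφtc))
    intro x
    exact (mul_pos (h.apos x) (hmpos x)).ne'
  have hθmono : StrictMono θ := strictMono_of_hasDerivAt_pos hθd hθ'pos
  have hsurj : Function.Surjective θ := hθc.surjective h.theta_top h.theta_bot
  obtain ⟨xm, hxm⟩ := hsurj (θ x0 - 2)
  obtain ⟨xp, hxp⟩ := hsurj (θ x0 + 2)
  have hxmp : xm ≤ xp := by
    rw [← hθmono.le_iff_le, hxm, hxp]; linarith
  -- test function
  set η : ℝ → ℝ := fun x => Real.exp (θ x / 2) * b (θ x - θ x0) with hη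
  set η' : ℝ → ℝ := fun x => Real.exp (θ x / 2) * (b (θ x - θ x0) / 2 + b' (θ x - θ x0)) * θ' x
    with hη'
  have hηd : ∀ x, HasDerivAt η (η' x) x := by
    intro x
    have h1 := ((hθd x).div_const 2).exp
    have h2 := (hb (θ x - θ x0)).comp x ((hθd x).sub_const (θ x0))
    refine (h1.mul h2).congr_deriv ?_
    simp only [hη', Function.comp]; ring
  have hη'cont : Continuous η' := by fun_prop
  have hsupp : ∀ x, x ∉ Set.Icc xm xp → 2 ≤ |θ x - θ x0| := by
    intro x hx
    by_contra hlt
    push Not at hlt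
    rw [abs_lt] at hlt
    apply hx
    constructor
    · rw [← hθmono.le_iff_le, hxm]; linarith
    · rw [← hθmono.le_iff_le, hxp]; linarith
  have hηcs : HasCompactSupport η := HasCompactSupport.intro (isCompact_Icc (a := xm) (b := xp)) fun x hx => by
    simp [hη, (hb2' _ (hsupp x hx)).1]
  have hH := h.hardy η η' hηd hη'cont hηcs
  have hexp : ∀ x, Real.exp (θ x / 2) ^ 2 = φt x / φ x := by
    intro x
    rw [← Real.exp_nat_mul]
    have : ((2:ℕ):ℝ) * (θ x / 2) = θ x := by push_cast; ring
    rw [this, hθ, Real.exp_log (div_pos (h.hφt.pos x) (h.hφ.pos x))]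
  have hup : ∫ x, a x * φ x ^ 2 * η' x ^ 2 ≤ 4 * W * (1 / 2 + Cb) ^ 2 := by
    have hpt : ∀ x, a x * φ x ^ 2 * η' x ^ 2
        = W * (b (θ x - θ x0) / 2 + b' (θ x - θ x0)) ^ 2 * θ' x := by
      intro x
      have h1 := (h.hφ.pos x).ne'
      have h2 := (h.hφt.pos x).ne'
      have h3 := (h.apos x).ne'
      calc a x * φ x ^ 2 * η' x ^ 2 = a x * φ x ^ 2 * Real.exp (θ x / 2) ^ 2 * θ' x
            * (b (θ x - θ x0) / 2 + b' (θ x - θ x0)) ^ 2 * θ' x := by simp only [hη']; ring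
        _ = _ := by
            rw [hexp x]
            have : a x * φ x ^ 2 * (φt x / φ x) * θ' x = W := by
              simp only [hθ']; field_simp
            rw [this]
    have e : ∫ x, a x * φ x ^ 2 * η' x ^ 2 = ∫ x in Set.Icc xm xp, a x * φ x ^ 2 * η' x ^ 2 := by
      rw [setIntegral_eq_integral_of_forall_compl_eq_zero]
      intro x hx
      simp [hη', (hb2' _ (hsupp x hx)).1, (hb2' _ (hsupp x hx)).2]
    rw [e]
    have hac := h.hac
    calc ∫ x in Set.Icc xm xp, a x * φ x ^ 2 * η' x ^ 2
        ≤ ∫ x in Set.Icc xm xp, W * (1 / 2 + Cb) ^ 2 * θ' x := by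
          apply setIntegral_mono_on
          · exact Continuous.integrableOn_Icc (by fun_prop)
          · exact Continuous.integrableOn_Icc (by fun_prop)
          · exact measurableSet_Icc
          · intro x _
            rw [hpt x]
            have h1 : (b (θ x - θ x0) / 2 + b' (θ x - θ x0)) ^ 2 ≤ (1 / 2 + Cb) ^ 2 := by
              have h2 := hb01 (θ x - θ x0)
              have h3 := abs_le.mp (hCb' (θ x - θ x0))
              apply sq_le_sq' <;> linarith [h2.1, h2.2, h3.1, h3.2]
            have := (hθ'pos x).le
            gcongr
      _ = 4 * W * (1 / 2 + Cb) ^ 2 := by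
          rw [integral_const_mul, integral_Icc_eq_integral_Ioc,
            ← intervalIntegral.integral_of_le hxmp,
            intervalIntegral.integral_eq_sub_of_hasDerivAt (fun x _ => hθd x)
              (hθ'c.intervalIntegrable _ _), hxm, hxp]
          ring
  have hnear : ∀ x ∈ Set.Icc (x0 - 1) (x0 + 1), M / E ^ 2 ≤ φ x * φt x := by
    intro x hx
    have hx1 : |x0 - x| ≤ 1 := by rw [abs_le]; constructor <;> linarith [hx.1, hx.2]
    have hEx : Real.exp (P * μ * |x0 - x|) ≤ E := by
      rw [hE]; apply Real.exp_le_exp.mpr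
      have : 0 < P * μ := by positivity
      nlinarith
    have h1 := h.hφ.harnack h.hμ h.ha h.bd x0 x
    have h2 := h.hφt.harnack h.hμ h.ha h.bdt x0 x
    rw [div_le_iff₀ (by positivity)]
    have p1 := h.hφ.pos x
    have p2 := h.hφt.pos x
    have p3 := h.hφt.pos x0
    calc M ≤ (φ x * Real.exp (P * μ * |x0 - x|)) * (φt x * Real.exp (P * μ * |x0 - x|)) := by
          rw [hM]; gcongr
      _ ≤ (φ x * E) * (φt x * E) := by gcongr
      _ = φ x * φt x * E ^ 2 := by ring
  have hθnear : ∀ x ∈ Set.Icc (x0 - 1) (x0 + 1), |θ x - θ x0| ≤ 1 := by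
    intro x hx
    have hbd : ∀ z ∈ Set.Icc (x0 - 1) (x0 + 1), ‖θ' z‖ ≤ 1 := by
      intro z hz
      rw [Real.norm_eq_abs, abs_of_pos (hθ'pos z), hθ']
      simp only
      rw [div_le_one (mul_pos (h.apos z) (hmpos z))]
      have h1 := hnear z hz
      have h2 : W * μ ≤ M / E ^ 2 := by
        rw [le_div_iff₀ (by positivity)]; exact hcase.le
      have h3 : 1 / μ * (W * μ) ≤ a z * (φ z * φt z) :=
        mul_le_mul (h.ha z).1 (h2.trans h1) (by positivity) (h.apos z).le
      have h4 : 1 / μ * (W * μ) = W := by field_simp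
      linarith
    have := Convex.norm_image_sub_le_of_norm_hasDerivWithin_le (s := Set.Icc (x0 - 1) (x0 + 1))
      (fun z _ => (hθd z).hasDerivWithinAt) hbd (convex_Icc _ _)
      (show x0 ∈ Set.Icc (x0 - 1) (x0 + 1) by constructor <;> linarith) hx
    rw [Real.norm_eq_abs, Real.norm_eq_abs, one_mul] at this
    refine this.trans ?_
    rw [abs_le]; constructor <;> linarith [hx.1, hx.2]
  have hlow : 2 * (M / E ^ 2) ≤ ∫ x, φ x ^ 2 * η x ^ 2 := by
    have hηcont : Continuous η := by fun_prop
    have hintg : Integrable fun x => φ x ^ 2 * η x ^ 2 :=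
      Continuous.integrable_of_hasCompactSupport (by fun_prop)
        (hcs_of_zero hηcs fun x hx => by simp [hx])
    have h1 : ∫ x in Set.Icc (x0 - 1) (x0 + 1), φ x ^ 2 * η x ^ 2 ≤ ∫ x, φ x ^ 2 * η x ^ 2 :=
      setIntegral_le_integral hintg (Eventually.of_forall fun x => by positivity)
    refine le_trans ?_ h1
    have h2 : ∫ x in Set.Icc (x0 - 1) (x0 + 1), M / E ^ 2 = 2 * (M / E ^ 2) := by
      rw [setIntegral_const]
      simp only [Measure.real, Real.volume_Icc, smul_eq_mul]
      rw [ENNReal.toReal_ofReal (by linarith)]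
      ring
    rw [← h2]
    apply setIntegral_mono_on continuous_const.integrableOn_Icc hintg.integrableOn measurableSet_Icc
    intro x hx
    have hb1 : b (θ x - θ x0) = 1 := hb1' _ (hθnear x hx)
    have : φ x ^ 2 * η x ^ 2 = φ x * φt x := by
      have h1 := (h.hφ.pos x).ne'
      simp only [hη, hb1, mul_one]
      rw [hexp x]; field_simp
    rw [this]
    exact hnear x hx
  have hfin : ε0 * (2 * (M / E ^ 2)) ≤ 4 * W * (1 / 2 + Cb) ^ 2 :=
    (mul_le_mul_of_nonneg_left hlow hε.le).trans (hH.trans hup)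
  have : M ≤ 4 * W * (1 / 2 + Cb) ^ 2 * E ^ 2 / ε0 := by
    rw [le_div_iff₀ hε]
    have h1 : ε0 * (M / E ^ 2) ≤ 4 * W * (1 / 2 + Cb) ^ 2 := by
      have : 0 ≤ ε0 * (M / E ^ 2) := by positivity
      linarith
    calc M * ε0 = ε0 * (M / E ^ 2) * E ^ 2 := by field_simp
      _ ≤ _ := by gcongr
  have h0 : 0 ≤ W * μ * E ^ 2 := by positivity
  linarith

end

/-! ### Part 8 -/
section
variable {μ γ ε0 P W : ℝ} {a r φ φ' φt φt' : ℝ → ℝ}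

theorem Pair.decay (h : Pair μ γ ε0 P W a r φ φ' φt φt') :
    ∃ K κ : ℝ, 0 < K ∧ 0 < κ ∧ ∀ w x, w ≤ x →
      φ x ≤ K * Real.exp (-κ * (x - w)) * φ w ∧ φt w ≤ K * Real.exp (-κ * (x - w)) * φt x := by
  obtain ⟨m1, hm1, hmu⟩ := h.m_upper
  have hW := h.Wpos
  have hP := h.hP
  have hμ0 := h.μpos
  set m0 := W / (2 * P) with hm0d
  have hm0 : 0 < m0 := by positivity
  have hml : ∀ x, m0 ≤ φ x * φt x := h.m_lower
  set c1 := W / (μ * m1) with hc1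
  have hc1p : 0 < c1 := by positivity
  have hmono : ∀ w x, w ≤ x → c1 * (x - w) ≤ Real.log (φt x / φ x) - Real.log (φt w / φ w) := by
    intro w x hwx
    have hm : Monotone (fun x => Real.log (φt x / φ x) - c1 * x) := by
      refine monotone_of_hasDerivAt_nonneg
        (f' := fun x => W / (a x * (φ x * φt x)) - c1) (fun x => ?_) (fun x => ?_)
      · exact (h.theta_deriv x).sub (by simpa using (hasDerivAt_id x).const_mul c1)
      · have h1 := h.apos x
        have h2 := mul_pos (h.hφ.pos x) (h.hφt.pos x)
        simp only [Pi.zero_apply, sub_nonneg, hc1]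
        exact div_le_div_of_nonneg_left hW.le (mul_pos h1 h2)
          (mul_le_mul (h.ha x).2 (hmu x) h2.le hμ0.le)
    have := hm hwx
    simp only at this
    linarith
  have hexp : ∀ w x, w ≤ x → φt w * φ x ≤ Real.exp (-c1 * (x - w)) * (φt x * φ w) := by
    intro w x hwx
    have p1 := h.hφ.pos x
    have p2 := h.hφ.pos w
    have p3 := h.hφt.pos x
    have p4 := h.hφt.pos w
    have h1 : Real.exp (c1 * (x - w)) ≤ (φt x / φ x) / (φt w / φ w) := by
      rw [← Real.exp_log (show 0 < (φt x / φ x) / (φt w / φ w) by positivity),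
        Real.log_div (by positivity) (by positivity)]
      exact Real.exp_le_exp.mpr (hmono w x hwx)
    rw [show -c1 * (x - w) = -(c1 * (x - w)) by ring, Real.exp_neg]
    rw [← div_eq_inv_mul, le_div_iff₀ (Real.exp_pos _)]
    rw [div_div_div_eq, le_div_iff₀ (by positivity)] at h1
    linarith
  refine ⟨Real.sqrt (m1 / m0), c1 / 2, by positivity, by positivity, fun w x hwx => ?_⟩
  have p1 := h.hφ.pos x
  have p2 := h.hφ.pos w
  have p3 := h.hφt.pos x
  have p4 := h.hφt.pos w
  have hK : Real.sqrt (m1 / m0) ^ 2 = m1 / m0 := Real.sq_sqrt (by positivity)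
  have hE : Real.exp (-(c1 / 2) * (x - w)) ^ 2 = Real.exp (-c1 * (x - w)) := by
    rw [← Real.exp_nat_mul]; congr 1; push_cast; ring
  have he := Real.exp_pos (-c1 * (x - w))
  have hh := hexp w x hwx
  constructor
  · apply le_of_sq_le_sq _ (by positivity)
    rw [mul_pow, mul_pow, hK, hE]
    have : m0 * φ x ^ 2 ≤ m1 * Real.exp (-c1 * (x - w)) * φ w ^ 2 := by
      calc m0 * φ x ^ 2 ≤ (φ w * φt w) * φ x ^ 2 := by gcongr; exact hml w
        _ = (φt w * φ x) * (φ w * φ x) := by ring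
        _ ≤ (Real.exp (-c1 * (x - w)) * (φt x * φ w)) * (φ w * φ x) := by gcongr
        _ = (φ x * φt x) * Real.exp (-c1 * (x - w)) * φ w ^ 2 := by ring
        _ ≤ _ := by gcongr; exact hmu x
    rw [div_mul_eq_mul_div, div_mul_eq_mul_div, le_div_iff₀ hm0]
    linarith
  · apply le_of_sq_le_sq _ (by positivity)
    rw [mul_pow, mul_pow, hK, hE]
    have : m0 * φt w ^ 2 ≤ m1 * Real.exp (-c1 * (x - w)) * φt x ^ 2 := by
      calc m0 * φt w ^ 2 ≤ (φ x * φt x) * φt w ^ 2 := by gcongr; exact hml x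
        _ = (φt w * φ x) * (φt x * φt w) := by ring
        _ ≤ (Real.exp (-c1 * (x - w)) * (φt x * φ w)) * (φt x * φt w) := by gcongr
        _ = (φ w * φt w) * Real.exp (-c1 * (x - w)) * φt x ^ 2 := by ring
        _ ≤ _ := by gcongr; exact hmu w
    rw [div_mul_eq_mul_div, div_mul_eq_mul_div, le_div_iff₀ hm0]
    linarith

theorem tail_integral {u : ℝ → ℝ} (hc : Continuous u) (hpos : ∀ x, 0 < u x) {K κ Q : ℝ}
    (hK : 0 < K) (hκ : 0 < κ)
    (hd : ∀ w x, w ≤ x → u x ≤ K * Real.exp (-κ * (x - w)) * u w)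
    (hh : ∀ x w, u x ≤ u w * Real.exp (Q * |x - w|)) :
    (∀ x, IntegrableOn (fun v => u v ^ 2) (Set.Ioi x)) ∧
    ∀ x, HasDerivAt (fun x => ∫ v in Set.Ioi x, u v ^ 2) (-u x ^ 2) x ∧
      Real.exp (-2 * Q) * u x ^ 2 ≤ (∫ v in Set.Ioi x, u v ^ 2) ∧
      (∫ v in Set.Ioi x, u v ^ 2) ≤ K ^ 2 / (2 * κ) * u x ^ 2 := by
  have hpt : ∀ x v, x ≤ v → u v ^ 2 ≤ K ^ 2 * u x ^ 2 * Real.exp (2 * κ * x) * Real.exp (-(2 * κ) * v) := by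
    intro x v hxv
    calc u v ^ 2 ≤ (K * Real.exp (-κ * (v - x)) * u x) ^ 2 :=
          pow_le_pow_left₀ (hpos v).le (hd x v hxv) 2
      _ = K ^ 2 * u x ^ 2 * Real.exp (-κ * (v - x)) ^ 2 := by ring
      _ = _ := by
        rw [← Real.exp_nat_mul, mul_assoc (K ^ 2 * u x ^ 2), ← Real.exp_add]
        congr 2; push_cast; ring
  have hib : ∀ x, IntegrableOn (fun v => K ^ 2 * u x ^ 2 * Real.exp (2 * κ * x) * Real.exp (-(2 * κ) * v)) (Set.Ioi x) :=
    fun x => (integrableOn_exp_mul_Ioi (by linarith) x).const_mul _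
  have hintg : ∀ x, IntegrableOn (fun v => u v ^ 2) (Set.Ioi x) := by
    intro x
    refine (hib x).mono' (hc.pow 2).aestronglyMeasurable ?_
    refine (ae_restrict_iff' measurableSet_Ioi).mpr (Eventually.of_forall fun v hv => ?_)
    rw [Real.norm_of_nonneg (by positivity)]
    exact hpt x v (le_of_lt hv)
  refine ⟨hintg, fun x => ⟨?_, ?_, ?_⟩⟩
  · have e : ∀ z ∈ Set.Ioo (x - 1) (x + 1), (∫ v in Set.Ioi z, u v ^ 2)
        = (∫ v in Set.Ioi (x - 1), u v ^ 2) - ∫ v in (x-1)..z, u v ^ 2 := by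
      intro z hz
      rw [← intervalIntegral.integral_Ioi_sub_Ioi (hintg _) hz.1.le]; ring
    have hD : HasDerivAt (fun z => (∫ v in Set.Ioi (x - 1), u v ^ 2) - ∫ v in (x-1)..z, u v ^ 2)
        (-u x ^ 2) x := by
      have := ((hc.pow 2).integral_hasStrictDerivAt (x-1) x).hasDerivAt
      refine (this.const_sub _).congr_deriv (by simp)
    refine hD.congr_of_eventuallyEq ?_
    filter_upwards [Ioo_mem_nhds (show x - 1 < x by linarith) (show x < x + 1 by linarith)] with z hz
    exact e z hz
  · have h1 : (∫ v in Set.Ioc x (x+1), u v ^ 2) ≤ ∫ v in Set.Ioi x, u v ^ 2 :=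
      setIntegral_mono_set (hintg x) (Eventually.of_forall fun v => by positivity)
        (Eventually.of_forall fun v hv => hv.1)
    refine le_trans ?_ h1
    have h2 : ∫ v in Set.Ioc x (x+1), Real.exp (-2 * Q) * u x ^ 2 = Real.exp (-2 * Q) * u x ^ 2 := by
      simp
    rw [← h2]
    apply setIntegral_mono_on
    · exact integrableOn_const (by simp)
    · exact (hintg x).mono_set fun v hv => hv.1
    · exact measurableSet_Ioc
    · intro v hv
      have h3 := hh x v
      have hQ : 0 ≤ Q := by
        have := hh 1 0
        have h' := hh 0 1
        by_contra hQ
        push Not at hQ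
        norm_num at this h'
        have e1 : Real.exp Q < 1 := by rw [Real.exp_lt_one_iff]; exact hQ
        have := hpos 0
        have := hpos 1
        nlinarith
      have h4 : u x ≤ u v * Real.exp Q := h3.trans (by
        have : |x - v| ≤ 1 := by rw [abs_le]; constructor <;> linarith [hv.1, hv.2]
        have := hpos v
        gcongr; nlinarith)
      have h5 : Real.exp (-2 * Q) * Real.exp Q ^ 2 = 1 := by
        rw [← Real.exp_nat_mul, ← Real.exp_add]; simp
      calc Real.exp (-2 * Q) * u x ^ 2 ≤ Real.exp (-2 * Q) * (u v * Real.exp Q) ^ 2 := by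
            have := hpos x
            gcongr
        _ = u v ^ 2 * (Real.exp (-2 * Q) * Real.exp Q ^ 2) := by ring
        _ = _ := by rw [h5, mul_one]
  · calc (∫ v in Set.Ioi x, u v ^ 2)
        ≤ ∫ v in Set.Ioi x, K ^ 2 * u x ^ 2 * Real.exp (2 * κ * x) * Real.exp (-(2 * κ) * v) :=
          setIntegral_mono_on (hintg x) (hib x) measurableSet_Ioi fun v hv => hpt x v (le_of_lt hv)
      _ = K ^ 2 / (2 * κ) * u x ^ 2 := by
        rw [integral_const_mul, integral_exp_mul_Ioi (by linarith) x]
        have : Real.exp (2 * κ * x) * Real.exp (-(2 * κ) * x) = 1 := by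
          rw [← Real.exp_add]; simp
        calc _ = K ^ 2 * u x ^ 2 * (Real.exp (2 * κ * x) * Real.exp (-(2 * κ) * x)) / (2 * κ) := by
              rw [neg_div_neg_eq]; ring
          _ = _ := by rw [this]; ring
end

/-! ### Part 9 -/
/-- All the data used in the parabolic part of the argument. -/
structure Ctx where
  (μ γ P W K κ m0 m1 τ0 τ1 C1 : ℝ)
  (a r φ φ' φt φt' T Td Tt Ttd : ℝ → ℝ)
  hμ : 1 ≤ μ
  hac : Continuous a
  hrc : Continuous r
  ha : ∀ x, 1 / μ ≤ a x ∧ a x ≤ μ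
  hr : ∀ x, |r x| ≤ μ
  hφ : PosSol a (fun x => γ - r x) φ φ'
  hφt : PosSol a (fun x => γ - r x) φt φt'
  wr : ∀ x, a x * (φt' x * φ x - φ' x * φt x) = W
  W0 : 0 < W
  P0 : 0 < P
  bd : ∀ x, |a x * φ' x| ≤ P * φ x
  bdt : ∀ x, |a x * φt' x| ≤ P * φt x
  K0 : 0 < K
  κ0 : 0 < κ
  dec : ∀ w x, w ≤ x → φ x ≤ K * Real.exp (-κ * (x - w)) * φ w
  dect : ∀ w x, w ≤ x → φt w ≤ K * Real.exp (-κ * (x - w)) * φt x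
  m00 : 0 < m0
  mlow : ∀ x, m0 ≤ φ x * φt x
  mup : ∀ x, φ x * φt x ≤ m1
  τ00 : 0 < τ0
  Tder : ∀ x, HasDerivAt T (Td x) x
  Tdc : Continuous Td
  Tdb : ∀ x, τ0 ≤ Td x ∧ Td x ≤ τ1
  Teq : ∀ x, HasDerivAt (fun x => a x * φ x ^ 2 * Td x) (-W * φ x ^ 2) x
  Ttder : ∀ x, HasDerivAt Tt (Ttd x) x
  Ttdc : Continuous Ttd
  Ttdb : ∀ x, τ0 ≤ Ttd x ∧ Ttd x ≤ τ1
  Tteq : ∀ x, HasDerivAt (fun x => a x * φt x ^ 2 * Ttd x) (W * φt x ^ 2) x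
  comp : ∀ x y, |(T x - T y) - (Tt x - Tt y)| ≤ C1

section
variable {μ γ ε0 P W : ℝ} {a r φ φ' φt φt' : ℝ → ℝ}

theorem Pair.T_eq (h : Pair μ γ ε0 P W a r φ φ' φt φt') {K κ : ℝ} (hK : 0 < K) (hκ : 0 < κ)
    (hd : ∀ w x, w ≤ x → φ x ≤ K * Real.exp (-κ * (x - w)) * φ w)
    {φd φd' T : ℝ → ℝ}
    (hφdD : ∀ x, HasDerivAt φd (φd' x) x)
    (hφdEq : ∀ x, HasDerivAt (fun y => a y * φd' y) (φ x - (r x - γ) * φd x) x)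
    (hφdB : ∃ K : ℝ, ∀ x : ℝ, x ≠ 0 → |φd x / (x * φ x)| ≤ K)
    (hT : ∀ x, T x = -W * φd x / φ x) (x : ℝ) :
    HasDerivAt T (W * (∫ v in Set.Ioi x, φ v ^ 2) / (a x * φ x ^ 2)) x := by
  obtain ⟨K2, hK2⟩ := hφdB
  have hW := h.Wpos
  have hμ0 := h.μpos
  obtain ⟨hintg, hI⟩ := tail_integral h.hφ.cont h.hφ.pos hK hκ hd (h.hφ.harnack h.hμ h.ha h.bd)
  set I : ℝ → ℝ := fun x => ∫ v in Set.Ioi x, φ v ^ 2 with hIdef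
  set Td : ℝ → ℝ := fun x => -W * (φd' x * φ x - φd x * φ' x) / φ x ^ 2 with hTd
  have hTder : ∀ x, HasDerivAt T (Td x) x := by
    intro x
    have hp := (h.hφ.pos x).ne'
    have e : T = fun x => -W * φd x / φ x := funext hT
    rw [e]
    refine (((hφdD x).const_mul (-W)).div (h.hφ.d1 x) hp).congr_deriv ?_
    simp only [hTd]; ring
  set Y : ℝ → ℝ := fun x => -W * ((a x * φd' x) * φ x - φd x * (a x * φ' x)) with hY
  have hYT : ∀ x, Y x = a x * φ x ^ 2 * Td x := by
    intro x
    have hp := (h.hφ.pos x).ne'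
    simp only [hY, hTd]; field_simp
  have hYd : ∀ x, HasDerivAt Y (-W * φ x ^ 2) x := by
    intro x
    refine ((((hφdEq x).mul (h.hφ.d1 x)).sub ((hφdD x).mul (h.hφ.d2 x))).const_mul (-W)).congr_deriv ?_
    ring
  have hZd : ∀ x, HasDerivAt (fun x => Y x - W * I x) 0 x := by
    intro x
    refine ((hYd x).sub ((hI x).1.const_mul W)).congr_deriv ?_
    ring
  have hconst : ∀ x, Y x - W * I x = Y 0 - W * I 0 := fun x =>
    is_const_of_deriv_eq_zero (fun x => (hZd x).differentiableAt) (fun x => (hZd x).deriv) x 0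
  set c := Y 0 - W * I 0 with hc
  have hTb : ∀ x, x ≠ 0 → |T x| ≤ W * K2 * |x| := by
    intro x hx
    have hp := h.hφ.pos x
    have h1 := hK2 x hx
    have e : T x = -W * (φd x / (x * φ x)) * x := by rw [hT]; field_simp
    rw [e, abs_mul, abs_mul, abs_neg, abs_of_pos hW]
    gcongr
  have hK20 : 0 ≤ K2 := (abs_nonneg _).trans (hK2 1 one_ne_zero)
  have hcb : ∀ x, 0 < x → |c| ≤ (3 * W * K2 * μ + W * (K ^ 2 / (2 * κ))) * K ^ 2 * φ x ^ 2 := by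
    intro x hx
    obtain ⟨z, hz, hzd⟩ := exists_hasDerivAt_eq_slope T Td (show x < 2 * x by linarith)
      (fun y _ => (hTder y).continuousAt.continuousWithinAt) (fun y _ => hTder y)
    have h1 := hTb x hx.ne'
    have h2 := hTb (2 * x) (by linarith)
    rw [abs_of_pos hx] at h1
    rw [abs_of_pos (show 0 < 2 * x by linarith)] at h2
    have h3 : |Td z| ≤ 3 * W * K2 := by
      rw [hzd, abs_div, show 2 * x - x = x by ring, abs_of_pos hx, div_le_iff₀ hx]
      calc |T (2 * x) - T x| ≤ |T (2*x)| + |T x| := abs_sub _ _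
        _ ≤ _ := by linarith
    have h4 : φ z ≤ K * φ x := by
      refine (hd x z hz.1.le).trans ?_
      have : Real.exp (-κ * (z - x)) ≤ 1 := by
        rw [Real.exp_le_one_iff]; nlinarith [hz.1]
      have := h.hφ.pos x
      gcongr
      nlinarith
    have h5 : φ z ^ 2 ≤ K ^ 2 * φ x ^ 2 := by
      rw [← mul_pow]; exact pow_le_pow_left₀ (h.hφ.pos z).le h4 2
    have hI0 : 0 ≤ I z := le_trans (by positivity) (hI z).2.1
    calc |c| = |Y z - W * I z| := by rw [hconst z]
      _ ≤ |Y z| + |W * I z| := abs_sub _ _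
      _ = a z * φ z ^ 2 * |Td z| + W * I z := by
        rw [hYT, abs_mul, abs_of_pos (mul_pos (h.apos z) (pow_pos (h.hφ.pos z) 2)),
          abs_of_nonneg (mul_nonneg hW.le hI0)]
      _ ≤ μ * φ z ^ 2 * (3 * W * K2) + W * (K ^ 2 / (2 * κ) * φ z ^ 2) := by
        have := (h.ha z).2
        have := (hI z).2.2
        gcongr
      _ = (3 * W * K2 * μ + W * (K ^ 2 / (2 * κ))) * φ z ^ 2 := by ring
      _ ≤ (3 * W * K2 * μ + W * (K ^ 2 / (2 * κ))) * (K ^ 2 * φ x ^ 2) := by gcongr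
      _ = _ := by ring
  have hc0 : c = 0 := by
    have hl : Tendsto (fun x => (3 * W * K2 * μ + W * (K ^ 2 / (2 * κ))) * K ^ 2 * φ x ^ 2) atTop (nhds 0) := by
      simpa using (h.lim.pow 2).const_mul ((3 * W * K2 * μ + W * (K ^ 2 / (2 * κ))) * K ^ 2)
    have : |c| ≤ 0 := ge_of_tendsto hl (by
      filter_upwards [eventually_gt_atTop 0] with x hx using hcb x hx)
    exact abs_nonpos_iff.mp this
  convert hTder x using 1
  have h1 := hconst x
  rw [hc0, hYT] at h1
  have h2 := (h.hφ.pos x).ne'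
  have h3 := (h.apos x).ne'
  rw [div_eq_iff (by positivity)]
  linarith

theorem abs_sub_le_of_deriv {f f' : ℝ → ℝ} {M : ℝ} (hf : ∀ x, HasDerivAt f (f' x) x)
    (hb : ∀ x, |f' x| ≤ M) (x y : ℝ) : |f x - f y| ≤ M * |x - y| := by
  have := Convex.norm_image_sub_le_of_norm_hasDerivWithin_le (f := f) (f' := f') (C := M)
    (s := Set.univ) (x := y) (y := x) (fun x _ => (hf x).hasDerivWithinAt)
    (fun x _ => hb x) convex_univ trivial trivial
  simpa using this

theorem Pair.ctx (h : Pair μ γ ε0 P W a r φ φ' φt φt')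
    {φd φd' T : ℝ → ℝ}
    (hφdD : ∀ x, HasDerivAt φd (φd' x) x)
    (hφdEq : ∀ x, HasDerivAt (fun y => a y * φd' y) (φ x - (r x - γ) * φd x) x)
    (hφdB : ∃ K : ℝ, ∀ x : ℝ, x ≠ 0 → |φd x / (x * φ x)| ≤ K)
    (hT : ∀ x, T x = -W * φd x / φ x) :
    ∃ c : Ctx, c.a = a ∧ c.r = r ∧ c.γ = γ ∧ c.φ = φ ∧ c.φt = φt ∧ c.T = T ∧ c.W = W := by
  obtain ⟨K, κ, hK, hκ, hdd⟩ := h.decay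
  obtain ⟨m1, hm1, hmu⟩ := h.m_upper
  have hW := h.Wpos
  have hμ0 := h.μpos
  have hP := h.hP
  have hd := fun w x hwx => (hdd w x hwx).1
  obtain ⟨hintg, hI⟩ := tail_integral h.hφ.cont h.hφ.pos hK hκ hd (h.hφ.harnack h.hμ h.ha h.bd)
  have hTder := h.T_eq hK hκ hd hφdD hφdEq hφdB hT
  set I : ℝ → ℝ := fun x => ∫ v in Set.Ioi x, φ v ^ 2 with hIdef
  obtain ⟨hintt, hIt⟩ := tail_integral (u := fun x => φt (-x)) (Q := P * μ)
    (h.hφt.cont.comp continuous_neg) (fun x => h.hφt.pos _) hK hκ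
    (fun w x hwx => by
      have := (hdd (-x) (-w) (by linarith)).2
      convert this using 4; ring)
    (fun x w => by
      have := h.hφt.harnack h.hμ h.ha h.bdt (-x) (-w)
      have e : |-x - -w| = |x - w| := by rw [← abs_neg]; congr 1; ring
      rwa [e] at this)
  set J : ℝ → ℝ := fun x => ∫ v in Set.Ioi x, φt (-v) ^ 2 with hJdef
  set Td : ℝ → ℝ := fun x => W * I x / (a x * φ x ^ 2) with hTd
  set Ttd : ℝ → ℝ := fun x => W * J (-x) / (a x * φt x ^ 2) with hTtd
  have hIc : Continuous I := continuous_iff_continuousAt.mpr fun x => (hI x).1.continuousAt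
  have hJc : Continuous J := continuous_iff_continuousAt.mpr fun x => (hIt x).1.continuousAt
  have hTdc : Continuous Td := by
    apply (continuous_const.mul hIc).div (h.hac.mul (h.hφ.cont.pow 2))
    intro x
    exact (mul_pos (h.apos x) (pow_pos (h.hφ.pos x) 2)).ne'
  have hTtdc : Continuous Ttd := by
    apply (continuous_const.mul (hJc.comp continuous_neg)).div (h.hac.mul (h.hφt.cont.pow 2))
    intro x
    exact (mul_pos (h.apos x) (pow_pos (h.hφt.pos x) 2)).ne'
  set τ0 := W * Real.exp (-2 * (P * μ)) / μ with hτ0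
  set τ1 := W * (K ^ 2 / (2 * κ)) * μ with hτ1
  have hbnd : ∀ A V i : ℝ, 1 / μ ≤ A → A ≤ μ → 0 < V → Real.exp (-2 * (P * μ)) * V ≤ i →
      i ≤ K ^ 2 / (2 * κ) * V → τ0 ≤ W * i / (A * V) ∧ W * i / (A * V) ≤ τ1 := by
    intro A V i hA1 hA2 hV h1 h2
    have hA : 0 < A := lt_of_lt_of_le (by positivity) hA1
    have hi : 0 ≤ i := le_trans (by positivity) h1
    constructor
    · rw [hτ0, div_le_div_iff₀ hμ0 (by positivity)]
      calc W * Real.exp (-2 * (P * μ)) * (A * V) = W * A * (Real.exp (-2 * (P * μ)) * V) := by ring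
        _ ≤ W * μ * i := by gcongr
        _ = _ := by ring
    · rw [div_le_iff₀ (by positivity), hτ1]
      have h3 : 1 ≤ μ * A := by rw [div_le_iff₀ hμ0] at hA1; linarith
      calc W * i ≤ W * (K ^ 2 / (2 * κ) * V) := by gcongr
        _ = W * (K ^ 2 / (2 * κ)) * V * 1 := by ring
        _ ≤ W * (K ^ 2 / (2 * κ)) * V * (μ * A) := by gcongr
        _ = _ := by ring
  have hTdb : ∀ x, τ0 ≤ Td x ∧ Td x ≤ τ1 := fun x =>
    hbnd _ _ _ (h.ha x).1 (h.ha x).2 (pow_pos (h.hφ.pos x) 2) (hI x).2.1 (hI x).2.2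
  have hTtdb : ∀ x, τ0 ≤ Ttd x ∧ Ttd x ≤ τ1 := fun x => by
    have h1 := (hIt (-x)).2.1
    have h2 := (hIt (-x)).2.2
    simp only [neg_neg] at h1 h2
    exact hbnd _ _ _ (h.ha x).1 (h.ha x).2 (pow_pos (h.hφt.pos x) 2) h1 h2
  set Tt : ℝ → ℝ := fun x => ∫ v in (0:ℝ)..x, Ttd v with hTt
  have hTtder : ∀ x, HasDerivAt Tt (Ttd x) x := fun x =>
    (hTtdc.integral_hasStrictDerivAt 0 x).hasDerivAt
  have hYeq : ∀ x, a x * φ x ^ 2 * Td x = W * I x := by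
    intro x
    have h2 := (h.hφ.pos x).ne'
    have h3 := (h.apos x).ne'
    simp only [hTd]; field_simp
  have hYteq : ∀ x, a x * φt x ^ 2 * Ttd x = W * J (-x) := by
    intro x
    have h2 := (h.hφt.pos x).ne'
    have h3 := (h.apos x).ne'
    simp only [hTtd]; field_simp
  have hYd : ∀ x, HasDerivAt (fun x => W * I x) (-W * φ x ^ 2) x := fun x =>
    ((hI x).1.const_mul W).congr_deriv (by ring)
  have hYtd : ∀ x, HasDerivAt (fun x => W * J (-x)) (W * φt x ^ 2) x := fun x => by
    have := ((hIt (-x)).1.comp x (hasDerivAt_neg x)).const_mul W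
    refine this.congr_deriv ?_
    simp
  have hτ10 : 0 ≤ τ1 := by positivity
  have hSd : ∀ x, HasDerivAt (fun x => φt x / φ x * (W * I x) + (φt x / φ x)⁻¹ * (W * J (-x))
      - W * (T x - Tt x)) 0 x := by
    intro x
    have h1 := (h.hφ.pos x).ne'
    have h2 := (h.hφt.pos x).ne'
    have h3 := (h.apos x).ne'
    have d1 := (h.ratio x).mul (hYd x)
    have d2 := ((h.ratio x).inv (div_ne_zero h2 h1)).mul (hYtd x)
    refine ((d1.add d2).sub (((hTder x).sub (hTtder x)).const_mul W)).congr_deriv ?_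
    simp only [hTd, hTtd]
    simp only [Pi.inv_apply]
    field_simp
    ring
  have hSc := fun x y => is_const_of_deriv_eq_zero (fun x => (hSd x).differentiableAt)
    (fun x => (hSd x).deriv) x y
  have hSb : ∀ x, 0 ≤ φt x / φ x * (W * I x) + (φt x / φ x)⁻¹ * (W * J (-x)) ∧
      φt x / φ x * (W * I x) + (φt x / φ x)⁻¹ * (W * J (-x)) ≤ 2 * (μ * m1 * τ1) := by
    intro x
    have h1 := (h.hφ.pos x)
    have h2 := (h.hφt.pos x)
    have h3 := (h.apos x)
    have e : φt x / φ x * (W * I x) + (φt x / φ x)⁻¹ * (W * J (-x))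
        = a x * (φ x * φt x) * Td x + a x * (φ x * φt x) * Ttd x := by
      rw [← hYeq, ← hYteq]; field_simp
    have hτp : 0 ≤ τ0 := by positivity
    have h4 := hTdb x
    have h5 := hTtdb x
    have h6 : 0 ≤ Td x := hτp.trans h4.1
    have h7 : 0 ≤ Ttd x := hτp.trans h5.1
    rw [e]
    refine ⟨by positivity, ?_⟩
    have := (h.ha x).2
    have := hmu x
    calc _ ≤ μ * m1 * τ1 + μ * m1 * τ1 := by
          gcongr
          · exact h4.2
          · exact h5.2
      _ = _ := by ring
  refine ⟨{
    μ := μ, γ := γ, P := P, W := W, K := K, κ := κ, m0 := W / (2 * P), m1 := m1, τ0 := τ0, τ1 := τ1,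
    C1 := 2 * (μ * m1 * τ1) / W, a := a, r := r, φ := φ, φ' := φ', φt := φt, φt' := φt', T := T,
    Td := Td, Tt := Tt, Ttd := Ttd, hμ := h.hμ, hac := h.hac, hrc := h.hrc, ha := h.ha, hr := h.hr,
    hφ := h.hφ, hφt := h.hφt, wr := h.wr, W0 := hW, P0 := hP, bd := h.bd, bdt := h.bdt, K0 := hK,
    κ0 := hκ, dec := hd, dect := fun w x hwx => (hdd w x hwx).2, m00 := by positivity,
    mlow := h.m_lower, mup := hmu, τ00 := by positivity, Tder := hTder, Tdc := hTdc, Tdb := hTdb,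
    Teq := fun x => by simpa only [hYeq] using hYd x, Ttder := hTtder, Ttdc := hTtdc,
    Ttdb := hTtdb, Tteq := fun x => by simpa only [hYteq] using hYtd x,
    comp := fun x y => ?_ }, rfl, rfl, rfl, rfl, rfl, rfl, rfl⟩
  have e := hSc x y
  have b1 := hSb x
  have b2 := hSb y
  rw [le_div_iff₀ hW, show ∀ q : ℝ, |q| * W = |q * W| from fun q => by rw [abs_mul, abs_of_pos hW], abs_le]
  constructor <;> nlinarith
end

/-! ### Part 10 -/
theorem smooth_below {g : ℝ → ℝ} (hg : Continuous g) (h0 : ∀ x, 0 ≤ g x) {ε : ℝ} (hε : 0 < ε) :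
    ∃ Φ : ℝ → ℝ, ContDiff ℝ 2 Φ ∧ ∀ x, 0 ≤ Φ x ∧ Φ x ≤ g x ∧ g x - ε ≤ Φ x := by
  obtain ⟨Φ, hΦ⟩ := exists_contMDiffMap_forall_mem_convex_of_local_const
    (n := 2) (modelWithCornersSelf ℝ ℝ) (M := ℝ) (F := ℝ)
    (t := fun y => Set.Icc (g y - ε) (g y) ∩ Set.Ici 0)
    (fun x => (convex_Icc _ _).inter (convex_Ici _))
    (fun x => by
      refine ⟨max 0 (g x - ε / 2), ?_⟩
      have e1 : ∀ᶠ y in nhds x, g y < g x + ε / 2 :=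
        hg.continuousAt.eventually_lt_const (by linarith)
      have e2 : ∀ᶠ y in nhds x, g x - ε / 2 < g y :=
        hg.continuousAt.eventually_const_lt (by linarith)
      filter_upwards [e1, e2] with y h1 h2
      refine ⟨⟨?_, ?_⟩, Set.mem_Ici.mpr (le_max_left _ _)⟩
      · exact le_trans (by linarith) (le_max_right _ _)
      · exact max_le (h0 y) h2.le)
  refine ⟨Φ, Φ.contMDiff.contDiff, fun x => ?_⟩
  have := hΦ x
  exact ⟨this.2, this.1.2, this.1.1⟩

namespace Ctx
variable (c : Ctx)

theorem μpos : 0 < c.μ := by have := c.hμ; linarith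
theorem apos (x : ℝ) : 0 < c.a x :=
  lt_of_lt_of_le (by have := c.μpos; positivity) (c.ha x).1
theorem φc : Continuous c.φ := c.hφ.cont
theorem φtc : Continuous c.φt := c.hφt.cont
theorem φ'c : Continuous c.φ' := c.hφ.cont' c.hac c.apos
theorem φt'c : Continuous c.φt' := c.hφt.cont' c.hac c.apos
theorem m10 : 0 < c.m1 := c.m00.trans_le ((c.mlow 0).trans (c.mup 0))
theorem τ10 : 0 < c.τ1 := c.τ00.trans_le ((c.Tdb 0).1.trans (c.Tdb 0).2)
theorem Tc : Continuous c.T := continuous_iff_continuousAt.mpr fun x => (c.Tder x).continuousAt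
theorem Ttc : Continuous c.Tt := continuous_iff_continuousAt.mpr fun x => (c.Ttder x).continuousAt
theorem C10 : 0 ≤ c.C1 := (abs_nonneg _).trans (c.comp 0 0)

theorem inv_a_bound (x : ℝ) : 1 / c.μ ≤ 1 / c.a x ∧ 1 / c.a x ≤ c.μ := by
  have h1 := c.apos x
  have h2 := c.ha x
  have h3 := c.μpos
  refine ⟨one_div_le_one_div_of_le h1 h2.2, ?_⟩
  rw [div_le_iff₀ h1]
  rw [div_le_iff₀ h3] at h2
  linarith [h2.1]

/-- natural scale -/
noncomputable def ξ (x : ℝ) : ℝ := ∫ v in (0:ℝ)..x, 1 / c.a v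

theorem inv_a_cont : Continuous fun x => 1 / c.a x :=
  continuous_const.div c.hac fun x => (c.apos x).ne'

theorem ξ_deriv (x : ℝ) : HasDerivAt c.ξ (1 / c.a x) x :=
  (c.inv_a_cont.integral_hasStrictDerivAt 0 x).hasDerivAt

theorem ξ_zero : c.ξ 0 = 0 := by simp [ξ]

theorem ξ_cont : Continuous c.ξ := continuous_iff_continuousAt.mpr fun x => (c.ξ_deriv x).continuousAt

theorem ξ_mono : StrictMono c.ξ :=
  strictMono_of_hasDerivAt_pos c.ξ_deriv fun x => one_div_pos.mpr (c.apos x)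

/-- general lower growth from derivative bounds -/
theorem growth {f f' : ℝ → ℝ} {l : ℝ} (hf : ∀ x, HasDerivAt f (f' x) x) (hl : ∀ x, l ≤ f' x)
    {x y : ℝ} (hxy : x ≤ y) : l * (y - x) ≤ f y - f x := by
  have hm : Monotone (fun x => f x - l * x) := by
    refine monotone_of_hasDerivAt_nonneg (f' := fun x => f' x - l) (fun x => ?_) (fun x => ?_)
    · exact (hf x).sub (by simpa using (hasDerivAt_id x).const_mul l)
    · simpa using hl x
  have := hm hxy
  simp only at this
  linarith

theorem ξ_low (x : ℝ) : |x| / c.μ ≤ |c.ξ x| := by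
  have h := c.ξ_zero
  rcases le_total 0 x with hx | hx
  · have := growth c.ξ_deriv (fun x => (c.inv_a_bound x).1) hx
    rw [h] at this
    rw [abs_of_nonneg hx]
    refine le_trans (le_of_eq ?_) (this.trans ?_)
    · ring
    · rw [sub_zero]; exact le_abs_self _
  · have := growth c.ξ_deriv (fun x => (c.inv_a_bound x).1) hx
    rw [h] at this
    rw [abs_of_nonpos hx]
    refine le_trans (le_of_eq ?_) (this.trans ?_)
    · ring
    · rw [zero_sub]; exact neg_le_abs _

theorem ξ_surj : Function.Surjective c.ξ := by
  refine c.ξ_cont.surjective ?_ ?_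
  · have h1 : Tendsto (fun x : ℝ => 1 / c.μ * x) atTop atTop :=
      tendsto_id.const_mul_atTop (by have := c.μpos; positivity)
    refine tendsto_atTop_mono' _ ?_ h1
    filter_upwards [eventually_ge_atTop 0] with x hx
    have := growth c.ξ_deriv (fun x => (c.inv_a_bound x).1) hx
    rw [c.ξ_zero] at this; linarith
  · have h1 : Tendsto (fun x : ℝ => 1 / c.μ * x) atBot atBot :=
      tendsto_id.const_mul_atBot (by have := c.μpos; positivity)
    refine tendsto_atBot_mono' _ ?_ h1
    filter_upwards [eventually_le_atBot 0] with x hx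
    have := growth c.ξ_deriv (fun x => (c.inv_a_bound x).1) hx
    rw [c.ξ_zero] at this; linarith

theorem ξ_inv : ∃ η : ℝ → ℝ, Continuous η ∧ (∀ x, η (c.ξ x) = x) ∧ ∀ z, c.ξ (η z) = z := by
  let e := c.ξ_mono.orderIsoOfSurjective _ c.ξ_surj
  exact ⟨e.symm, e.symm.continuous, fun x => e.symm_apply_apply x, fun z => e.apply_symm_apply z⟩

/-- nice test functions; `k = (γ - r) ψ - (a ψ')'`. -/
structure N (ψ ψ' k : ℝ → ℝ) : Prop where
  d1 : ∀ x, HasDerivAt ψ (ψ' x) x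
  d2 : ∀ x, HasDerivAt (fun y => c.a y * ψ' y) ((c.γ - c.r x) * ψ x - k x) x
  kc : Continuous k
  cs : HasCompactSupport ψ

theorem density {g : ℝ → ℝ} (hg : Continuous g) (hcs : HasCompactSupport g) (h0 : ∀ x, 0 ≤ g x)
    {ε : ℝ} (hε : 0 < ε) : ∃ ψ ψ' k, c.N ψ ψ' k ∧ ∀ x, 0 ≤ ψ x ∧ ψ x ≤ g x ∧ g x - ε ≤ ψ x := by
  obtain ⟨η, hηc, hη1, hη2⟩ := c.ξ_inv
  obtain ⟨Φ, hΦ, hb⟩ := smooth_below (hg.comp hηc) (fun x => h0 _) hε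
  have hΦ1 : ContDiff ℝ 1 (deriv Φ) := by
    have := (contDiff_succ_iff_deriv (n := 1) (f := Φ)).mp (by norm_num; exact hΦ)
    exact this.2.2
  have hΦ2 : Continuous (deriv (deriv Φ)) := hΦ1.continuous_deriv le_rfl
  have D1 : ∀ z, HasDerivAt Φ (deriv Φ z) z := fun z =>
    (hΦ.differentiable (by norm_num) z).hasDerivAt
  have D2 : ∀ z, HasDerivAt (deriv Φ) (deriv (deriv Φ) z) z := fun z =>
    (hΦ1.differentiable (by norm_num) z).hasDerivAt
  have hb' : ∀ x, 0 ≤ Φ (c.ξ x) ∧ Φ (c.ξ x) ≤ g x ∧ g x - ε ≤ Φ (c.ξ x) := by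
    intro x
    have := hb (c.ξ x)
    simpa only [Function.comp, hη1] using this
  refine ⟨fun x => Φ (c.ξ x), fun x => deriv Φ (c.ξ x) * (1 / c.a x),
    fun x => (c.γ - c.r x) * Φ (c.ξ x) - deriv (deriv Φ) (c.ξ x) * (1 / c.a x), ⟨?_, ?_, ?_, ?_⟩, hb'⟩
  · intro x
    exact (D1 _).comp x (c.ξ_deriv x)
  · intro x
    have e : (fun y => c.a y * (deriv Φ (c.ξ y) * (1 / c.a y))) = fun y => deriv Φ (c.ξ y) := by
      ext y
      have := (c.apos y).ne'
      field_simp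
    rw [e]
    refine ((D2 _).comp x (c.ξ_deriv x)).congr_deriv ?_
    ring
  · have h1 := c.ξ_cont
    have h2 := hΦ.continuous
    have h3 := c.hrc
    have h4 := c.inv_a_cont
    exact ((continuous_const.sub h3).mul (h2.comp h1)).sub ((hΦ2.comp h1).mul h4)
  · refine HasCompactSupport.intro hcs fun x hx => ?_
    have h1 := hb' x
    rw [image_eq_zero_of_notMem_tsupport hx] at h1
    exact le_antisymm h1.2.1 h1.1

variable {c}
theorem N.cont {ψ ψ' k : ℝ → ℝ} (h : c.N ψ ψ' k) : Continuous ψ :=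
  continuous_iff_continuousAt.mpr fun x => (h.d1 x).continuousAt

theorem N.zero_off {ψ ψ' k : ℝ → ℝ} (h : c.N ψ ψ' k) {x : ℝ} (hx : x ∉ tsupport ψ) :
    ψ x = 0 ∧ ψ' x = 0 ∧ k x = 0 := by
  have hev : ∀ᶠ y in nhds x, ψ y = 0 := by
    filter_upwards [(isClosed_tsupport ψ).isOpen_compl.mem_nhds hx] with y hy
    exact image_eq_zero_of_notMem_tsupport hy
  have h1 : ∀ y, y ∉ tsupport ψ → ψ' y = 0 := by
    intro y hy
    have hev : ψ =ᶠ[nhds y] fun _ => 0 := by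
      filter_upwards [(isClosed_tsupport ψ).isOpen_compl.mem_nhds hy] with y hy
      exact image_eq_zero_of_notMem_tsupport hy
    exact (h.d1 y).unique ((hasDerivAt_const y (0:ℝ)).congr_of_eventuallyEq hev)
  have h2 : (fun y => c.a y * ψ' y) =ᶠ[nhds x] fun _ => 0 := by
    filter_upwards [(isClosed_tsupport ψ).isOpen_compl.mem_nhds hx] with y hy
    simp [h1 y hy]
  have h3 := (h.d2 x).unique ((hasDerivAt_const x (0:ℝ)).congr_of_eventuallyEq h2)
  have h4 : ψ x = 0 := hev.self_of_nhds
  refine ⟨h4, h1 x hx, ?_⟩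
  rw [h4] at h3; linarith

theorem N.kcs {ψ ψ' k : ℝ → ℝ} (h : c.N ψ ψ' k) : HasCompactSupport k :=
  HasCompactSupport.intro h.cs fun x hx => (h.zero_off hx).2.2

variable (c)
theorem d_comp {t : ℝ} (ht : 0 < t) (x y : ℝ) :
    |(c.T x - c.T y - c.W * t) - (c.Tt x - c.Tt y - c.W * t)| ≤
      (c.C1 + (2 * c.τ1 / c.τ0) * (1 + c.W)) *
        (min |c.T x - c.T y - c.W * t| |c.Tt x - c.Tt y - c.W * t| + Real.sqrt t) := by
  set d := c.T x - c.T y - c.W * t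
  set e := c.Tt x - c.Tt y - c.W * t
  have h1 : |d - e| ≤ c.C1 := by
    have := c.comp x y
    have e1 : d - e = (c.T x - c.T y) - (c.Tt x - c.Tt y) := by simp only [d, e]; ring
    rwa [e1]
  have hW := c.W0
  have hC := c.C10
  have h0 := c.τ00
  have h10 := c.τ10
  have hs : 0 ≤ Real.sqrt t := Real.sqrt_nonneg t
  have hm : 0 ≤ min |d| |e| := le_min (abs_nonneg _) (abs_nonneg _)
  have hq : 0 ≤ 2 * c.τ1 / c.τ0 := by positivity
  rcases le_total 1 t with ht1 | ht1
  · have hs1 : 1 ≤ Real.sqrt t := by rwa [Real.one_le_sqrt]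
    calc |d - e| ≤ c.C1 * 1 := by linarith
      _ ≤ (c.C1 + (2 * c.τ1 / c.τ0) * (1 + c.W)) * (min |d| |e| + Real.sqrt t) := by
        have : 0 ≤ (2 * c.τ1 / c.τ0) * (1 + c.W) := by positivity
        gcongr <;> linarith
  · have hts : t ≤ Real.sqrt t := by
      have h2 : Real.sqrt t ≤ 1 := by rw [Real.sqrt_le_one]; exact ht1
      nlinarith [Real.mul_self_sqrt ht.le]
    have hlow : ∀ f f' : ℝ → ℝ, (∀ x, HasDerivAt f (f' x) x) → (∀ x, c.τ0 ≤ f' x ∧ f' x ≤ c.τ1) →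
        c.τ0 * |x - y| ≤ |f x - f y| ∧ |f x - f y| ≤ c.τ1 * |x - y| := by
      intro f f' hf hb
      refine ⟨?_, abs_sub_le_of_deriv hf (fun z => ?_) x y⟩
      · rcases le_total x y with hxy | hxy
        · have := growth hf (fun z => (hb z).1) hxy
          rw [abs_sub_comm x y, abs_of_nonneg (sub_nonneg.mpr hxy), abs_sub_comm]
          exact this.trans (le_abs_self _)
        · have := growth hf (fun z => (hb z).1) hxy
          rw [abs_of_nonneg (sub_nonneg.mpr hxy)]
          exact this.trans (le_abs_self _)
      · rw [abs_of_nonneg (by linarith [(hb z).1])]; exact (hb z).2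
    have hT := hlow c.T c.Td c.Tder c.Tdb
    have hTt := hlow c.Tt c.Ttd c.Ttder c.Ttdb
    have hWt : |c.W * t| ≤ c.W * Real.sqrt t := by
      rw [abs_of_pos (by positivity)]; gcongr
    have k1 : |c.T x - c.T y| ≤ |d| + c.W * Real.sqrt t := by
      have : c.T x - c.T y = d + c.W * t := by simp only [d]; ring
      rw [this]; exact (abs_add_le _ _).trans (by linarith)
    have k2 : |c.Tt x - c.Tt y| ≤ |e| + c.W * Real.sqrt t := by
      have : c.Tt x - c.Tt y = e + c.W * t := by simp only [e]; ring
      rw [this]; exact (abs_add_le _ _).trans (by linarith)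
    have hx : c.τ0 * |x - y| ≤ min |d| |e| + c.W * Real.sqrt t := by
      rcases min_choice |d| |e| with hh | hh <;> rw [hh] <;> linarith [hT.1, hTt.1]
    have hde : |d - e| ≤ 2 * c.τ1 * |x - y| := by
      have e1 : d - e = (c.T x - c.T y) - (c.Tt x - c.Tt y) := by simp only [d, e]; ring
      rw [e1]
      exact (abs_sub _ _).trans (by linarith [hT.2, hTt.2])
    calc |d - e| ≤ 2 * c.τ1 * |x - y| := hde
      _ = 2 * c.τ1 / c.τ0 * (c.τ0 * |x - y|) := by field_simp
      _ ≤ 2 * c.τ1 / c.τ0 * (min |d| |e| + c.W * Real.sqrt t) := by gcongr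
      _ ≤ 2 * c.τ1 / c.τ0 * ((1 + c.W) * (min |d| |e| + Real.sqrt t)) := by
        gcongr
        nlinarith
      _ = (0 + (2 * c.τ1 / c.τ0) * (1 + c.W)) * (min |d| |e| + Real.sqrt t) := by ring
      _ ≤ _ := by gcongr

end Ctx

/-! ### Part 11 -/
theorem integrable_exp_abs {κ : ℝ} (hκ : 0 < κ) : Integrable fun x : ℝ => Real.exp (-κ * |x|) := by
  rw [← integrableOn_univ, ← Set.Iic_union_Ioi (a := (0:ℝ))]
  refine IntegrableOn.union ?_ ?_
  · refine (integrableOn_exp_mul_Iic hκ 0).congr_fun (fun x hx => ?_) measurableSet_Iic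
    simp only [Set.mem_Iic] at hx
    simp [abs_of_nonpos hx]
  · refine (integrableOn_exp_mul_Ioi (show -κ < 0 by linarith) 0).congr_fun (fun x hx => ?_) measurableSet_Ioi
    simp only [Set.mem_Ioi] at hx
    simp [abs_of_pos hx]

/-- complex L² space -/
noncomputable abbrev L2 := Lp ℂ 2 (volume : Measure ℝ)

structure Ker (k : ℝ → ℝ → ℝ) (M κ : ℝ) : Prop where
  meas : Measurable (Function.uncurry k)
  M0 : 0 ≤ M
  κ0 : 0 < κ
  bd : ∀ x w, |k x w| ≤ M * Real.exp (-κ * |x - w|)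

theorem Ker.swap {k : ℝ → ℝ → ℝ} {M κ : ℝ} (h : Ker k M κ) : Ker (fun x w => k w x) M κ where
  meas := h.meas.comp measurable_swap
  M0 := h.M0
  κ0 := h.κ0
  bd x w := by rw [abs_sub_comm]; exact h.bd w x

noncomputable def kop (k : ℝ → ℝ → ℝ) (h : ℝ → ℂ) (x : ℝ) : ℂ := ∫ w, (k x w : ℂ) * h w

theorem L2.sq_int (h : L2) : Integrable fun w => ‖h w‖ ^ 2 :=
  (memLp_two_iff_integrable_sq_norm (Lp.memLp h).1).mp (Lp.memLp h)

theorem L2.norm_sq (h : L2) : ‖h‖ ^ 2 = ∫ w, ‖h w‖ ^ 2 := by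
  have h1 := @inner_self_eq_norm_sq_to_K ℂ _ _ _ _ h
  rw [L2.inner_def] at h1
  have h2 : ∀ a, inner ℂ (h a) (h a) = ((‖h a‖ ^ 2 : ℝ) : ℂ) := fun a => by
    rw [inner_self_eq_norm_sq_to_K]; simp
  simp only [h2] at h1
  rw [integral_complex_ofReal] at h1
  exact Complex.ofReal_injective (by push_cast at h1 ⊢; exact h1.symm)

section
variable {k : ℝ → ℝ → ℝ} {M κ : ℝ}

theorem Ker.int2 (hk : Ker k M κ) (h : L2) (x : ℝ) :
    Integrable fun w => Real.exp (-κ * |x - w|) * ‖h w‖ ^ 2 := by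
  refine (L2.sq_int h).bdd_mul (c := 1) ?_ ?_
  · exact (by fun_prop : Continuous fun w : ℝ => Real.exp (-κ * |x - w|)).aestronglyMeasurable
  · refine Eventually.of_forall fun w => ?_
    rw [Real.norm_of_nonneg (Real.exp_nonneg _), Real.exp_le_one_iff]
    have := hk.κ0
    nlinarith [abs_nonneg (x - w)]

theorem Ker.int0 (hk : Ker k M κ) (x : ℝ) :
    Integrable fun w => Real.exp (-κ * |x - w|) :=
  (integrable_exp_abs hk.κ0).comp_sub_left x

theorem Ker.int1 (hk : Ker k M κ) (h : L2) (x : ℝ) :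
    Integrable fun w => Real.exp (-κ * |x - w|) * ‖h w‖ := by
  refine ((hk.int0 x).add (hk.int2 h x)).mono' ?_ ?_
  · exact (by fun_prop : Continuous fun w : ℝ => Real.exp (-κ * |x - w|)).aestronglyMeasurable.mul
      (Lp.aestronglyMeasurable h).norm
  · refine Eventually.of_forall fun w => ?_
    rw [Real.norm_of_nonneg (by positivity)]
    have h1 := Real.exp_pos (-κ * |x - w|)
    have h2 := norm_nonneg (h w)
    simp only [Pi.add_apply]
    nlinarith [mul_nonneg h1.le (sq_nonneg (‖h w‖ - 1)), mul_nonneg h1.le (sq_nonneg (‖h w‖))]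

theorem Ker.meas_row (hk : Ker k M κ) (x : ℝ) : Measurable fun w => (k x w : ℂ) :=
  Complex.measurable_ofReal.comp (hk.meas.comp (measurable_const.prodMk measurable_id))

theorem Ker.int (hk : Ker k M κ) (h : L2) (x : ℝ) :
    Integrable fun w => (k x w : ℂ) * h w := by
  refine ((hk.int1 h x).const_mul M).mono' ?_ ?_
  · exact (hk.meas_row x).aestronglyMeasurable.mul (Lp.aestronglyMeasurable h)
  · refine Eventually.of_forall fun w => ?_
    rw [norm_mul, Complex.norm_real, Real.norm_eq_abs, ← mul_assoc]
    gcongr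
    exact hk.bd x w

/-- total mass -/
noncomputable def eS (κ : ℝ) : ℝ := ∫ z : ℝ, Real.exp (-κ * |z|)

theorem eS_pos (hκ : 0 < κ) : 0 < eS κ := by
  have h := integral_pos_iff_support_of_nonneg (f := fun z : ℝ => Real.exp (-κ * |z|)) 
    (fun z => (Real.exp_pos _).le) (integrable_exp_abs hκ)
  rw [eS, h]
  have : Function.support (fun z : ℝ => Real.exp (-κ * |z|)) = Set.univ := by
    ext z; simp [Real.exp_ne_zero]
  rw [this]; simp

theorem Ker.norm_le (hk : Ker k M κ) (h : L2) (x : ℝ) :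
    ‖kop k h x‖ ^ 2 ≤ M ^ 2 * eS κ * ∫ w, Real.exp (-κ * |x - w|) * ‖h w‖ ^ 2 := by
  set p := ∫ w, Real.exp (-κ * |x - w|) * ‖h w‖ with hp
  set q := ∫ w, Real.exp (-κ * |x - w|) * ‖h w‖ ^ 2 with hq
  have hS := eS_pos hk.κ0
  have e0 : ∫ w, Real.exp (-κ * |x - w|) = eS κ :=
    integral_sub_left_eq_self (fun z => Real.exp (-κ * |z|)) volume x
  have h1 : ‖kop k h x‖ ≤ M * p := by
    rw [hp, ← integral_const_mul]
    refine norm_integral_le_of_norm_le ((hk.int1 h x).const_mul M) (Eventually.of_forall fun w => ?_)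
    rw [norm_mul, Complex.norm_real, Real.norm_eq_abs, ← mul_assoc]
    gcongr
    exact hk.bd x w
  have h2 : ∀ δ : ℝ, 0 ≤ q - 2 * δ * p + δ ^ 2 * eS κ := by
    intro δ
    have : 0 ≤ ∫ w, Real.exp (-κ * |x - w|) * (‖h w‖ - δ) ^ 2 :=
      integral_nonneg fun w => by positivity
    have e : ∀ w, Real.exp (-κ * |x - w|) * (‖h w‖ - δ) ^ 2 =
        Real.exp (-κ * |x - w|) * ‖h w‖ ^ 2 - 2 * δ * (Real.exp (-κ * |x - w|) * ‖h w‖)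
          + δ ^ 2 * Real.exp (-κ * |x - w|) := fun w => by ring
    simp only [e] at this
    rw [integral_add (f := fun w => Real.exp (-κ * |x - w|) * ‖h w‖ ^ 2
        - 2 * δ * (Real.exp (-κ * |x - w|) * ‖h w‖))
        ((hk.int2 h x).sub ((hk.int1 h x).const_mul _)) ((hk.int0 x).const_mul _),
      integral_sub (hk.int2 h x) ((hk.int1 h x).const_mul _), integral_const_mul, integral_const_mul,
      e0] at this
    exact this
  have h3 : p ^ 2 ≤ eS κ * q := by
    have := h2 (p / eS κ)
    have e : q - 2 * (p / eS κ) * p + (p / eS κ) ^ 2 * eS κ = q - p ^ 2 / eS κ := by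
      field_simp; ring
    rw [e, sub_nonneg, div_le_iff₀ hS] at this
    linarith
  calc ‖kop k h x‖ ^ 2 ≤ (M * p) ^ 2 := pow_le_pow_left₀ (norm_nonneg _) h1 2
    _ = M ^ 2 * p ^ 2 := by ring
    _ ≤ M ^ 2 * (eS κ * q) := by gcongr
    _ = _ := by ring

theorem Ker.bound (hk : Ker k M κ) (h : L2) (x : ℝ) :
    ‖kop k h x‖ ≤ M * Real.sqrt (eS κ) * ‖h‖ := by
  have hS := eS_pos hk.κ0
  have hM := hk.M0
  apply le_of_sq_le_sq _ (by positivity)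
  rw [mul_pow, mul_pow, Real.sq_sqrt hS.le, L2.norm_sq]
  refine (hk.norm_le h x).trans ?_
  gcongr
  · exact hk.int2 h x
  · exact L2.sq_int h
  · intro w
    have : Real.exp (-κ * |x - w|) ≤ 1 := by
      rw [Real.exp_le_one_iff]
      have := hk.κ0
      nlinarith [abs_nonneg (x - w)]
    simp only
    nlinarith [sq_nonneg ‖h w‖]

theorem Ker.conv (hk : Ker k M κ) {f : ℝ → ℝ} (hf : Integrable f) :
    Integrable (fun p : ℝ × ℝ => Real.exp (-κ * |p.1 - p.2|) * f p.2) (volume.prod volume) := by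
  have := hf.convolution_integrand (ContinuousLinearMap.mul ℝ ℝ) (integrable_exp_abs hk.κ0)
  refine this.congr (Eventually.of_forall fun p => ?_)
  simp [mul_comm]

theorem Ker.q_int (hk : Ker k M κ) (h : L2) :
    Integrable (fun x => ∫ w, Real.exp (-κ * |x - w|) * ‖h w‖ ^ 2) ∧
    ∫ x, (∫ w, Real.exp (-κ * |x - w|) * ‖h w‖ ^ 2) = eS κ * ‖h‖ ^ 2 := by
  have hi := hk.conv (L2.sq_int h)
  refine ⟨hi.integral_prod_left, ?_⟩
  rw [integral_integral_swap hi]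
  have : ∀ w, ∫ x, Real.exp (-κ * |x - w|) * ‖h w‖ ^ 2 = eS κ * ‖h w‖ ^ 2 := by
    intro w
    rw [integral_mul_const]
    congr 1
    exact integral_sub_right_eq_self (fun z => Real.exp (-κ * |z|)) w
  simp only [this]
  rw [integral_const_mul, L2.norm_sq]

theorem Ker.memLp (hk : Ker k M κ) (h : L2) : MemLp (kop k h) 2 volume := by
  have hm : AEStronglyMeasurable (kop k h) volume := by
    have h1 : StronglyMeasurable (Function.uncurry fun x w => (k x w : ℂ) * h w) :=
      (Complex.measurable_ofReal.comp hk.meas).stronglyMeasurable.mul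
        ((Lp.stronglyMeasurable h).comp_measurable measurable_snd)
    exact h1.integral_prod_right.aestronglyMeasurable
  rw [memLp_two_iff_integrable_sq_norm hm]
  refine ((hk.q_int h).1.const_mul (M ^ 2 * eS κ)).mono' (hm.norm.pow 2) (Eventually.of_forall fun x => ?_)
  rw [Real.norm_of_nonneg (by positivity)]
  exact hk.norm_le h x

theorem Ker.exists_op (hk : Ker k M κ) : ∃ T : L2 →L[ℂ] L2, ∀ h : L2, T h =ᵐ[volume] kop k h := by
  let L : L2 →ₗ[ℂ] L2 :=
    { toFun := fun h => (hk.memLp h).toLp _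
      map_add' := fun f g => by
        rw [← MemLp.toLp_add]
        refine MemLp.toLp_congr _ _ (Eventually.of_forall fun x => ?_)
        simp only [kop, Pi.add_apply]
        rw [← integral_add (hk.int f x) (hk.int g x)]
        refine integral_congr_ae ?_
        filter_upwards [Lp.coeFn_add f g] with w hw
        rw [hw, Pi.add_apply, mul_add]
      map_smul' := fun c f => by
        rw [RingHom.id_apply, ← MemLp.toLp_const_smul]
        refine MemLp.toLp_congr _ _ (Eventually.of_forall fun x => ?_)
        simp only [kop, Pi.smul_apply]
        rw [← integral_smul]
        refine integral_congr_ae ?_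
        filter_upwards [Lp.coeFn_smul c f] with w hw
        rw [hw, Pi.smul_apply, smul_eq_mul, smul_eq_mul]; ring }
  have hL : ∀ h : L2, L h =ᵐ[volume] kop k h := fun h => MemLp.coeFn_toLp (hk.memLp h)
  have hS := eS_pos hk.κ0
  have hM := hk.M0
  refine ⟨L.mkContinuous (M * eS κ) fun h => ?_, hL⟩
  apply le_of_sq_le_sq _ (by positivity)
  rw [L2.norm_sq, integral_congr_ae (g := fun w => ‖kop k h w‖ ^ 2)]
  · calc ∫ w, ‖kop k h w‖ ^ 2 ≤ ∫ x, M ^ 2 * eS κ * ∫ w, Real.exp (-κ * |x - w|) * ‖h w‖ ^ 2 := by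
          refine integral_mono ?_ ((hk.q_int h).1.const_mul _) (hk.norm_le h)
          exact (memLp_two_iff_integrable_sq_norm (hk.memLp h).1).mp (hk.memLp h)
      _ = (M * eS κ * ‖h‖) ^ 2 := by
        rw [integral_const_mul, (hk.q_int h).2]; ring
  · filter_upwards [hL h] with w hw
    rw [hw]

theorem Ker.adjoint (hk : Ker k M κ) (f g : L2) :
    ∫ x, inner ℂ (kop k f x) (g x) = ∫ w, inner ℂ (f w) (kop (fun x w => k w x) g w) := by
  have hi : Integrable (fun p : ℝ × ℝ => (k p.1 p.2 : ℂ) * (starRingEnd ℂ (f p.2) * g p.1))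
      (volume.prod volume) := by
    have i1 := hk.conv (L2.sq_int f)
    have i2 := (hk.conv (L2.sq_int g)).swap
    refine ((i1.add i2).const_mul M).mono' ?_ (Eventually.of_forall fun p => ?_)
    · exact ((Complex.measurable_ofReal.comp hk.meas).stronglyMeasurable.mul
        (((Complex.continuous_conj.comp_stronglyMeasurable (Lp.stronglyMeasurable f)).comp_measurable
          measurable_snd).mul ((Lp.stronglyMeasurable g).comp_measurable measurable_fst))).aestronglyMeasurable
    · rw [norm_mul, norm_mul, Complex.norm_real, Real.norm_eq_abs, RCLike.norm_conj]
      simp only [Pi.add_apply, Function.comp, Prod.fst_swap, Prod.snd_swap]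
      rw [abs_sub_comm p.2 p.1]
      have hM := hk.M0
      calc |k p.1 p.2| * (‖f p.2‖ * ‖g p.1‖)
          ≤ (M * Real.exp (-κ * |p.1 - p.2|)) * (‖f p.2‖ ^ 2 + ‖g p.1‖ ^ 2) := by
            gcongr
            · exact hk.bd _ _
            · nlinarith [sq_nonneg (‖f p.2‖ - ‖g p.1‖), sq_nonneg (‖f p.2‖), sq_nonneg ‖g p.1‖]
        _ = _ := by ring
  have h1 : ∀ x, inner ℂ (kop k f x) (g x) = ∫ w, (k x w : ℂ) * (starRingEnd ℂ (f w) * g x) := by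
    intro x
    rw [RCLike.inner_apply, kop, ← integral_conj, ← integral_const_mul]
    congr 1; ext w
    simp; ring
  have h2 : ∀ w, inner ℂ (f w) (kop (fun x w => k w x) g w) =
      ∫ x, (k x w : ℂ) * (starRingEnd ℂ (f w) * g x) := by
    intro w
    rw [RCLike.inner_apply, kop, ← integral_mul_const]
    congr 1; ext x
    ring
  simp only [h1, h2]
  exact integral_integral_swap hi

end

/-! ### Part 12 -/
theorem tail_cont {f : ℝ → ℂ} (hf : ∀ x, IntegrableOn f (Set.Ioi x)) :
    Continuous fun x => ∫ v in Set.Ioi x, f v := by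
  have hii : ∀ a b, IntervalIntegrable f volume a b := by
    intro a b
    rw [intervalIntegrable_iff]
    exact (hf (min a b)).mono_set fun z hz => hz.1
  have e : (fun x => ∫ v in Set.Ioi x, f v) =
      fun x => (∫ v in Set.Ioi 0, f v) - ∫ v in (0:ℝ)..x, f v := by
    ext x
    rw [← intervalIntegral.integral_Ioi_sub_Ioi' (hf 0) (hf x)]; ring
  rw [e]
  exact continuous_const.sub (intervalIntegral.continuous_primitive hii 0)

theorem tail_deriv {f : ℝ → ℂ} (hf : ∀ x, IntegrableOn f (Set.Ioi x)) {g : ℝ → ℂ} (hfg : f =ᵐ[volume] g)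
    (hg : Continuous g) (x : ℝ) : HasDerivAt (fun x => ∫ v in Set.Ioi x, f v) (-g x) x := by
  have e : (fun x => ∫ v in Set.Ioi x, f v) =
      fun x => (∫ v in Set.Ioi 0, f v) - ∫ v in (0:ℝ)..x, g v := by
    ext x
    have h1 : ∫ v in (0:ℝ)..x, g v = ∫ v in (0:ℝ)..x, f v := by
      apply intervalIntegral.integral_congr_ae
      filter_upwards [hfg] with z hz _ using hz.symm
    rw [h1, ← intervalIntegral.integral_Ioi_sub_Ioi' (hf 0) (hf x)]; ring
  rw [e]
  refine ((hg.integral_hasStrictDerivAt 0 x).hasDerivAt.const_sub _).congr_deriv rfl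

theorem head_deriv {g : ℝ → ℂ} (hf : ∀ x, IntegrableOn g (Set.Iic x))
    (hg : Continuous g) (x : ℝ) : HasDerivAt (fun x => ∫ v in Set.Iic x, g v) (g x) x := by
  have e : (fun x => ∫ v in Set.Iic x, g v) =
      fun x => (∫ v in Set.Iic 0, g v) + ∫ v in (0:ℝ)..x, g v := by
    ext x
    rw [← intervalIntegral.integral_Iic_sub_Iic (hf 0) (hf x)]; ring
  rw [e]
  exact ((hg.integral_hasStrictDerivAt 0 x).hasDerivAt.const_add _)

namespace Ctx
variable (c : Ctx)

noncomputable def b (x w : ℝ) : ℝ := if w < x then c.φ x / (Real.sqrt (c.a w) * c.φ w) else 0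

theorem kb : Ker c.b (c.K * Real.sqrt c.μ) c.κ where
  meas := by
    refine Measurable.ite (measurableSet_lt measurable_snd measurable_fst) ?_ measurable_const
    exact ((c.φc.measurable.comp measurable_fst).div
      (((c.hac.measurable.comp measurable_snd).sqrt).mul (c.φc.measurable.comp measurable_snd)))
  M0 := mul_nonneg c.K0.le (Real.sqrt_nonneg _)
  κ0 := c.κ0
  bd x w := by
    have hK := c.K0
    have hμ := c.μpos
    unfold b
    split_ifs with h
    · have h1 := c.dec w x h.le
      have p1 := c.hφ.pos x
      have p2 := c.hφ.pos w
      have p3 := c.apos w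
      have p4 := Real.sqrt_pos.mpr p3
      rw [abs_of_pos (by positivity), abs_of_pos (show 0 < x - w by linarith)]
      have h2 : 1 ≤ Real.sqrt c.μ * Real.sqrt (c.a w) := by
        rw [← Real.sqrt_mul hμ.le, Real.one_le_sqrt]
        have := (c.ha w).1
        rw [div_le_iff₀ hμ] at this
        linarith
      rw [div_le_iff₀ (by positivity)]
      calc c.φ x ≤ (c.K * Real.exp (-c.κ * (x - w)) * c.φ w) * 1 := by linarith
        _ ≤ (c.K * Real.exp (-c.κ * (x - w)) * c.φ w) * (Real.sqrt c.μ * Real.sqrt (c.a w)) := by gcongr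
        _ = _ := by ring
    · rw [abs_zero]; positivity

noncomputable def B : L2 →L[ℂ] L2 := c.kb.exists_op.choose
noncomputable def B' : L2 →L[ℂ] L2 := c.kb.swap.exists_op.choose
theorem B_spec (h : L2) : c.B h =ᵐ[volume] kop c.b h := c.kb.exists_op.choose_spec h
theorem B'_spec (h : L2) : c.B' h =ᵐ[volume] kop (fun x w => c.b w x) h :=
  c.kb.swap.exists_op.choose_spec h

theorem B_adj : c.B = ContinuousLinearMap.adjoint c.B' := by
  rw [ContinuousLinearMap.eq_adjoint_iff]
  intro f g
  rw [L2.inner_def, L2.inner_def]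
  calc ∫ x, inner ℂ (c.B f x) (g x) = ∫ x, inner ℂ (kop c.b f x) (g x) := by
        refine integral_congr_ae ?_
        filter_upwards [c.B_spec f] with x hx
        rw [hx]
    _ = _ := c.kb.adjoint f g
    _ = _ := by
        refine integral_congr_ae ?_
        filter_upwards [c.B'_spec g] with x hx
        rw [hx]

noncomputable def R : L2 →L[ℂ] L2 := c.B ∘L c.B'

theorem R_pos : c.R.IsPositive := by
  have := ContinuousLinearMap.isPositive_adjoint_comp_self c.B'
  rw [← c.B_adj] at this
  exact this

noncomputable def F (h : L2) (w : ℝ) : ℂ := ∫ x in Set.Ioi w, (c.φ x : ℂ) * h x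
noncomputable def g (h : L2) (w : ℝ) : ℂ := ((1 / (c.a w * c.φ w ^ 2) : ℝ) : ℂ) * c.F h w
noncomputable def Rc (h : L2) (x : ℝ) : ℂ := (c.φ x : ℂ) * ∫ w in Set.Iic x, c.g h w

theorem F_int (h : L2) (w : ℝ) : IntegrableOn (fun x => (c.φ x : ℂ) * h x) (Set.Ioi w) := by
  have h1 := c.kb.swap.int h w
  have p2 := c.hφ.pos w
  have p4 := Real.sqrt_pos.mpr (c.apos w)
  rw [← integrable_indicator_iff measurableSet_Ioi]
  refine (h1.const_mul ((Real.sqrt (c.a w) * c.φ w : ℝ) : ℂ)).congr (Eventually.of_forall fun x => ?_)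
  simp only [b, Set.indicator, Set.mem_Ioi]
  split_ifs with hh
  · rw [← mul_assoc, ← Complex.ofReal_mul]
    congr 2; field_simp
  · simp

theorem kop_F (h : L2) (w : ℝ) : kop (fun x w => c.b w x) h w =
    ((1 / (Real.sqrt (c.a w) * c.φ w) : ℝ) : ℂ) * c.F h w := by
  rw [kop, F, ← integral_indicator measurableSet_Ioi, ← integral_const_mul]
  congr 1; ext x
  simp only [b, Set.indicator, Set.mem_Ioi]
  split_ifs with hh
  · rw [← mul_assoc, ← Complex.ofReal_mul]
    congr 2; ring
  · simp

theorem F_cont (h : L2) : Continuous (c.F h) := tail_cont (c.F_int h)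

theorem inv_cont : Continuous fun w => 1 / (c.a w * c.φ w ^ 2) :=
  continuous_const.div (c.hac.mul (c.φc.pow 2)) fun w =>
    (mul_pos (c.apos w) (pow_pos (c.hφ.pos w) 2)).ne'

theorem g_cont (h : L2) : Continuous (c.g h) :=
  (Complex.continuous_ofReal.comp c.inv_cont).mul (c.F_cont h)

theorem b_B' (h : L2) (x : ℝ) : (fun w => (c.b x w : ℂ) * c.B' h w) =ᵐ[volume]
    (Set.Iio x).indicator (fun w => (c.φ x : ℂ) * c.g h w) := by
  filter_upwards [c.B'_spec h] with w hw
  rw [hw, kop_F]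
  simp only [b, Set.indicator, Set.mem_Iio, g]
  split_ifs with hh
  · rw [← mul_assoc, ← mul_assoc, ← Complex.ofReal_mul, ← Complex.ofReal_mul]
    congr 2
    have p2 := c.hφ.pos w
    have p4 := Real.sqrt_pos.mpr (c.apos w)
    have := Real.sq_sqrt (c.apos w).le
    have p5 := c.apos w
    field_simp
    rw [this]
  · simp

theorem g_int (h : L2) (x : ℝ) : IntegrableOn (c.g h) (Set.Iic x) := by
  have h1 := (c.kb.int (c.B' h) x).congr (c.b_B' h x)
  rw [integrable_indicator_iff measurableSet_Iio] at h1
  rw [integrableOn_Iic_iff_integrableOn_Iio]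
  have h2 : IntegrableOn (fun w => ((c.φ x : ℂ))⁻¹ * ((c.φ x : ℂ) * c.g h w)) (Set.Iio x) :=
    Integrable.const_mul h1 _
  refine h2.congr_fun (fun w _ => ?_) measurableSet_Iio
  have : (c.φ x : ℂ) ≠ 0 := by exact_mod_cast (c.hφ.pos x).ne'
  field_simp

theorem Rc_eq (h : L2) (x : ℝ) : c.Rc h x = kop c.b (c.B' h) x := by
  rw [kop, integral_congr_ae (c.b_B' h x), integral_indicator measurableSet_Iio,
    integral_const_mul, Rc, integral_Iic_eq_integral_Iio]

theorem R_ae (h : L2) : c.R h =ᵐ[volume] c.Rc h := by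
  filter_upwards [c.B_spec (c.B' h)] with x hx
  rw [c.Rc_eq]
  exact hx

/-- evaluation functional -/
theorem exists_Rx : ∃ C : ℝ, 0 < C ∧ ∃ Rx : ℝ → L2 →L[ℂ] ℂ, (∀ x h, Rx x h = c.Rc h x) ∧
    ∀ x h, ‖Rx x h‖ ≤ C * ‖h‖ := by
  let L : ℝ → L2 →ₗ[ℂ] ℂ := fun x =>
    { toFun := fun h => c.Rc h x
      map_add' := fun f g => by
        rw [Rc_eq, Rc_eq, Rc_eq, map_add]
        simp only [kop]
        rw [← integral_add (c.kb.int _ x) (c.kb.int _ x)]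
        refine integral_congr_ae ?_
        filter_upwards [Lp.coeFn_add (c.B' f) (c.B' g)] with w hw
        rw [hw, Pi.add_apply, mul_add]
      map_smul' := fun s f => by
        rw [RingHom.id_apply, Rc_eq, Rc_eq, map_smul]
        simp only [kop]
        rw [← integral_smul]
        refine integral_congr_ae ?_
        filter_upwards [Lp.coeFn_smul s (c.B' f)] with w hw
        rw [hw, Pi.smul_apply, smul_eq_mul, smul_eq_mul]; ring }
  set C0 := c.K * Real.sqrt c.μ * Real.sqrt (eS c.κ) * ‖c.B'‖
  have hb : ∀ x h, ‖L x h‖ ≤ (C0 + 1) * ‖h‖ := by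
    intro x h
    change ‖c.Rc h x‖ ≤ _
    rw [Rc_eq]
    refine (c.kb.bound (c.B' h) x).trans ?_
    have h1 := c.B'.le_opNorm h
    have h2 : 0 ≤ c.K * Real.sqrt c.μ * Real.sqrt (eS c.κ) := by
      have := c.K0; positivity
    calc _ ≤ c.K * Real.sqrt c.μ * Real.sqrt (eS c.κ) * (‖c.B'‖ * ‖h‖) := by gcongr
      _ = C0 * ‖h‖ := by simp only [C0]; ring
      _ ≤ _ := by gcongr; linarith
  refine ⟨C0 + 1, ?_, fun x => (L x).mkContinuous (C0 + 1) (hb x), fun x h => rfl, hb⟩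
  have := c.K0
  positivity

noncomputable def Rd (h : L2) (x : ℝ) : ℂ := (c.φ' x : ℂ) * (∫ w in Set.Iic x, c.g h w) + (c.φ x : ℂ) * c.g h x

theorem Rc_d1 (h : L2) (x : ℝ) : HasDerivAt (c.Rc h) (c.Rd h x) x :=
  (c.hφ.d1 x).ofReal_comp.mul (head_deriv (c.g_int h) (c.g_cont h) x)

theorem Rc_cont (h : L2) : Continuous (c.Rc h) :=
  continuous_iff_continuousAt.mpr fun x => (c.Rc_d1 h x).continuousAt

theorem Rc_d2 (h : L2) {k : ℝ → ℂ} (hk : Continuous k) (hh : h =ᵐ[volume] k) (x : ℝ) :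
    HasDerivAt (fun x => (c.a x : ℂ) * c.Rd h x) (((c.γ - c.r x : ℝ) : ℂ) * c.Rc h x - k x) x := by
  have e : (fun x => (c.a x : ℂ) * c.Rd h x) =
      fun x => ((c.a x * c.φ' x : ℝ) : ℂ) * (∫ w in Set.Iic x, c.g h w) + ((c.φ x : ℝ) : ℂ)⁻¹ * c.F h x := by
    ext x
    have h1 : (c.φ x : ℂ) ≠ 0 := by exact_mod_cast (c.hφ.pos x).ne'
    have h2 : (c.a x : ℂ) ≠ 0 := by exact_mod_cast (c.apos x).ne'
    simp only [Rd, g]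
    push_cast
    field_simp
  rw [e]
  have h1 : (c.φ x : ℂ) ≠ 0 := by exact_mod_cast (c.hφ.pos x).ne'
  have h2 : (c.a x : ℂ) ≠ 0 := by exact_mod_cast (c.apos x).ne'
  have hF : HasDerivAt (c.F h) (-((c.φ x : ℂ) * k x)) x :=
    tail_deriv (c.F_int h) (g := fun x => (c.φ x : ℂ) * k x) (by
      filter_upwards [hh] with w hw
      rw [hw]) ((Complex.continuous_ofReal.comp c.φc).mul hk) x
  refine (((c.hφ.d2 x).ofReal_comp.mul (head_deriv (c.g_int h) (c.g_cont h) x)).add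
    ((c.hφ.d1 x).ofReal_comp.inv h1 |>.mul hF)).congr_deriv ?_
  simp only [Rc, g, Pi.inv_apply]
  push_cast
  field_simp
  ring

end Ctx

/-! ### Part 13 -/
theorem ev_zero_top {f : ℝ → ℝ} (hf : HasCompactSupport f) : Tendsto f atTop (nhds 0) := by
  have := hf.is_zero_at_infty
  exact this.mono_left atTop_le_cocompact

theorem ev_zero_bot {f : ℝ → ℝ} (hf : HasCompactSupport f) : Tendsto f atBot (nhds 0) := by
  have := hf.is_zero_at_infty
  exact this.mono_left atBot_le_cocompact

namespace Ctx
variable {c : Ctx} {ψ ψ' k : ℝ → ℝ}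

theorem N.ccs {f : ℝ → ℝ} (hf : HasCompactSupport f) : HasCompactSupport fun x => (f x : ℂ) :=
  hf.comp_left (g := fun z : ℝ => (z : ℂ)) (by simp)

theorem mem2 {f : ℝ → ℝ} (hc : Continuous f) (hf : HasCompactSupport f) :
    MemLp (fun x => (f x : ℂ)) 2 volume :=
  (Complex.continuous_ofReal.comp hc).memLp_of_hasCompactSupport (N.ccs hf)

noncomputable def lp {f : ℝ → ℝ} (hc : Continuous f) (hf : HasCompactSupport f) : L2 :=
  (mem2 hc hf).toLp _

theorem lp_ae {f : ℝ → ℝ} (hc : Continuous f) (hf : HasCompactSupport f) :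
    lp hc hf =ᵐ[volume] fun x => (f x : ℂ) := MemLp.coeFn_toLp _

noncomputable def N.kL (h : c.N ψ ψ' k) : L2 := lp h.kc h.kcs
noncomputable def N.ψL (h : c.N ψ ψ' k) : L2 := lp h.cont h.cs

theorem N.cs' (h : c.N ψ ψ' k) : HasCompactSupport ψ' :=
  HasCompactSupport.intro h.cs fun _ hx => (h.zero_off hx).2.1

theorem N.G_deriv (h : c.N ψ ψ' k) (x : ℝ) :
    HasDerivAt (fun x => c.φ x * (c.a x * ψ' x) - ψ x * (c.a x * c.φ' x)) (-(c.φ x * k x)) x := by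
  have := ((c.hφ.d1 x).mul (h.d2 x)).sub ((h.d1 x).mul (c.hφ.d2 x))
  refine this.congr_deriv ?_
  ring

theorem N.F_eq (h : c.N ψ ψ' k) (w : ℝ) :
    c.F h.kL w = ((c.φ w * (c.a w * ψ' w) - ψ w * (c.a w * c.φ' w) : ℝ) : ℂ) := by
  have e1 : c.F h.kL w = ((∫ x in Set.Ioi w, c.φ x * k x : ℝ) : ℂ) := by
    rw [F, ← integral_complex_ofReal]
    refine integral_congr_ae (ae_restrict_of_ae ?_)
    filter_upwards [lp_ae h.kc h.kcs] with x hx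
    rw [kL, hx]; push_cast; ring
  have hi : Integrable fun x => c.φ x * k x :=
    (c.φc.mul h.kc).integrable_of_hasCompactSupport h.kcs.mul_left
  have hcs : HasCompactSupport fun x => c.φ x * (c.a x * ψ' x) - ψ x * (c.a x * c.φ' x) := by
    refine HasCompactSupport.intro h.cs fun x hx => ?_
    obtain ⟨h1, h2, h3⟩ := h.zero_off hx
    simp [h1, h2]
  have e2 := integral_Ioi_of_hasDerivAt_of_tendsto (a := w)
    (h.G_deriv w).continuousAt.continuousWithinAt
    (fun x _ => h.G_deriv x) hi.neg.integrableOn (ev_zero_top hcs)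
  simp only [integral_neg] at e2
  rw [e1]
  congr 1
  linarith

theorem N.Rc_eq (h : c.N ψ ψ' k) (x : ℝ) : c.Rc h.kL x = (ψ x : ℂ) := by
  have hd : ∀ w, HasDerivAt (fun w => ψ w / c.φ w)
      ((1 / (c.a w * c.φ w ^ 2)) * (c.φ w * (c.a w * ψ' w) - ψ w * (c.a w * c.φ' w))) w := by
    intro w
    have := (h.d1 w).div (c.hφ.d1 w) (c.hφ.pos w).ne'
    refine this.congr_deriv ?_
    have h1 := (c.hφ.pos w).ne'
    have h2 := (c.apos w).ne'
    field_simp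
  have e1 : ∫ w in Set.Iic x, c.g h.kL w = ((∫ w in Set.Iic x, (1 / (c.a w * c.φ w ^ 2)) * (c.φ w * (c.a w * ψ' w) - ψ w * (c.a w * c.φ' w)) : ℝ) : ℂ) := by
    rw [← integral_complex_ofReal]
    congr 1; ext w
    rw [g, h.F_eq]; push_cast; ring
  have hcs : HasCompactSupport fun w => ψ w / c.φ w :=
    HasCompactSupport.intro h.cs fun x hx => by simp [(h.zero_off hx).1]
  have hi : IntegrableOn (fun w => (1 / (c.a w * c.φ w ^ 2)) * (c.φ w * (c.a w * ψ' w) - ψ w * (c.a w * c.φ' w))) (Set.Iic x) := by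
    have := (c.g_int h.kL x).re
    refine this.congr (Eventually.of_forall fun w => ?_)
    simp only [g, h.F_eq]
    rw [← Complex.ofReal_mul]
    exact Complex.ofReal_re _
  have e2 := integral_Iic_of_hasDerivAt_of_tendsto (a := x)
    (hd x).continuousAt.continuousWithinAt
    (fun x _ => hd x) hi (ev_zero_bot hcs)
  rw [Rc, e1, e2]
  have := (c.hφ.pos x).ne'
  rw [← Complex.ofReal_mul]
  congr 1
  field_simp
  ring

theorem N.R_eq (h : c.N ψ ψ' k) : c.R h.kL = h.ψL := by
  apply Lp.ext
  filter_upwards [c.R_ae h.kL, lp_ae h.cont h.cs] with x h1 h2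
  rw [h1, h.Rc_eq, N.ψL, h2]

end Ctx

/-! ### Part 14 -/
noncomputable def hfun0 (t ρ : ℝ) : ℝ := expNegInvGlue (ρ / t)
noncomputable def hfun1 (t ρ : ℝ) : ℝ := ρ⁻¹ * expNegInvGlue (ρ / t)

theorem hfun0_cont (t : ℝ) : Continuous (hfun0 t) :=
  (expNegInvGlue.contDiff (n := 0)).continuous.comp (continuous_id.div_const t)

theorem hfun1_cont {t : ℝ} (ht : 0 < t) : Continuous (hfun1 t) := by
  have h := (expNegInvGlue.continuous_polynomial_eval_inv_mul Polynomial.X).comp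
    (continuous_id.div_const t)
  have e : hfun1 t = fun ρ => t⁻¹ * ((fun x => Polynomial.eval x⁻¹ Polynomial.X * expNegInvGlue x) ∘ fun x => id x / t) ρ := by
    ext ρ
    simp only [hfun1, Polynomial.eval_X, Function.comp, id]
    rw [inv_div]
    by_cases h0 : ρ = 0
    · simp [h0]
    · field_simp
  rw [e]
  exact continuous_const.mul h

theorem hfun0_pos {t ρ : ℝ} (ht : 0 < t) (hρ : 0 < ρ) : hfun0 t ρ = Real.exp (-(ρ⁻¹ * t)) := by
  rw [hfun0, expNegInvGlue, if_neg (not_le.mpr (div_pos hρ ht)), inv_div]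
  congr 2; rw [div_eq_inv_mul]

theorem hfun0_zero (t : ℝ) : hfun0 t 0 = 0 := by simp [hfun0, expNegInvGlue]
theorem hfun1_zero (t : ℝ) : hfun1 t 0 = 0 := by simp [hfun1]

theorem exp_rem (x : ℝ) : |Real.exp x - 1 - x| ≤ x ^ 2 * Real.exp |x| := by
  have h1 := Real.add_one_le_exp x
  have h2 := Real.add_one_le_exp (-x)
  have h3 : Real.exp x * Real.exp (-x) = 1 := by rw [← Real.exp_add]; simp
  have h4 := Real.exp_pos x
  have h5 : Real.exp x - 1 ≤ x * Real.exp x := by nlinarith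
  rw [abs_of_nonneg (by linarith)]
  rcases le_total 0 x with h | h
  · rw [abs_of_nonneg h]; nlinarith
  · have h6 : 1 ≤ Real.exp |x| := Real.one_le_exp (abs_nonneg _)
    nlinarith [sq_nonneg x]

theorem hfun_taylor {t h ρ : ℝ} (ht : 0 < t) (hh : |h| ≤ t / 2) (hρ : 0 ≤ ρ) :
    ‖hfun0 (t + h) ρ - hfun0 t ρ + h * hfun1 t ρ‖ ≤ 16 / t ^ 2 * h ^ 2 := by
  rcases hρ.eq_or_lt with h0 | h0
  · rw [← h0, hfun0_zero, hfun0_zero, hfun1_zero]; simp; positivity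
  have hth : 0 < t + h := by have := (abs_le.mp hh).1; linarith
  have e1 : hfun1 t ρ = ρ⁻¹ * Real.exp (-(ρ⁻¹ * t)) := by
    rw [hfun1, ← hfun0, hfun0_pos ht h0]
  rw [hfun0_pos hth h0, hfun0_pos ht h0, e1]
  set s := ρ⁻¹ with hs
  have hs0 : 0 < s := inv_pos.mpr h0
  have e2 : Real.exp (-(s * (t + h))) - Real.exp (-(s * t)) + h * (s * Real.exp (-(s * t))) =
      Real.exp (-(s * t)) * (Real.exp (-(s * h)) - 1 - (-(s * h))) := by
    rw [show -(s * (t + h)) = -(s * t) + -(s * h) by ring, Real.exp_add]; ring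
  rw [e2, norm_mul, Real.norm_of_nonneg (Real.exp_nonneg _), Real.norm_eq_abs]
  have h1 := exp_rem (-(s * h))
  have h2 : Real.exp |-(s * h)| ≤ Real.exp (s * t / 2) := by
    apply Real.exp_le_exp.mpr
    rw [abs_neg, abs_mul, abs_of_pos hs0]; nlinarith
  have h3 : Real.exp (-(s * t)) * Real.exp (s * t / 2) * Real.exp (s * t / 2) = 1 := by
    rw [← Real.exp_add, ← Real.exp_add]; ring_nf; simp
  have h4 := Real.add_one_le_exp (s * t / 4)
  have h5 : Real.exp (s * t / 4) * Real.exp (s * t / 4) = Real.exp (s * t / 2) := by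
    rw [← Real.exp_add]; ring_nf
  have h6 : (s * t / 4) ^ 2 ≤ Real.exp (s * t / 2) := by
    rw [← h5, sq]
    have : 0 < s * t / 4 := by positivity
    apply mul_le_mul <;> linarith
  have h7 : s ^ 2 ≤ 16 / t ^ 2 * Real.exp (s * t / 2) := by
    have : s ^ 2 = 16 / t ^ 2 * (s * t / 4) ^ 2 := by field_simp; ring
    rw [this]; gcongr
  calc Real.exp (-(s * t)) * |Real.exp (-(s * h)) - 1 - -(s * h)|
      ≤ Real.exp (-(s * t)) * ((-(s * h)) ^ 2 * Real.exp (s * t / 2)) := by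
        gcongr; exact h1.trans (by gcongr)
    _ = (Real.exp (-(s * t)) * Real.exp (s * t / 2)) * (s ^ 2 * h ^ 2) := by ring
    _ ≤ (Real.exp (-(s * t)) * Real.exp (s * t / 2)) * ((16 / t ^ 2 * Real.exp (s * t / 2)) * h ^ 2) := by
        gcongr
    _ = 16 / t ^ 2 * h ^ 2 * (Real.exp (-(s * t)) * Real.exp (s * t / 2) * Real.exp (s * t / 2)) := by ring
    _ = _ := by rw [h3, mul_one]

section
variable {H : Type*} [NormedAddCommGroup H] [InnerProductSpace ℂ H] [CompleteSpace H]
variable {R : H →L[ℂ] H}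

theorem spec_nonneg (hR : R.IsPositive) : ∀ x ∈ spectrum ℝ R, 0 ≤ x := fun x hx =>
  spectrum_nonneg_of_nonneg ((ContinuousLinearMap.nonneg_iff_isPositive R).mpr hR) hx

theorem exists_semigroup (hR : R.IsPositive) : ∃ E D : ℝ → (H →L[ℂ] H),
    (∀ t, 0 < t → R * D t = E t) ∧ (∀ t, 0 < t → R * E t = E t * R) ∧
    (∀ t, 0 < t → HasDerivAt E (-(D t)) t) ∧ (∀ t, 0 < t → ‖E t‖ ≤ 1) ∧
    (∀ t, 0 < t → ‖E t * R - R‖ ≤ t) ∧ (∀ t, IsSelfAdjoint (E t)) := by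
  have hsa : IsSelfAdjoint R := hR.isSelfAdjoint
  refine ⟨fun t => cfc (hfun0 t) R, fun t => cfc (hfun1 t) R, ?_, ?_, ?_, ?_, ?_, ?_⟩
  · intro t ht
    nth_rw 1 [← cfc_id ℝ R hsa]
    have h1 := (hfun1_cont ht).continuousOn (s := spectrum ℝ R)
    rw [← cfc_mul (id) (hfun1 t) R continuousOn_id h1]
    refine cfc_congr fun ρ hρ => ?_
    rcases (spec_nonneg hR ρ hρ).eq_or_lt with h0 | h0
    · rw [← h0]; simp [hfun0_zero]
    · simp only [id, hfun1, hfun0]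
      rw [mul_inv_cancel_left₀ h0.ne']
  · intro t ht
    have := (cfc_commute_cfc id (hfun0 t) R).eq
    rwa [cfc_id ℝ R hsa] at this
  · intro t ht
    rw [hasDerivAt_iff_isLittleO_nhds_zero]
    have hO : (fun h : ℝ => cfc (hfun0 (t + h)) R - cfc (hfun0 t) R - h • -cfc (hfun1 t) R)
        =O[nhds 0] fun h : ℝ => h ^ 2 := by
      refine Asymptotics.IsBigO.of_bound (16 / t ^ 2) ?_
      have : ∀ᶠ h : ℝ in nhds 0, |h| ≤ t / 2 := by
        have : Set.Icc (-(t / 2)) (t / 2) ∈ nhds (0:ℝ) := Icc_mem_nhds (by linarith) (by linarith)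
        filter_upwards [this] with h hh
        exact abs_le.mpr hh
      filter_upwards [this] with h hh
      have c0 := fun s => (hfun0_cont s).continuousOn (s := spectrum ℝ R)
      have c1 := (hfun1_cont ht).continuousOn (s := spectrum ℝ R)
      have e : cfc (hfun0 (t + h)) R - cfc (hfun0 t) R - h • -cfc (hfun1 t) R =
          cfc (fun ρ => hfun0 (t + h) ρ - hfun0 t ρ + h * hfun1 t ρ) R := by
        rw [cfc_add (a := R) (fun ρ => hfun0 (t + h) ρ - hfun0 t ρ) (fun ρ => h * hfun1 t ρ) ((c0 _).sub (c0 _)) (continuousOn_const.mul c1),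
          cfc_sub (hfun0 (t + h)) (hfun0 t) R (c0 _) (c0 _), cfc_const_mul h (hfun1 t) R c1]
        simp
      rw [e]
      refine (norm_cfc_le (by positivity) fun ρ hρ => hfun_taylor ht hh (spec_nonneg hR ρ hρ)).trans ?_
      simp
    exact hO.trans_isLittleO (by
      simpa using (Asymptotics.isLittleO_pow_id (𝕜 := ℝ) (n := 2) (by norm_num)))
  · intro t ht
    refine norm_cfc_le (by norm_num) fun ρ hρ => ?_
    rw [hfun0, Real.norm_of_nonneg (expNegInvGlue.nonneg _)]
    unfold expNegInvGlue
    split_ifs with h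
    · norm_num
    · rw [Real.exp_le_one_iff]; push Not at h; exact neg_nonpos.mpr (inv_nonneg.mpr h.le)
  · intro t ht
    have e : cfc (hfun0 t) R * R - R = cfc (fun ρ => hfun0 t ρ * id ρ - id ρ) R := by
      have c0 := (hfun0_cont t).continuousOn (s := spectrum ℝ R)
      rw [cfc_sub (fun ρ => hfun0 t ρ * id ρ) id R (c0.mul continuousOn_id) continuousOn_id,
        cfc_mul (hfun0 t) id R c0 continuousOn_id, cfc_id ℝ R hsa]
    rw [e]
    refine norm_cfc_le ht.le fun ρ hρ => ?_
    rcases (spec_nonneg hR ρ hρ).eq_or_lt with h0 | h0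
    · rw [← h0]; simp; exact ht.le
    · rw [hfun0_pos ht h0]
      have h1 := Real.add_one_le_exp (-(ρ⁻¹ * t))
      have h2 : Real.exp (-(ρ⁻¹ * t)) ≤ 1 := by rw [Real.exp_le_one_iff]; simp; positivity
      have h3 : ρ * ρ⁻¹ = 1 := mul_inv_cancel₀ h0.ne'
      simp only [id]
      rw [Real.norm_eq_abs, abs_le]
      constructor <;> nlinarith
  · intro t
    exact cfc_predicate (hfun0 t) R
end

/-! ### Part 15 -/
namespace Ctx

section dens
variable (c : Ctx)

theorem lp_dense {f : ℝ → ℝ} (hf : Continuous f) (hcs : HasCompactSupport f) {δ : ℝ} (hδ : 0 < δ) :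
    ∃ g : L2, ‖lp hf hcs - c.R g‖ ≤ δ := by
  obtain ⟨L, hL0, hL⟩ : ∃ L : ℝ, 0 < L ∧ ∀ x, x ∉ Set.Icc (-L) L → f x = 0 := by
    obtain ⟨L, hL⟩ := hcs.isCompact.isBounded.subset_closedBall 0
    refine ⟨max L 1, by positivity, fun x hx => ?_⟩
    by_contra h0
    have := hL (subset_tsupport f h0)
    rw [Metric.mem_closedBall, Real.dist_0_eq_abs] at this
    exact hx (abs_le.mp (this.trans (le_max_left _ _)))
  obtain ⟨ε, hε, hεδ⟩ : ∃ ε : ℝ, 0 < ε ∧ (ε + ε) ^ 2 * (2 * L) ≤ δ ^ 2 := by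
    refine ⟨δ / (4 * (1 + L)), by positivity, ?_⟩
    rw [show δ / (4 * (1 + L)) + δ / (4 * (1 + L)) = δ * (1 / (2 * (1 + L))) by field_simp; ring, mul_pow, mul_assoc]
    refine mul_le_of_le_one_right (sq_nonneg _) ?_
    rw [div_pow, one_pow, one_div, inv_mul_le_iff₀ (by positivity)]
    nlinarith
  have hcp : HasCompactSupport fun x => max (f x) 0 := hcs.comp_left (g := fun z => max z 0) (by simp)
  have hcm : HasCompactSupport fun x => max (-f x) 0 := hcs.comp_left (g := fun z => max (-z) 0) (by simp)
  obtain ⟨ψ1, ψ1', k1, n1, b1⟩ := c.density (hf.max continuous_const) hcp (fun x => le_max_right _ _) hε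
  obtain ⟨ψ2, ψ2', k2, n2, b2⟩ := c.density (g := fun x => max (-f x) 0) (hf.neg.max continuous_const) hcm (fun x => le_max_right _ _) hε
  refine ⟨n1.kL - n2.kL, ?_⟩
  rw [map_sub, n1.R_eq, n2.R_eq]
  have hb : ∀ᵐ x, ‖(lp hf hcs - (n1.ψL - n2.ψL) : L2) x‖ ^ 2 ≤
      (Set.Icc (-L) L).indicator (fun _ => (ε + ε) ^ 2) x := by
    filter_upwards [Lp.coeFn_sub (lp hf hcs) (n1.ψL - n2.ψL), Lp.coeFn_sub n1.ψL n2.ψL, lp_ae hf hcs,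
      lp_ae n1.cont n1.cs, lp_ae n2.cont n2.cs] with x h1 h2 h3 h4 h5
    simp only [N.ψL] at h1 h2 ⊢
    rw [h1, Pi.sub_apply, h2, Pi.sub_apply, h3, h4, h5, ← Complex.ofReal_sub, ← Complex.ofReal_sub,
      Complex.norm_real, Real.norm_eq_abs, sq_abs]
    obtain ⟨p1, p2, p3⟩ := b1 x
    obtain ⟨q1, q2, q3⟩ := b2 x
    have e : f x = max (f x) 0 - max (-f x) 0 := by
      rcases le_total 0 (f x) with h | h
      · rw [max_eq_left h, max_eq_right (by linarith)]; ring
      · rw [max_eq_right h, max_eq_left (by linarith)]; ring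
    by_cases hx : x ∈ Set.Icc (-L) L
    · rw [Set.indicator_of_mem hx]
      apply sq_le_sq'
      · rw [e]; linarith
      · rw [e]; linarith
    · rw [Set.indicator_of_notMem hx]
      have h0 := hL x hx
      simp only [h0, neg_zero, max_self] at p2 q2
      rw [h0, le_antisymm p2 p1, le_antisymm q2 q1]; simp
  have h2 : ‖lp hf hcs - (n1.ψL - n2.ψL)‖ ^ 2 ≤ δ ^ 2 := by
    rw [L2.norm_sq]
    refine (integral_mono_ae (L2.sq_int _) ?_ hb).trans ?_
    · rw [integrable_indicator_iff measurableSet_Icc]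
      exact integrableOn_const (by simp)
    · rw [integral_indicator measurableSet_Icc, setIntegral_const]
      simp only [Real.volume_real_Icc, smul_eq_mul]
      rw [max_eq_left (by linarith)]
      linarith
  exact abs_le_of_sq_le_sq' h2 hδ.le |>.2

noncomputable def E : ℝ → (L2 →L[ℂ] L2) := (exists_semigroup c.R_pos).choose
noncomputable def D : ℝ → (L2 →L[ℂ] L2) := (exists_semigroup c.R_pos).choose_spec.choose
theorem E_spec : (∀ t, 0 < t → c.R * c.D t = c.E t) ∧ (∀ t, 0 < t → c.R * c.E t = c.E t * c.R) ∧
    (∀ t, 0 < t → HasDerivAt c.E (-(c.D t)) t) ∧ (∀ t, 0 < t → ‖c.E t‖ ≤ 1) ∧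
    (∀ t, 0 < t → ‖c.E t * c.R - c.R‖ ≤ t) ∧ (∀ t, IsSelfAdjoint (c.E t)) :=
  (exists_semigroup c.R_pos).choose_spec.choose_spec

theorem E_strong {f : ℝ → ℝ} (hf : Continuous f) (hcs : HasCompactSupport f) :
    Tendsto (fun t => c.E t (lp hf hcs)) (nhdsWithin 0 (Set.Ioi 0)) (nhds (lp hf hcs)) := by
  obtain ⟨-, -, -, h1, h2, -⟩ := c.E_spec
  rw [Metric.tendsto_nhds]
  intro δ hδ
  obtain ⟨g, hg⟩ := c.lp_dense hf hcs (δ := δ / 4) (by linarith)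
  have hs : ∀ᶠ t in nhdsWithin (0:ℝ) (Set.Ioi 0), t * (‖g‖ + 1) < δ / 4 := by
    have : Tendsto (fun t : ℝ => t * (‖g‖ + 1)) (nhdsWithin 0 (Set.Ioi 0)) (nhds (0 * (‖g‖ + 1))) :=
      (continuous_id.mul continuous_const).continuousAt.mono_left nhdsWithin_le_nhds
    rw [zero_mul] at this
    exact this.eventually_lt_const (by linarith)
  filter_upwards [hs, self_mem_nhdsWithin] with t ht ht0
  rw [dist_eq_norm]
  set F := lp hf hcs
  have e : c.E t F - F = c.E t (F - c.R g) + (c.E t * c.R - c.R) g - (F - c.R g) := by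
    simp
  rw [e]
  have a1 : ‖c.E t (F - c.R g)‖ ≤ ‖F - c.R g‖ := by
    refine ((c.E t).le_opNorm _).trans ?_
    exact mul_le_of_le_one_left (norm_nonneg _) (h1 t ht0)
  have a2 : ‖(c.E t * c.R - c.R) g‖ ≤ t * ‖g‖ := by
    refine (ContinuousLinearMap.le_opNorm _ _).trans ?_
    gcongr; exact h2 t ht0
  have a3 := norm_add_le (c.E t (F - c.R g)) ((c.E t * c.R - c.R) g)
  have a4 := norm_sub_le (c.E t (F - c.R g) + (c.E t * c.R - c.R) g) (F - c.R g)
  have ht0 : 0 < t := ht0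
  nlinarith

/-- extended semigroup -/
noncomputable def E' (t : ℝ) : L2 →L[ℂ] L2 := if t ≤ 0 then 1 else c.E t

theorem E'_cont {f : ℝ → ℝ} (hf : Continuous f) (hcs : HasCompactSupport f) :
    Continuous fun t => c.E' t (lp hf hcs) := by
  obtain ⟨-, -, h3, -, -, -⟩ := c.E_spec
  rw [continuous_iff_continuousAt]
  intro t
  rcases lt_trichotomy t 0 with h | h | h
  · refine (continuousAt_const (y := lp hf hcs)).congr ?_
    filter_upwards [gt_mem_nhds h] with s hs
    rw [E', if_pos hs.le]; rfl
  · subst h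
    rw [continuousAt_iff_continuous_left'_right']
    have e0 : c.E' 0 (lp hf hcs) = lp hf hcs := by rw [E', if_pos le_rfl]; rfl
    constructor
    · refine (continuousWithinAt_const (b := lp hf hcs)).congr ?_ e0
      intro s hs
      rw [E', if_pos (le_of_lt hs)]; rfl
    · rw [ContinuousWithinAt, e0]
      refine (c.E_strong hf hcs).congr' ?_
      filter_upwards [self_mem_nhdsWithin] with s hs
      rw [E', if_neg (not_le.mpr hs)]
  · have := ((ContinuousLinearMap.apply ℂ L2 (lp hf hcs)).continuous.continuousAt).comp (h3 t h).continuousAt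
    refine this.congr ?_
    filter_upwards [lt_mem_nhds h] with s hs
    rw [E', if_neg (not_le.mpr hs)]; rfl

theorem Rc_joint : Continuous fun p : L2 × ℝ => c.Rc p.1 p.2 := by
  obtain ⟨C, hC, Rx, h1, h2⟩ := c.exists_Rx
  have h3 : Continuous fun p : ℝ × L2 => c.Rc p.2 p.1 := by
    refine continuous_prod_of_continuous_lipschitzWith' (fun p : ℝ × L2 => c.Rc p.2 p.1) ⟨C, hC.le⟩ ?_ ?_
    · intro x
      refine LipschitzWith.of_dist_le_mul fun f g => ?_
      simp only [dist_eq_norm, ← h1]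
      rw [← map_sub]
      exact h2 x _
    · intro h; exact c.Rc_cont h
  exact h3.comp continuous_swap

end dens

variable {c : Ctx} {ψ ψ' k ψ2 ψ2' k2 : ℝ → ℝ}

noncomputable def N.S (h : c.N ψ ψ' k) (t x : ℝ) : ℝ :=
  Real.exp (c.γ * t) * (c.Rc (c.E' t h.kL) x).re

theorem N.S_cont (h : c.N ψ ψ' k) : Continuous fun p : ℝ × ℝ => h.S p.1 p.2 := by
  have h1 : Continuous fun p : ℝ × ℝ => c.Rc (c.E' p.1 h.kL) p.2 :=
    c.Rc_joint.comp (((c.E'_cont h.kc h.kcs).comp continuous_fst).prodMk continuous_snd)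
  exact (Real.continuous_exp.comp (continuous_const.mul continuous_fst)).mul
    (Complex.continuous_re.comp h1)

theorem N.S_zero (h : c.N ψ ψ' k) (x : ℝ) : h.S 0 x = ψ x := by
  simp [N.S, E', h.Rc_eq]

theorem N.S_bdd (h : c.N ψ ψ' k) (t : ℝ) : ∃ M : ℝ, 0 ≤ M ∧ ∀ s ∈ Set.Icc 0 t, ∀ x, |h.S s x| ≤ M := by
  obtain ⟨C, hC, Rx, h1, h2⟩ := c.exists_Rx
  refine ⟨Real.exp (|c.γ| * t) * (C * ‖h.kL‖), by positivity, fun s hs x => ?_⟩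
  rw [N.S, abs_mul, abs_of_pos (Real.exp_pos _)]
  have a1 : ‖c.E' s h.kL‖ ≤ ‖h.kL‖ := by
    unfold E'
    split_ifs with h0
    · rfl
    · refine ((c.E s).le_opNorm _).trans (mul_le_of_le_one_left (norm_nonneg _) ?_)
      exact c.E_spec.2.2.2.1 s (not_le.mp h0)
  refine mul_le_mul (Real.exp_le_exp.mpr ?_) ?_ (abs_nonneg _) (Real.exp_nonneg _)
  · have := le_abs_self c.γ
    nlinarith [hs.1, hs.2, abs_nonneg c.γ]
  · refine (Complex.abs_re_le_norm _).trans ?_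
    rw [← h1]
    exact (h2 _ _).trans (by gcongr)

noncomputable def N.Sx (h : c.N ψ ψ' k) (t x : ℝ) : ℝ :=
  Real.exp (c.γ * t) * (c.Rd (c.E' t h.kL) x).re

theorem N.S_d1 (h : c.N ψ ψ' k) (t x : ℝ) : HasDerivAt (h.S t) (h.Sx t x) x := by
  have h1 := (c.Rc_d1 (c.E' t h.kL) x)
  have h2 : HasDerivAt (fun x => (c.Rc (c.E' t h.kL) x).re) (c.Rd (c.E' t h.kL) x).re x :=
    (Complex.reCLM.hasFDerivAt.comp_hasDerivAt x h1)
  exact h2.const_mul _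

theorem N.S_pde (h : c.N ψ ψ' k) {t : ℝ} (ht : 0 < t) (x : ℝ) :
    ∃ Q, HasDerivAt (fun x => c.a x * h.Sx t x) Q x ∧
      HasDerivAt (fun s => h.S s x) (Q + c.r x * h.S t x) t := by
  obtain ⟨p1, -, p3, -, -, -⟩ := c.E_spec
  have e' : ∀ s, 0 < s → c.E' s = c.E s := fun s hs => by rw [E', if_neg (not_le.mpr hs)]
  have hae : c.E' t h.kL =ᵐ[volume] c.Rc (c.D t h.kL) := by
    rw [e' t ht, ← p1 t ht]
    exact c.R_ae _
  have h2 := c.Rc_d2 (c.E' t h.kL) (c.Rc_cont _) hae x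
  have h2' := ((Complex.reCLM.hasFDerivAt.comp_hasDerivAt x h2).const_mul (Real.exp (c.γ * t)))
  simp only [Complex.reCLM_apply] at h2'
  refine ⟨_, h2'.congr_of_eventuallyEq (Eventually.of_forall fun y => ?_), ?_⟩
  · simp [N.Sx, Complex.re_ofReal_mul]; ring
  · obtain ⟨C, hC, Rx, q1, q2⟩ := c.exists_Rx
    have h3 : HasDerivAt (fun s => (Rx x (c.E s h.kL)).re) (Rx x (-(c.D t) h.kL)).re t := by
      have := ((ContinuousLinearMap.apply ℂ L2 h.kL).restrictScalars ℝ).hasFDerivAt.comp_hasDerivAt t (p3 t ht)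
      have := ((Rx x).restrictScalars ℝ).hasFDerivAt.comp_hasDerivAt t this
      have := Complex.reCLM.hasFDerivAt.comp_hasDerivAt t this
      exact this
    have h4 : HasDerivAt (fun s => Real.exp (c.γ * s)) (Real.exp (c.γ * t) * c.γ) t := by
      have := ((hasDerivAt_id t).const_mul c.γ).exp
      simpa using this
    have h5 := h4.mul h3
    refine (h5.congr_of_eventuallyEq ?_).congr_deriv ?_
    · filter_upwards [lt_mem_nhds ht] with s hs
      simp only [N.S, Pi.mul_apply]
      rw [e' s hs, q1]
    · simp only [N.S, Complex.sub_re, Complex.re_ofReal_mul]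
      rw [e' t ht]
      rw [map_neg, Complex.neg_re, q1, q1]
      ring

theorem N.S_ae (h : c.N ψ ψ' k) (t : ℝ) :
    h.S t =ᵐ[volume] fun x => Real.exp (c.γ * t) * (c.E' t h.ψL x).re := by
  have e : c.R (c.E' t h.kL) = c.E' t h.ψL := by
    rw [← h.R_eq]
    unfold E'
    split_ifs with h0
    · rfl
    · exact congrArg (fun A : L2 →L[ℂ] L2 => A h.kL) (c.E_spec.2.1 t (not_le.mp h0))
  filter_upwards [c.R_ae (c.E' t h.kL)] with x hx
  rw [N.S, ← hx, e]

theorem N.S_inner (h : c.N ψ ψ' k) (h2 : c.N ψ2 ψ2' k2) (t : ℝ) :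
    ∫ x, ψ2 x * h.S t x = Real.exp (c.γ * t) * (inner ℂ h2.ψL (c.E' t h.ψL)).re := by
  rw [L2.inner_def]
  have hi : Integrable fun x => inner ℂ (h2.ψL x) (c.E' t h.ψL x) := L2.integrable_inner _ _
  have := integral_re hi
  simp only [RCLike.re_to_complex] at this
  rw [← this, ← integral_const_mul]
  refine integral_congr_ae ?_
  filter_upwards [h.S_ae t, lp_ae h2.cont h2.cs] with x e1 e2
  rw [e1, show h2.ψL x = (ψ2 x : ℂ) from e2]
  simp
  ring

theorem N.S_dual (h : c.N ψ ψ' k) (h2 : c.N ψ2 ψ2' k2) (t : ℝ) :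
    ∫ x, ψ2 x * h.S t x = ∫ x, ψ x * h2.S t x := by
  rw [h.S_inner h2, h2.S_inner h]
  congr 1
  have hs : IsSelfAdjoint (c.E' t) := by
    unfold E'
    split_ifs
    · exact IsSelfAdjoint.one _
    · exact c.E_spec.2.2.2.2.2 t
  have := (ContinuousLinearMap.isSelfAdjoint_iff_isSymmetric.mp hs) h2.ψL h.ψL
  simp only [ContinuousLinearMap.coe_coe] at this
  rw [← this, ← inner_conj_symm, Complex.conj_re]

end Ctx

/-! ### Part 16 -/
namespace Ctx
variable (c : Ctx)

noncomputable def kE : ℝ := c.μ * (c.P * c.μ + 1)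
noncomputable def ΛE : ℝ := c.kE ^ 2 * c.μ + 2 * c.μ + |c.γ|
noncomputable def Ef (x : ℝ) : ℝ := Real.cosh (c.kE * c.ξ x)
noncomputable def Ef' (x : ℝ) : ℝ := Real.sinh (c.kE * c.ξ x) * (c.kE * (1 / c.a x))

theorem Ef_d1 (x : ℝ) : HasDerivAt c.Ef (c.Ef' x) x :=
  ((c.ξ_deriv x).const_mul c.kE).cosh

theorem Ef_d2 (x : ℝ) : HasDerivAt (fun x => c.a x * c.Ef' x) (c.kE ^ 2 / c.a x * c.Ef x) x := by
  have h := (((c.ξ_deriv x).const_mul c.kE).sinh).const_mul c.kE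
  refine (h.congr_of_eventuallyEq (Eventually.of_forall fun y => ?_)).congr_deriv ?_
  · have := (c.apos y).ne'
    simp only [Ef']; field_simp
  · simp only [Ef]; ring

theorem Ef_cont : Continuous c.Ef := continuous_iff_continuousAt.mpr fun x => (c.Ef_d1 x).continuousAt
theorem Ef_one (x : ℝ) : 1 ≤ c.Ef x := Real.one_le_cosh _

theorem kE_pos : 0 < c.kE := by
  have := c.μpos; have := c.P0; unfold kE; positivity

theorem Ef_large (x : ℝ) : Real.exp ((c.P * c.μ + 1) * |x|) / 2 ≤ c.Ef x := by
  have h := c.ξ_low x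
  have hμ := c.μpos
  have hk := c.kE_pos
  have h1 : (c.P * c.μ + 1) * |x| ≤ |c.kE * c.ξ x| := by
    rw [abs_mul, abs_of_pos hk]
    have : c.kE * (|x| / c.μ) ≤ c.kE * |c.ξ x| := by gcongr
    rw [kE] at this ⊢
    have e : c.μ * (c.P * c.μ + 1) * (|x| / c.μ) = (c.P * c.μ + 1) * |x| := by field_simp
    linarith
  rw [Ef, ← Real.cosh_abs, Real.cosh_eq]
  have := Real.exp_le_exp.mpr h1
  have := Real.exp_pos (-|c.kE * c.ξ x|)
  linarith

theorem Ef_coer (M : ℝ) : ∃ L : ℝ, 0 < L ∧ ∀ x, L < |x| → M ≤ c.Ef x := by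
  refine ⟨max 1 (2 * M), by positivity, fun x hx => ?_⟩
  have h1 := c.Ef_large x
  have h2 := Real.add_one_le_exp ((c.P * c.μ + 1) * |x|)
  have h3 : 0 < c.P * c.μ := mul_pos c.P0 c.μpos
  have := le_max_right 1 (2 * M)
  have := abs_nonneg x
  nlinarith

theorem Ef_a (x : ℝ) : c.kE ^ 2 / c.a x ≤ c.kE ^ 2 * c.μ := by
  have := (c.inv_a_bound x).2
  rw [div_eq_mul_one_div]
  gcongr

/-- a solution dominated by Ef -/
theorem dom_Ef {u u' : ℝ → ℝ} (hu : PosSol c.a (fun x => c.γ - c.r x) u u') (hb : ∀ x, |c.a x * u' x| ≤ c.P * u x)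
    {ε : ℝ} (hε : 0 < ε) : ∃ L : ℝ, 0 < L ∧ ∀ x, L < |x| → u x ≤ ε * c.Ef x := by
  have hu0 := hu.pos 0
  refine ⟨2 * u 0 / ε, by positivity, fun x hx => ?_⟩
  have h1 := hu.harnack c.hμ c.ha hb x 0
  rw [sub_zero] at h1
  have h2 := c.Ef_large x
  rw [add_mul, one_mul, Real.exp_add] at h2
  have h3 := Real.add_one_le_exp |x|
  rw [div_lt_iff₀ hε] at hx
  have h4 := Real.exp_pos (c.P * c.μ * |x|)
  calc u x ≤ u 0 * Real.exp (c.P * c.μ * |x|) := h1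
    _ ≤ (ε * Real.exp |x| / 2) * Real.exp (c.P * c.μ * |x|) := by
        gcongr; nlinarith
    _ = ε * (Real.exp (c.P * c.μ * |x|) * Real.exp |x| / 2) := by ring
    _ ≤ _ := by gcongr

def Super (f fx : ℝ → ℝ → ℝ) : Prop := ∀ s, 0 < s → ∀ x, HasDerivAt (f s) (fx s x) x ∧
  ∃ Q d, HasDerivAt (fun x => c.a x * fx s x) Q x ∧ HasDerivAt (fun τ => f τ x) d s ∧
    Q + c.r x * f s x ≤ d

variable {c}

theorem Super.add {f fx g gx : ℝ → ℝ → ℝ} (hf : c.Super f fx) (hg : c.Super g gx) :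
    c.Super (fun s x => f s x + g s x) (fun s x => fx s x + gx s x) := by
  intro s hs x
  obtain ⟨h1, Q, d, h2, h3, h4⟩ := hf s hs x
  obtain ⟨k1, Q', d', k2, k3, k4⟩ := hg s hs x
  refine ⟨h1.add k1, Q + Q', d + d', ?_, h3.add k3, by linarith⟩
  refine (h2.add k2).congr_of_eventuallyEq (Eventually.of_forall fun y => ?_)
  simp only [Pi.add_apply]; ring

theorem super_Ef {ε : ℝ} (hε : 0 ≤ ε) : c.Super (fun s x => ε * Real.exp (c.ΛE * s) * c.Ef x)
    (fun s x => ε * Real.exp (c.ΛE * s) * c.Ef' x) := by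
  intro s hs x
  refine ⟨(c.Ef_d1 x).const_mul _, ε * Real.exp (c.ΛE * s) * (c.kE ^ 2 / c.a x * c.Ef x),
    ε * (Real.exp (c.ΛE * s) * c.ΛE) * c.Ef x, ?_, ?_, ?_⟩
  · refine ((c.Ef_d2 x).const_mul (ε * Real.exp (c.ΛE * s))).congr_of_eventuallyEq (Eventually.of_forall fun y => ?_)
    simp only; ring
  · have := (((hasDerivAt_id s).const_mul c.ΛE).exp.const_mul ε).mul_const (c.Ef x)
    simpa using this
  · have h1 := c.Ef_a x
    have h2 := (abs_le.mp (c.hr x)).2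
    have h3 : c.kE ^ 2 / c.a x + c.r x ≤ c.ΛE := by
      have := abs_nonneg c.γ; have := c.μpos
      unfold ΛE; linarith
    have h4 : 0 ≤ ε * Real.exp (c.ΛE * s) * c.Ef x :=
      mul_nonneg (by positivity) (by linarith [c.Ef_one x])
    nlinarith

theorem super_mp {f fx : ℝ → ℝ → ℝ} (hf : c.Super f fx) {t : ℝ} (ht : 0 ≤ t)
    (hl : LowerSemicontinuousOn (fun p : ℝ × ℝ => f p.1 p.2) (Set.Icc 0 t ×ˢ Set.univ))
    (h0 : ∀ x, 0 ≤ f 0 x) (hb : ∃ M, ∀ s ∈ Set.Icc 0 t, ∀ x, -M ≤ f s x) :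
    ∀ s ∈ Set.Icc 0 t, ∀ x, 0 ≤ f s x := by
  obtain ⟨M, hM⟩ := hb
  have key : ∀ ε : ℝ, 0 < ε → ∀ s ∈ Set.Icc 0 t, ∀ x, 0 ≤ f s x + ε * Real.exp (c.ΛE * s) * c.Ef x := by
    intro ε hε
    have hw := hf.add (super_Ef hε.le)
    have hΛ : 0 ≤ c.ΛE := by
      have := c.μpos; have := abs_nonneg c.γ; unfold ΛE; positivity
    have := abs_max_principle (X := ℝ) Set.univ (fun s x => f s x + ε * Real.exp (c.ΛE * s) * c.Ef x) t c.μ ht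
      ?_ ?_ ?_ ?_
    · intro s hs x; exact this s hs x trivial
    · refine hl.add ?_
      exact (((continuous_const.mul (Real.continuous_exp.comp (continuous_const.mul continuous_fst))).mul
        (c.Ef_cont.comp continuous_snd)).lowerSemicontinuous).lowerSemicontinuousOn _
    · intro x _
      have := c.Ef_one x
      have := h0 x
      simp only [mul_zero, Real.exp_zero]
      nlinarith
    · obtain ⟨L, hL0, hL⟩ := c.Ef_coer (M / ε)
      refine ⟨Set.Icc (-L) L, isCompact_Icc, Set.subset_univ _, fun s hs x _ hx => ?_⟩
      have h1 : L < |x| := by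
        by_contra h; exact hx (abs_le.mp (not_lt.mp h))
      have h2 := hL x h1
      rw [div_le_iff₀ hε] at h2
      have h3 : 1 ≤ Real.exp (c.ΛE * s) := Real.one_le_exp (mul_nonneg hΛ hs.1)
      have h4 := hM s hs x
      have h5 := c.Ef_one x
      have : ε * 1 * c.Ef x ≤ ε * Real.exp (c.ΛE * s) * c.Ef x := by gcongr
      linarith
    · intro s hs hst x _ hneg hmin
      obtain ⟨-, Q, d, h2, h3, h4⟩ := hw s hs x
      refine ⟨d, h3, ?_⟩
      have hQ : 0 ≤ Q := second_deriv_nonneg c.apos (Eventually.of_forall fun z => (hw s hs z).1) h2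
        (Eventually.of_forall fun z => hmin z trivial)
      have := (abs_le.mp (c.hr x)).2
      nlinarith
  intro s hs x
  refine le_of_forall_pos_le_add fun δ hδ => ?_
  have hp : 0 < Real.exp (c.ΛE * s) * c.Ef x := mul_pos (Real.exp_pos _) (by linarith [c.Ef_one x])
  have := key (δ / (Real.exp (c.ΛE * s) * c.Ef x)) (by positivity) s hs x
  rw [mul_assoc, div_mul_cancel₀ _ hp.ne'] at this
  linarith

variable {ψ ψ' k ψ2 ψ2' k2 : ℝ → ℝ}

theorem N.S_super (h : c.N ψ ψ' k) : c.Super h.S h.Sx := by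
  intro s hs x
  obtain ⟨Q, h1, h2⟩ := h.S_pde hs x
  exact ⟨h.S_d1 s x, Q, _, h1, h2, le_rfl⟩

theorem N.S_sub (h : c.N ψ ψ' k) : c.Super (fun s x => -h.S s x) (fun s x => -h.Sx s x) := by
  intro s hs x
  obtain ⟨Q, h1, h2⟩ := h.S_pde hs x
  refine ⟨(h.S_d1 s x).neg, -Q, _, ?_, h2.neg, by linarith⟩
  refine h1.neg.congr_of_eventuallyEq (Eventually.of_forall fun y => ?_)
  simp

theorem lsc_of {f : ℝ → ℝ → ℝ} (hf : Continuous fun p : ℝ × ℝ => f p.1 p.2) (s : Set (ℝ × ℝ)) :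
    LowerSemicontinuousOn (fun p : ℝ × ℝ => f p.1 p.2) s := hf.lowerSemicontinuous.lowerSemicontinuousOn _

theorem N.S_nonneg (h : c.N ψ ψ' k) (h0 : ∀ x, 0 ≤ ψ x) {t : ℝ} (ht : 0 ≤ t) (x : ℝ) : 0 ≤ h.S t x := by
  obtain ⟨M, hM0, hM⟩ := h.S_bdd t
  refine super_mp h.S_super ht (lsc_of h.S_cont _) (fun x => by rw [h.S_zero]; exact h0 x)
    ⟨M, fun s hs x => (abs_le.mp (hM s hs x)).1⟩ t ⟨ht, le_rfl⟩ x

theorem N.S_le (h : c.N ψ ψ' k) {F Fx : ℝ → ℝ → ℝ} (hF : c.Super F Fx) {t : ℝ} (ht : 0 ≤ t)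
    (hl : LowerSemicontinuousOn (fun p : ℝ × ℝ => F p.1 p.2) (Set.Icc 0 t ×ˢ Set.univ))
    (hF0 : ∃ M, ∀ s ∈ Set.Icc 0 t, ∀ x, -M ≤ F s x) (h0 : ∀ x, ψ x ≤ F 0 x) (x : ℝ) : h.S t x ≤ F t x := by
  obtain ⟨M, hM0, hM⟩ := h.S_bdd t
  obtain ⟨M', hM'⟩ := hF0
  have := super_mp (hF.add h.S_sub) ht (hl.add (lsc_of (f := fun s x => -h.S s x) h.S_cont.neg _))
    (fun x => by have := h0 x; rw [h.S_zero]; linarith)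
    ⟨M + M', fun s hs x => by have := (abs_le.mp (hM s hs x)).2; have := hM' s hs x; linarith⟩ t ⟨ht, le_rfl⟩ x
  linarith

theorem N.S_ge (h : c.N ψ ψ' k) {F Fx : ℝ → ℝ → ℝ} (hF : c.Super F Fx) {t : ℝ} (ht : 0 ≤ t)
    (hl : LowerSemicontinuousOn (fun p : ℝ × ℝ => F p.1 p.2) (Set.Icc 0 t ×ˢ Set.univ))
    (hF0 : ∃ M, ∀ s ∈ Set.Icc 0 t, ∀ x, -M ≤ F s x) (h0 : ∀ x, 0 ≤ ψ x + F 0 x) (x : ℝ) : 0 ≤ h.S t x + F t x := by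
  obtain ⟨M, hM0, hM⟩ := h.S_bdd t
  obtain ⟨M', hM'⟩ := hF0
  have := super_mp (h.S_super.add hF) ht ((lsc_of (f := fun s x => h.S s x) h.S_cont _).add hl)
    (fun x => by have := h0 x; rw [h.S_zero]; linarith)
    ⟨M + M', fun s hs x => by have := (abs_le.mp (hM s hs x)).1; have := hM' s hs x; linarith⟩ t ⟨ht, le_rfl⟩ x
  linarith

theorem approx (c : Ctx) {G : ℝ → ℝ} (hG : Continuous G) (h0 : ∀ x, 0 ≤ G x) :
    ∃ ψ ψ' k : ℕ → ℝ → ℝ, (∀ n, c.N (ψ n) (ψ' n) (k n)) ∧ (∀ n x, 0 ≤ ψ n x ∧ ψ n x ≤ G x) ∧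
      ∀ x, Tendsto (fun n => ψ n x) atTop (nhds (G x)) := by
  have key : ∀ n : ℕ, ∃ ψ ψ' k : ℝ → ℝ, c.N ψ ψ' k ∧ (∀ x, 0 ≤ ψ x ∧ ψ x ≤ G x) ∧
      ∀ x : ℝ, |x| ≤ (n:ℝ) → G x - 1 / ((n:ℝ) + 1) ≤ ψ x := by
    intro n
    set g : ℝ → ℝ := fun x => G x * max 0 (min 1 (n + 1 - |x|)) with hg
    have hgc : Continuous g := by fun_prop
    have hgs : HasCompactSupport g := by
      refine HasCompactSupport.intro (isCompact_Icc (a := -((n:ℝ) + 1)) (b := (n:ℝ) + 1)) fun x hx => ?_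
      have h1 : (n:ℝ) + 1 < |x| := by by_contra h; exact hx (abs_le.mp (not_lt.mp h))
      simp only [hg]
      rw [max_eq_left]
      · ring
      · exact (min_le_right _ _).trans (by linarith)
    have hg0 : ∀ x, 0 ≤ g x := fun x => mul_nonneg (h0 x) (le_max_left _ _)
    obtain ⟨ψ, ψ', k, hN, hb⟩ := c.density hgc hgs hg0 (ε := 1 / ((n:ℝ) + 1)) (by positivity)
    refine ⟨ψ, ψ', k, hN, fun x => ⟨(hb x).1, (hb x).2.1.trans ?_⟩, fun x hx => ?_⟩
    · exact mul_le_of_le_one_right (h0 x) (max_le (by norm_num) (min_le_left _ _))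
    · have h1 : g x = G x := by
        simp only [hg]
        rw [min_eq_left (by linarith), max_eq_right (by norm_num), mul_one]
      rw [← h1]; exact (hb x).2.2
  choose ψ ψ' k hN hb hc using key
  refine ⟨ψ, ψ', k, hN, hb, fun x => ?_⟩
  refine tendsto_of_tendsto_of_tendsto_of_le_of_le' (g := fun n : ℕ => G x - 1 / ((n:ℝ) + 1)) (h := fun _ => G x) ?_ tendsto_const_nhds ?_ ?_
  · have := (tendsto_one_div_add_atTop_nhds_zero_nat (𝕜 := ℝ)).const_sub (G x)
    simpa using this
  · filter_upwards [eventually_ge_atTop ⌈|x|⌉₊] with n hn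
    exact hc n x ((Nat.le_ceil _).trans (by exact_mod_cast hn))
  · exact Eventually.of_forall fun n => (hb n x).2

theorem N.S_xcont (h : c.N ψ ψ' k) (t : ℝ) : Continuous (h.S t) :=
  h.S_cont.comp (continuous_const.prodMk continuous_id)

theorem N.int_mul (h : c.N ψ ψ' k) {f : ℝ → ℝ} (hf : Continuous f) : Integrable fun x => ψ x * f x :=
  (h.cont.mul hf).integrable_of_hasCompactSupport h.cs.mul_right

theorem N.S_super_dual (h : c.N ψ ψ' k) (hψ : ∀ x, 0 ≤ ψ x) {F Fx : ℝ → ℝ → ℝ} (hF : c.Super F Fx)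
    (hFc : Continuous fun p : ℝ × ℝ => F p.1 p.2) (hF0 : ∀ s x, 0 ≤ F s x) {t : ℝ} (ht : 0 ≤ t) :
    Integrable (fun x => F 0 x * h.S t x) ∧ ∫ x, F 0 x * h.S t x ≤ ∫ x, ψ x * F t x := by
  have hFx : ∀ s, Continuous (F s) := fun s => hFc.comp (continuous_const.prodMk continuous_id)
  obtain ⟨ρ, ρ', κ, hN, hb, hl⟩ := c.approx (hFx 0) (hF0 0)
  have hS := fun x => h.S_nonneg hψ ht x
  have e1 : ∀ n, ∫ x, ρ n x * h.S t x ≤ ∫ x, ψ x * F t x := by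
    intro n
    rw [h.S_dual (hN n)]
    refine integral_mono (h.int_mul ((hN n).S_xcont t)) (h.int_mul (hFx t)) fun x => ?_
    refine mul_le_mul_of_nonneg_left ?_ (hψ x)
    exact (hN n).S_le hF ht (lsc_of hFc _) ⟨0, fun s _ x => by simpa using hF0 s x⟩ (fun x => (hb n x).2) x
  have hnn : 0 ≤ ∫ x, ψ x * F t x := integral_nonneg fun x => mul_nonneg (hψ x) (hF0 t x)
  have e2 : ∫⁻ x, ENNReal.ofReal (F 0 x * h.S t x) ≤ ENNReal.ofReal (∫ x, ψ x * F t x) := by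
    have e3 : ∀ x, ENNReal.ofReal (F 0 x * h.S t x) =
        liminf (fun n => ENNReal.ofReal (ρ n x * h.S t x)) atTop := by
      intro x
      refine (Tendsto.liminf_eq ?_).symm
      exact ENNReal.tendsto_ofReal ((hl x).mul_const _)
    simp only [e3]
    refine (lintegral_liminf_le fun n => ?_).trans ?_
    · exact (((hN n).cont.mul (h.S_xcont t)).measurable).ennreal_ofReal
    · refine liminf_le_of_le (by isBoundedDefault) fun b hb' => ?_
      obtain ⟨n, hn⟩ := hb'.exists
      refine hn.trans ?_
      rw [← ofReal_integral_eq_lintegral_ofReal ((hN n).int_mul (h.S_xcont t))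
        (Eventually.of_forall fun x => mul_nonneg (hb n x).1 (hS x))]
      exact ENNReal.ofReal_le_ofReal (e1 n)
  have hnn2 : ∀ x, 0 ≤ F 0 x * h.S t x := fun x => mul_nonneg (hF0 0 x) (hS x)
  have hm := ((hFx 0).mul (h.S_xcont t)).aestronglyMeasurable (μ := volume)
  have hi : Integrable (fun x => F 0 x * h.S t x) := by
    refine ⟨hm, ?_⟩
    rw [hasFiniteIntegral_iff_ofReal (Eventually.of_forall hnn2)]
    exact e2.trans_lt ENNReal.ofReal_lt_top
  refine ⟨hi, ?_⟩
  rw [integral_eq_lintegral_of_nonneg_ae (Eventually.of_forall hnn2) hm]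
  exact ENNReal.toReal_le_of_le_ofReal hnn e2

end Ctx

/-! ### Part 17 -/
namespace Ctx
variable {c : Ctx} {ψ ψ' k : ℝ → ℝ}

theorem exp_eig (κ s u : ℝ) : HasDerivAt (fun τ => Real.exp (κ * τ) * u) (κ * (Real.exp (κ * s) * u)) s := by
  have := (((hasDerivAt_id s).const_mul κ).exp).mul_const u
  refine this.congr_deriv ?_
  simp; ring

theorem super_φt : c.Super (fun s x => Real.exp (c.γ * s) * c.φt x) (fun s x => Real.exp (c.γ * s) * c.φt' x) := by
  intro s hs x
  refine ⟨(c.hφt.d1 x).const_mul _, Real.exp (c.γ * s) * ((c.γ - c.r x) * c.φt x), _, ?_, exp_eig _ _ _, by linarith⟩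
  refine ((c.hφt.d2 x).const_mul (Real.exp (c.γ * s))).congr_of_eventuallyEq (Eventually.of_forall fun y => ?_)
  simp only; ring

theorem sub_φt : c.Super (fun s x => -(Real.exp (c.γ * s) * c.φt x)) (fun s x => -(Real.exp (c.γ * s) * c.φt' x)) := by
  intro s hs x
  refine ⟨((c.hφt.d1 x).const_mul _).neg, -(Real.exp (c.γ * s) * ((c.γ - c.r x) * c.φt x)), _, ?_, (exp_eig _ _ _).neg, by linarith⟩
  refine ((c.hφt.d2 x).const_mul (Real.exp (c.γ * s))).neg.congr_of_eventuallyEq (Eventually.of_forall fun y => ?_)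
  simp only [Pi.neg_apply]; ring

theorem ΛE_nonneg : 0 ≤ c.ΛE := by
  have := c.μpos; have := abs_nonneg c.γ; unfold ΛE; positivity

theorem γ_le_ΛE : c.γ ≤ c.ΛE := by
  have := c.μpos; have := le_abs_self c.γ
  have : 0 ≤ c.kE ^ 2 * c.μ := by positivity
  unfold ΛE; linarith

theorem N.S_mass (h : c.N ψ ψ' k) (hψ : ∀ x, 0 ≤ ψ x) {t : ℝ} (ht : 0 ≤ t) :
    Integrable (fun x => c.φt x * h.S t x) ∧
      ∫ x, c.φt x * h.S t x = Real.exp (c.γ * t) * ∫ x, c.φt x * ψ x := by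
  have hFc : Continuous fun p : ℝ × ℝ => Real.exp (c.γ * p.1) * c.φt p.2 :=
    (Real.continuous_exp.comp (continuous_const.mul continuous_fst)).mul (c.φtc.comp continuous_snd)
  obtain ⟨hi, hle⟩ := h.S_super_dual hψ super_φt hFc (fun s x => mul_nonneg (Real.exp_nonneg _) (c.hφt.pos x).le) ht
  simp only [mul_zero, Real.exp_zero, one_mul] at hi hle
  refine ⟨hi, le_antisymm (hle.trans (le_of_eq ?_)) ?_⟩
  · rw [← integral_const_mul]; congr 1; ext x; ring
  have hEψ := h.int_mul c.Ef_cont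
  have hφψ := h.int_mul c.φtc
  have key : ∀ ε : ℝ, 0 < ε → Real.exp (c.γ * t) * ∫ x, c.φt x * ψ x ≤ (∫ x, c.φt x * h.S t x) +
      ε * (2 * Real.exp (c.ΛE * t) * ∫ x, ψ x * c.Ef x) := by
    intro ε hε
    obtain ⟨L, hL0, hL⟩ := c.dom_Ef c.hφt c.bdt hε
    set g : ℝ → ℝ := fun x => max (c.φt x - ε * c.Ef x) 0 with hg
    have hgc : Continuous g := ((c.φtc.sub (continuous_const.mul c.Ef_cont)).max continuous_const)
    have hgs : HasCompactSupport g := by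
      refine HasCompactSupport.intro (isCompact_Icc (a := -L) (b := L)) fun x hx => ?_
      have h1 : L < |x| := by by_contra h; exact hx (abs_le.mp (not_lt.mp h))
      exact max_eq_right (by linarith [hL x h1])
    obtain ⟨ρ, ρ', κ, hN, hb⟩ := c.density hgc hgs (fun x => le_max_right _ _) hε
    have hρφ : ∀ x, ρ x ≤ c.φt x := fun x => (hb x).2.1.trans (max_le (by nlinarith [c.Ef_one x]) (c.hφt.pos x).le)
    have hlow : ∀ x, Real.exp (c.γ * t) * c.φt x - 2 * ε * Real.exp (c.ΛE * t) * c.Ef x ≤ hN.S t x := by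
      intro x
      have := hN.S_ge (sub_φt.add (super_Ef (c := c) (ε := 2 * ε) (by linarith))) ht ?_ ?_ ?_ x
      · linarith
      · refine lsc_of (f := fun s x => -(Real.exp (c.γ * s) * c.φt x) + 2 * ε * Real.exp (c.ΛE * s) * c.Ef x) ?_ _
        refine hFc.neg.add ?_
        exact (continuous_const.mul (Real.continuous_exp.comp (continuous_const.mul continuous_fst))).mul (c.Ef_cont.comp continuous_snd)
      · obtain ⟨M, hM⟩ := (isCompact_Icc (a := -L) (b := L)).bddAbove_image c.φtc.continuousOn
        refine ⟨max M 0 * Real.exp (c.ΛE * t), fun s hs x => ?_⟩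
        have e1 : Real.exp (c.γ * s) ≤ Real.exp (c.ΛE * s) := Real.exp_le_exp.mpr (mul_le_mul_of_nonneg_right γ_le_ΛE hs.1)
        have e2 : Real.exp (c.ΛE * s) ≤ Real.exp (c.ΛE * t) := Real.exp_le_exp.mpr (mul_le_mul_of_nonneg_left hs.2 ΛE_nonneg)
        have e3 := c.hφt.pos x
        have e4 := Real.exp_pos (c.ΛE * s)
        have e5 := c.Ef_one x
        have e6 := le_max_right M 0
        have e7 : c.φt x ≤ max M 0 + 2 * ε * c.Ef x := by
          by_cases hx : L < |x|
          · have := hL x hx; nlinarith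
          · have : c.φt x ≤ M := hM ⟨x, abs_le.mp (not_lt.mp hx), rfl⟩
            have := le_max_left M 0; nlinarith
        have e8 : Real.exp (c.γ * s) * c.φt x ≤ Real.exp (c.ΛE * s) * (max M 0 + 2 * ε * c.Ef x) := by gcongr
        have e9 : Real.exp (c.ΛE * s) * max M 0 ≤ Real.exp (c.ΛE * t) * max M 0 := by gcongr
        nlinarith
      · intro x
        have h1 := (hb x).2.2
        have h2 : c.φt x - ε * c.Ef x ≤ g x := le_max_left _ _
        have h3 := c.Ef_one x
        simp only [mul_zero, Real.exp_zero, one_mul, mul_one]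
        nlinarith
    calc Real.exp (c.γ * t) * ∫ x, c.φt x * ψ x
        = (∫ x, ψ x * (Real.exp (c.γ * t) * c.φt x - 2 * ε * Real.exp (c.ΛE * t) * c.Ef x)) +
          ε * (2 * Real.exp (c.ΛE * t) * ∫ x, ψ x * c.Ef x) := by
          rw [show (fun x => ψ x * (Real.exp (c.γ * t) * c.φt x - 2 * ε * Real.exp (c.ΛE * t) * c.Ef x)) =
            fun x => Real.exp (c.γ * t) * (ψ x * c.φt x) - (2 * ε * Real.exp (c.ΛE * t)) * (ψ x * c.Ef x) by
              ext x; ring, integral_sub (hφψ.const_mul _) (hEψ.const_mul _), integral_const_mul, integral_const_mul]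
          simp only [mul_comm (c.φt _)]
          ring
      _ ≤ (∫ x, ψ x * hN.S t x) + ε * (2 * Real.exp (c.ΛE * t) * ∫ x, ψ x * c.Ef x) := by
          gcongr ?_ + _
          refine integral_mono (h.int_mul ((continuous_const.mul c.φtc).sub (continuous_const.mul c.Ef_cont)))
            (h.int_mul (hN.S_xcont t)) fun x => ?_
          exact mul_le_mul_of_nonneg_left (hlow x) (hψ x)
      _ ≤ _ := by
          gcongr ?_ + _
          rw [← h.S_dual hN]
          refine integral_mono (hN.int_mul (h.S_xcont t)) hi fun x => ?_
          exact mul_le_mul_of_nonneg_right (hρφ x) (h.S_nonneg hψ ht x)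
  have hlim : Tendsto (fun ε : ℝ => (∫ x, c.φt x * h.S t x) +
      ε * (2 * Real.exp (c.ΛE * t) * ∫ x, ψ x * c.Ef x)) (nhdsWithin 0 (Set.Ioi 0))
      (nhds ((∫ x, c.φt x * h.S t x) + 0 * (2 * Real.exp (c.ΛE * t) * ∫ x, ψ x * c.Ef x))) :=
    (by fun_prop : Continuous fun ε : ℝ => (∫ x, c.φt x * h.S t x) +
      ε * (2 * Real.exp (c.ΛE * t) * ∫ x, ψ x * c.Ef x)).continuousAt.mono_left nhdsWithin_le_nhds
  rw [zero_mul, add_zero] at hlim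
  refine ge_of_tendsto hlim ?_
  filter_upwards [self_mem_nhdsWithin] with ε hε
  exact key ε hε

end Ctx

/-! ### Part 18 -/
namespace Ctx
variable (c : Ctx)

noncomputable def z (t y x : ℝ) : ℝ := c.T x - c.T y - c.W * t
noncomputable def Cd : ℝ := c.C1 + (2 * c.τ1 / c.τ0) * (1 + c.W)
noncomputable def A0 : ℝ := c.μ * c.τ1 ^ 2

theorem Cd_nonneg : 0 ≤ c.Cd := by
  have := c.C10; have := c.τ10; have := c.τ00; have := c.W0
  unfold Cd; positivity

theorem super_tail (l : ℝ) (y : ℝ) : c.Super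
    (fun s x => Real.exp ((c.γ + l * c.W + l ^ 2 * c.A0) * s) * (c.φt x * Real.exp (l * (c.Tt x - c.Tt y))))
    (fun s x => Real.exp ((c.γ + l * c.W + l ^ 2 * c.A0) * s) *
      (c.φt' x * Real.exp (l * (c.Tt x - c.Tt y)) + c.φt x * (Real.exp (l * (c.Tt x - c.Tt y)) * (l * c.Ttd x)))) := by
  intro s hs x
  have hE : ∀ x, HasDerivAt (fun x => Real.exp (l * (c.Tt x - c.Tt y)))
      (Real.exp (l * (c.Tt x - c.Tt y)) * (l * c.Ttd x)) x := fun x =>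
    (((c.Ttder x).sub_const _).const_mul l).exp
  have hp := fun x => (c.hφt.pos x).ne'
  have h3 : HasDerivAt (fun x => c.a x * c.φt x * c.Ttd x) (c.W * c.φt x - c.a x * c.Ttd x * c.φt' x) x := by
    have := (c.Tteq x).div (c.hφt.d1 x) (hp x)
    refine (this.congr_of_eventuallyEq (Eventually.of_forall fun y => ?_)).congr_deriv ?_
    · have := hp y
      simp only [Pi.div_apply]; field_simp
    · have := hp x
      field_simp
  have h4 := (((c.hφt.d2 x).mul (hE x)).add ((h3.mul (hE x)).const_mul l)).const_mul
      (Real.exp ((c.γ + l * c.W + l ^ 2 * c.A0) * s))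
  refine ⟨((c.hφt.d1 x).mul (hE x)).const_mul _, Real.exp ((c.γ + l * c.W + l ^ 2 * c.A0) * s) * ((c.γ - c.r x + l * c.W + l ^ 2 * (c.a x * c.Ttd x ^ 2)) * (c.φt x * Real.exp (l * (c.Tt x - c.Tt y)))), _, ?_, exp_eig _ _ _, ?_⟩
  · refine (h4.congr_of_eventuallyEq (Eventually.of_forall fun y => ?_)).congr_deriv ?_
    · simp only [Pi.add_apply, Pi.mul_apply]; ring
    · ring
  · have h5 : c.a x * c.Ttd x ^ 2 ≤ c.A0 := by
      unfold A0
      have h1 := c.Ttdb x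
      have h2 := c.τ00
      have h3 := c.ha x
      have h4 := c.apos x
      have : c.Ttd x ^ 2 ≤ c.τ1 ^ 2 := by apply pow_le_pow_left₀ <;> linarith
      have := c.μpos
      apply mul_le_mul <;> first | linarith | positivity
    have h6 : 0 < Real.exp ((c.γ + l * c.W + l ^ 2 * c.A0) * s) * (c.φt x * Real.exp (l * (c.Tt x - c.Tt y))) :=
      mul_pos (Real.exp_pos _) (mul_pos (c.hφt.pos x) (Real.exp_pos _))
    have h7 : l ^ 2 * (c.a x * c.Ttd x ^ 2) ≤ l ^ 2 * c.A0 := by gcongr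
    have h8 := mul_le_mul_of_nonneg_right h7 h6.le
    simp only
    linarith

theorem T_lip (x y : ℝ) : c.τ0 * |x - y| ≤ |c.T x - c.T y| := by
  rcases le_total x y with h | h
  · have := growth c.Tder (fun x => (c.Tdb x).1) h
    rw [abs_sub_comm, abs_of_nonneg (sub_nonneg.mpr h), abs_sub_comm]
    exact this.trans (le_abs_self _)
  · have := growth c.Tder (fun x => (c.Tdb x).1) h
    rw [abs_of_nonneg (sub_nonneg.mpr h)]
    exact this.trans (le_abs_self _)

theorem T_lip' (x y : ℝ) : |c.T x - c.T y| ≤ c.τ1 * |x - y| :=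
  abs_sub_le_of_deriv c.Tder (fun x => abs_le.mpr ⟨by linarith [(c.Tdb x).1, c.τ00, c.τ10], (c.Tdb x).2⟩) x y

theorem Tt_lip' (x y : ℝ) : |c.Tt x - c.Tt y| ≤ c.τ1 * |x - y| :=
  abs_sub_le_of_deriv c.Ttder (fun x => abs_le.mpr ⟨by linarith [(c.Ttdb x).1, c.τ00, c.τ10], (c.Ttdb x).2⟩) x y

noncomputable def C0 : ℝ := c.τ1 / (2 * c.τ0)
noncomputable def At : ℝ := 1 + c.Cd + (1 + c.Cd) ^ 2 * c.A0 + (1 + c.Cd) * c.C0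

theorem C0_nonneg : 0 ≤ c.C0 := by
  have := c.τ10; have := c.τ00; unfold C0; positivity
theorem A0_nonneg : 0 ≤ c.A0 := by
  have := c.μpos; unfold A0; positivity

variable {c} {ψ ψ' k : ℝ → ℝ}

theorem N.tail1 (h : c.N ψ ψ' k) (hψ : ∀ x, 0 ≤ ψ x) {t y : ℝ} (ht : 0 < t)
    (hs : ∀ x, ψ x ≠ 0 → |c.T x - c.T y| ≤ Real.sqrt t / 2) (l : ℝ) :
    Integrable (fun x => c.φt x * h.S t x * Real.exp (l * (c.Tt x - c.Tt y - c.W * t))) ∧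
    ∫ x, c.φt x * h.S t x * Real.exp (l * (c.Tt x - c.Tt y - c.W * t)) ≤
      Real.exp (c.γ * t + l ^ 2 * c.A0 * t + |l| * c.C0 * Real.sqrt t) * ∫ x, c.φt x * ψ x := by
  have hc1 : Continuous fun x => c.φt x * Real.exp (l * (c.Tt x - c.Tt y)) :=
    c.φtc.mul (Real.continuous_exp.comp (continuous_const.mul (c.Ttc.sub continuous_const)))
  obtain ⟨hi, hle⟩ := h.S_super_dual hψ (c.super_tail l y)
    ((Real.continuous_exp.comp (continuous_const.mul continuous_fst)).mul (hc1.comp continuous_snd))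
    (fun s x => mul_nonneg (Real.exp_nonneg _) (mul_nonneg (c.hφt.pos x).le (Real.exp_nonneg _))) ht.le
  have e : (fun x => c.φt x * h.S t x * Real.exp (l * (c.Tt x - c.Tt y - c.W * t))) = fun x =>
      Real.exp (-(l * c.W * t)) * (Real.exp ((c.γ + l * c.W + l ^ 2 * c.A0) * 0) * (c.φt x * Real.exp (l * (c.Tt x - c.Tt y))) * h.S t x) := by
    ext x
    rw [show l * (c.Tt x - c.Tt y - c.W * t) = l * (c.Tt x - c.Tt y) + -(l * c.W * t) by ring, Real.exp_add]
    simp; ring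
  rw [e]
  refine ⟨hi.const_mul _, ?_⟩
  rw [integral_const_mul]
  have h2 : ∫ x, ψ x * (Real.exp ((c.γ + l * c.W + l ^ 2 * c.A0) * t) * (c.φt x * Real.exp (l * (c.Tt x - c.Tt y)))) ≤
      Real.exp ((c.γ + l * c.W + l ^ 2 * c.A0) * t) * Real.exp (|l| * c.C0 * Real.sqrt t) * ∫ x, c.φt x * ψ x := by
    rw [← integral_const_mul]
    have i2 : Integrable fun x => c.φt x * ψ x := by
      simpa only [mul_comm] using h.int_mul c.φtc
    refine integral_mono (h.int_mul (continuous_const.mul hc1)) (i2.const_mul _) fun x => ?_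
    by_cases hx : ψ x = 0
    · simp [hx]
    have h3 := hs x hx
    have h4 := c.T_lip x y
    have h5 := c.Tt_lip' x y
    have h6 : l * (c.Tt x - c.Tt y) ≤ |l| * c.C0 * Real.sqrt t := by
      refine (le_abs_self _).trans ?_
      rw [abs_mul, mul_assoc]
      gcongr
      refine h5.trans ?_
      have h7 := c.τ00
      have h8 := c.τ10
      unfold C0
      rw [div_mul_eq_mul_div, le_div_iff₀ (by positivity)]
      nlinarith
    have h7 := Real.exp_le_exp.mpr h6
    have h8 : 0 ≤ Real.exp ((c.γ + l * c.W + l ^ 2 * c.A0) * t) * (c.φt x * ψ x) :=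
      mul_nonneg (Real.exp_nonneg _) (mul_nonneg (c.hφt.pos x).le (hψ x))
    simp only
    nlinarith
  refine (mul_le_mul_of_nonneg_left (hle.trans h2) (Real.exp_nonneg _)).trans (le_of_eq ?_)
  rw [← mul_assoc, ← mul_assoc, ← Real.exp_add, ← Real.exp_add]
  congr 2; ring

theorem N.tail (h : c.N ψ ψ' k) (hψ : ∀ x, 0 ≤ ψ x) {t y : ℝ} (ht : 0 < t)
    (hs : ∀ x, ψ x ≠ 0 → |c.T x - c.T y| ≤ Real.sqrt t / 2) {l : ℝ} (hl : 0 ≤ l) :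
    Integrable (fun x => c.φt x * h.S t x * Real.exp (l * |c.z t y x| / Real.sqrt t)) ∧
    ∫ x, c.φt x * h.S t x * Real.exp (l * |c.z t y x| / Real.sqrt t) ≤
      Real.exp (c.γ * t + c.At * (1 + l ^ 2)) * ∫ x, c.φt x * ψ x := by
  have hq : 0 < Real.sqrt t := Real.sqrt_pos.mpr ht
  have hqq : Real.sqrt t * Real.sqrt t = t := Real.mul_self_sqrt ht.le
  set q := Real.sqrt t with hqdef
  set L := l * (1 + c.Cd) / q with hL
  have hCd := c.Cd_nonneg
  have hL0 : 0 ≤ L := by positivity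
  obtain ⟨i1, b1⟩ := h.tail1 hψ ht hs L
  obtain ⟨i2, b2⟩ := h.tail1 hψ ht hs (-L)
  have hM : 0 ≤ ∫ x, c.φt x * ψ x := integral_nonneg fun x => mul_nonneg (c.hφt.pos x).le (hψ x)
  have hpt : ∀ x, c.φt x * h.S t x * Real.exp (l * |c.z t y x| / q) ≤ Real.exp (l * c.Cd) *
      (c.φt x * h.S t x * Real.exp (L * (c.Tt x - c.Tt y - c.W * t)) +
       c.φt x * h.S t x * Real.exp (-L * (c.Tt x - c.Tt y - c.W * t))) := by
    intro x
    have h1 := c.d_comp ht x y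
    rw [← Cd, ← z] at h1
    set e := c.Tt x - c.Tt y - c.W * t
    have h2 : |c.z t y x| ≤ (1 + c.Cd) * |e| + c.Cd * q := by
      have h3 := abs_sub_abs_le_abs_sub (c.z t y x) e
      have h4 : c.Cd * (min |c.z t y x| |e| + q) ≤ c.Cd * (|e| + q) := by
        gcongr; exact min_le_right _ _
      linarith
    have h5 : Real.exp (l * |c.z t y x| / q) ≤ Real.exp (l * c.Cd) * (Real.exp (L * e) + Real.exp (-L * e)) := by
      have h6 : l * |c.z t y x| / q ≤ l * c.Cd + L * |e| := by
        rw [div_le_iff₀ hq, hL]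
        have : (l * c.Cd + l * (1 + c.Cd) / q * |e|) * q = l * ((1 + c.Cd) * |e| + c.Cd * q) := by
          field_simp; ring
        rw [this]; gcongr
      refine (Real.exp_le_exp.mpr h6).trans ?_
      rw [Real.exp_add]
      gcongr
      rcases le_total 0 e with h | h
      · rw [abs_of_nonneg h]; linarith [Real.exp_pos (-L * e)]
      · rw [abs_of_nonpos h, mul_neg, ← neg_mul]; linarith [Real.exp_pos (L * e)]
    have h6 : 0 ≤ c.φt x * h.S t x := mul_nonneg (c.hφt.pos x).le (h.S_nonneg hψ ht.le x)
    calc _ ≤ c.φt x * h.S t x * (Real.exp (l * c.Cd) * (Real.exp (L * e) + Real.exp (-L * e))) := by gcongr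
      _ = _ := by ring
  have hnn : ∀ x, 0 ≤ c.φt x * h.S t x * Real.exp (l * |c.z t y x| / q) := fun x =>
    mul_nonneg (mul_nonneg (c.hφt.pos x).le (h.S_nonneg hψ ht.le x)) (Real.exp_nonneg _)
  have hcont : Continuous fun x => c.φt x * h.S t x * Real.exp (l * |c.z t y x| / q) := by
    have h1 : Continuous (c.z t y) := (c.Tc.sub continuous_const).sub continuous_const
    exact (c.φtc.mul (h.S_xcont t)).mul (Real.continuous_exp.comp ((continuous_const.mul h1.abs).div_const _))
  have hi : Integrable (fun x => c.φt x * h.S t x * Real.exp (l * |c.z t y x| / q)) := by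
    refine ((i1.add i2).const_mul (Real.exp (l * c.Cd))).mono' hcont.aestronglyMeasurable (Eventually.of_forall fun x => ?_)
    rw [Real.norm_of_nonneg (hnn x)]
    exact hpt x
  refine ⟨hi, (integral_mono hi ((i1.add i2).const_mul (Real.exp (l * c.Cd))) hpt).trans ?_⟩
  rw [integral_const_mul]
  simp only [Pi.add_apply]
  rw [integral_add i1 i2]
  have hLt : L ^ 2 * t = l ^ 2 * (1 + c.Cd) ^ 2 := by rw [hL, ← hqq]; field_simp
  have hLq : L * q = l * (1 + c.Cd) := by rw [hL]; field_simp
  rw [neg_sq, abs_neg, abs_of_nonneg hL0] at b2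
  rw [abs_of_nonneg hL0] at b1
  have e1 : c.γ * t + L ^ 2 * c.A0 * t + L * c.C0 * q = c.γ * t + l ^ 2 * (1 + c.Cd) ^ 2 * c.A0 + l * (1 + c.Cd) * c.C0 := by
    rw [← hLt, ← hLq]; ring
  rw [e1] at b1 b2
  set X := c.γ * t + l ^ 2 * (1 + c.Cd) ^ 2 * c.A0 + l * (1 + c.Cd) * c.C0 with hX
  have h2 : (2:ℝ) ≤ Real.exp 1 := by have := Real.add_one_le_exp (1:ℝ); linarith
  calc _ ≤ Real.exp (l * c.Cd) * (Real.exp X * (∫ x, c.φt x * ψ x) + Real.exp X * (∫ x, c.φt x * ψ x)) := by gcongr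
    _ = 2 * (Real.exp (l * c.Cd) * Real.exp X) * (∫ x, c.φt x * ψ x) := by ring
    _ ≤ Real.exp 1 * (Real.exp (l * c.Cd) * Real.exp X) * (∫ x, c.φt x * ψ x) := by gcongr
    _ = Real.exp (1 + (l * c.Cd + X)) * (∫ x, c.φt x * ψ x) := by rw [Real.exp_add 1, Real.exp_add (l * c.Cd) X]
    _ ≤ _ := by
      refine mul_le_mul_of_nonneg_right (Real.exp_le_exp.mpr ?_) hM
      have h3 : l ≤ 1 + l ^ 2 := by nlinarith [sq_nonneg (l - 1)]
      have h4 := c.A0_nonneg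
      have h5 := c.C0_nonneg
      have h6 : 0 ≤ (1 + c.Cd) ^ 2 * c.A0 := by positivity
      have h7 : 0 ≤ (1 + c.Cd) * c.C0 := by positivity
      have h8 : l * c.Cd ≤ (1 + l ^ 2) * c.Cd := by gcongr
      have h9 : l * ((1 + c.Cd) * c.C0) ≤ (1 + l ^ 2) * ((1 + c.Cd) * c.C0) := by gcongr
      rw [hX]; unfold At
      nlinarith [sq_nonneg l]

end Ctx

/-! ### Part 19 -/
noncomputable def bA (q l e D s : ℝ) : ℝ := Real.exp (q * (Real.log e - Real.log (s + e)) - D / (4 * l * (s + e)))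

theorem bA_le_one {q l e D s : ℝ} (hq : 0 ≤ q) (hl : 0 < l) (he : 0 < e) (hD : 0 ≤ D) (hs : 0 ≤ s) :
    bA q l e D s ≤ 1 := by
  rw [bA, Real.exp_le_one_iff]
  have h1 : Real.log e ≤ Real.log (s + e) := Real.log_le_log he (by linarith)
  have h2 : 0 ≤ D / (4 * l * (s + e)) := by positivity
  nlinarith

theorem bA_ds {q l e D s : ℝ} (hl : 0 < l) (he : 0 < e) (hs : 0 ≤ s) :
    HasDerivAt (fun s => bA q l e D s) (bA q l e D s * (-q / (s + e) + D / (4 * l * (s + e) ^ 2))) s := by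
  have hp : s + e ≠ 0 := by positivity
  have h1 : HasDerivAt (fun s => s + e) 1 s := (hasDerivAt_id s).add_const e
  have h2 := (((h1.log hp).const_sub (Real.log e)).const_mul q).sub
    ((hasDerivAt_const s D).div (h1.const_mul (4 * l)) (by positivity))
  refine h2.exp.congr_deriv ?_
  simp only [bA, Pi.sub_apply, Pi.div_apply]
  congr 1
  field_simp
  ring

theorem bA_dz {q l e s zc : ℝ} (hl : 0 < l) (he : 0 < e) (hs : 0 ≤ s) (z : ℝ) :
    HasDerivAt (fun z => bA q l e ((z - zc) ^ 2) s) (-(bA q l e ((z - zc) ^ 2) s * ((z - zc) / (2 * l * (s + e))))) z := by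
  have hp : s + e ≠ 0 := by positivity
  have h1 : HasDerivAt (fun z => (z - zc) ^ 2) (2 * (z - zc)) z := by
    have := ((hasDerivAt_id z).sub_const zc).pow 2
    refine this.congr_deriv ?_
    simp
  have h2 := (h1.div_const (4 * l * (s + e))).const_sub (q * (Real.log e - Real.log (s + e)))
  refine h2.exp.congr_deriv ?_
  simp only [bA]
  field_simp
  ring

theorem bA_dzz {q l e s zc : ℝ} (hl : 0 < l) (he : 0 < e) (hs : 0 ≤ s) (z : ℝ) :
    HasDerivAt (fun z => -(bA q l e ((z - zc) ^ 2) s * ((z - zc) / (2 * l * (s + e)))))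
      (bA q l e ((z - zc) ^ 2) s * (-1 / (2 * l * (s + e)) + (z - zc) ^ 2 / (4 * l ^ 2 * (s + e) ^ 2))) z := by
  have hp : s + e ≠ 0 := by positivity
  have h1 := ((bA_dz (q := q) (zc := zc) hl he hs z).mul (((hasDerivAt_id z).sub_const zc).div_const (2 * l * (s + e)))).neg
  refine h1.congr_deriv ?_
  simp only [id]
  field_simp
  ring

theorem bA_tot {q l e s zc f' : ℝ} {f : ℝ → ℝ} (hl : 0 < l) (he : 0 < e) (hs : 0 ≤ s) (hf : HasDerivAt f f' s) :
    HasDerivAt (fun s => bA q l e ((f s - zc) ^ 2) s)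
      (bA q l e ((f s - zc) ^ 2) s * (-q / (s + e) + (f s - zc) ^ 2 / (4 * l * (s + e) ^ 2)) +
        -(bA q l e ((f s - zc) ^ 2) s * ((f s - zc) / (2 * l * (s + e)))) * f') s := by
  have hp : s + e ≠ 0 := by positivity
  have h1 : HasDerivAt (fun s => s + e) 1 s := (hasDerivAt_id s).add_const e
  have h3 : HasDerivAt (fun s => (f s - zc) ^ 2) (2 * (f s - zc) * f') s := by
    have := (hf.sub_const zc).pow 2
    refine this.congr_deriv ?_
    simp
  have h2 := (((h1.log hp).const_sub (Real.log e)).const_mul q).sub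
    (h3.div (h1.const_mul (4 * l)) (by positivity))
  refine h2.exp.congr_deriv ?_
  simp only [bA, Pi.sub_apply, Pi.div_apply]
  rw [← sub_eq_zero]
  generalize Real.exp _ = E
  field_simp
  ring

structure Barrier (l L B t zc z2 : ℝ) (G Gs Gz Gzz : ℝ → ℝ → ℝ) (R : ℝ) : Prop where
  ds : ∀ s, 0 ≤ s → ∀ z, HasDerivAt (fun s => G s z) (Gs s z) s
  dz : ∀ s, 0 ≤ s → ∀ z, HasDerivAt (G s) (Gz s z) z
  dzz : ∀ s, 0 ≤ s → ∀ z, HasDerivAt (Gz s) (Gzz s z) z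
  tot : ∀ s, 0 ≤ s → ∀ (f : ℝ → ℝ) (f' : ℝ), HasDerivAt f f' s →
    HasDerivAt (fun s => G s (f s)) (Gs s (f s) + Gz s (f s) * f') s
  ineq : ∀ s, 0 ≤ s → ∀ z α, l ≤ α → α ≤ L → Gs s z ≤ α * Gzz s z
  le1 : ∀ s, 0 ≤ s → ∀ z, G s z ≤ 1
  initv : ∀ z, Real.sqrt t / 2 ≤ |z - zc| → G 0 z ≤ 0
  far : ∀ s, 0 ≤ s → s ≤ t → ∀ z, R ≤ |z - zc| → G s z ≤ 0
  low : Real.exp (-(B * (1 + (z2 - zc) ^ 2 / t))) ≤ G t z2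
  cont : ContinuousOn (fun p : ℝ × ℝ => G p.1 p.2) (Set.Ici 0 ×ˢ Set.univ)

theorem eps_exists {l q : ℝ} (hl : 0 < l) (hq : 0 < q) : ∃ X : ℝ, 1 ≤ X ∧
    1 + q * Real.log (2 * X) + q + 1 / (4 * l) ≤ X / (16 * l) := by
  set Y := 16 * l * (1 + 3 * q + 1 / (4 * l)) + 1 with hY
  have hY1 : 1 ≤ Y := by rw [hY]; have : 0 ≤ 16 * l * (1 + 3 * q + 1 / (4 * l)) := by positivity
                         linarith
  refine ⟨Y ^ 2, by nlinarith, ?_⟩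
  have h1 : Real.log (2 * Y ^ 2) ≤ 2 * Y := by
    rw [Real.log_mul (by norm_num) (by positivity), Real.log_pow]
    have h2 := Real.log_le_sub_one_of_pos (show (0:ℝ) < 2 by norm_num)
    have h3 := Real.log_le_sub_one_of_pos (show 0 < Y by linarith)
    push_cast
    linarith
  have h2 : Y * (1 + 3 * q + 1 / (4 * l)) ≤ Y ^ 2 / (16 * l) := by
    rw [le_div_iff₀ (by positivity)]
    have : 16 * l * (1 + 3 * q + 1 / (4 * l)) ≤ Y := by linarith
    nlinarith
  have h3 : 0 < 1 / (4 * l) := by positivity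
  have h4 : q * Real.log (2 * Y ^ 2) ≤ q * (2 * Y) := by gcongr
  nlinarith

theorem barrier {l L : ℝ} (hl : 0 < l) (hlL : l ≤ L) : ∃ B : ℝ, 0 < B ∧ ∀ t, 0 < t → ∀ zc z2,
    ∃ G Gs Gz Gzz R, Barrier l L B t zc z2 G Gs Gz Gzz R := by
  set q := L / (2 * l) with hq
  have hL : 0 < L := hl.trans_le hlL
  have hq0 : 0 < q := by positivity
  obtain ⟨X, hX1, hX⟩ := eps_exists hl hq0
  refine ⟨X / (16 * l), by positivity, fun t ht zc z2 => ?_⟩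
  set K := (z2 - zc) ^ 2 / t with hK
  have hK0 : 0 ≤ K := by positivity
  set ε := 1 / (X * (1 + K)) with hε
  have hε0 : 0 < ε := by positivity
  have hε1 : ε ≤ 1 := by
    rw [hε, div_le_one (by positivity)]; nlinarith
  set e := ε * t with he
  have he0 : 0 < e := by positivity
  set η := bA q l e ((z2 - zc) ^ 2) t / 2 with hη
  have hη0 : 0 < η := by rw [hη, bA]; positivity
  have hη1 : Real.exp (-(X / (16 * l) * (1 + K))) ≤ η := by
    have e1 : η = Real.exp (q * (Real.log e - Real.log (t + e)) - (z2 - zc) ^ 2 / (4 * l * (t + e)) - Real.log 2) := by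
      rw [Real.exp_sub _ (Real.log 2), Real.exp_log (by norm_num), hη, bA]
    rw [e1]
    apply Real.exp_le_exp.mpr
    have h1 : Real.log e - Real.log (t + e) = -Real.log ((1 + ε) / ε) := by
      rw [← Real.log_div he0.ne' (by positivity), ← Real.log_inv]
      congr 1
      rw [he]; field_simp
    have h2 : Real.log ((1 + ε) / ε) ≤ Real.log (2 * X) + K := by
      have : (1 + ε) / ε ≤ 2 * X * (1 + K) := by
        rw [div_le_iff₀ hε0]
        have : X * (1 + K) * ε = 1 := by rw [hε]; field_simp
        nlinarith
      refine (Real.log_le_log (by positivity) this).trans ?_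
      rw [Real.log_mul (by positivity) (by positivity)]
      have := Real.log_le_sub_one_of_pos (show 0 < 1 + K by linarith)
      linarith
    have h3 : (z2 - zc) ^ 2 / (4 * l * (t + e)) ≤ K * (1 / (4 * l)) := by
      rw [hK, div_mul_div_comm, mul_one]
      apply div_le_div_of_nonneg_left (sq_nonneg _) (by positivity)
      have : 0 < l * e := by positivity
      linarith
    have h4 := Real.log_le_sub_one_of_pos (show (0:ℝ) < 2 by norm_num)
    have h5 : q * Real.log ((1 + ε) / ε) ≤ q * (Real.log (2 * X) + K) := by gcongr
    have h6 : 0 < 1 / (4 * l) := by positivity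
    have h7 : 0 ≤ Real.log (2 * X) := Real.log_nonneg (by linarith)
    have h8 : (1 + q * Real.log (2 * X) + q + 1 / (4 * l)) * (1 + K) ≤ X / (16 * l) * (1 + K) := by gcongr
    rw [h1]
    have h9 : 0 ≤ q * Real.log (2 * X) := by positivity
    nlinarith
  have hlogη : ∀ s D, 0 ≤ s → s ≤ t → 0 ≤ D → 8 * l * t * (-Real.log η) ≤ D → bA q l e D s ≤ η := by
    intro s D hs hst hD0 hD
    rw [← Real.log_le_log_iff (by rw [bA]; positivity) hη0, bA, Real.log_exp]
    have h1 : Real.log e ≤ Real.log (s + e) := Real.log_le_log he0 (by linarith)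
    have h2 : D / (8 * l * t) ≤ D / (4 * l * (s + e)) := by
      apply div_le_div_of_nonneg_left hD0 (by positivity)
      have : e ≤ t := by nlinarith
      nlinarith
    have h3 : -Real.log η ≤ D / (8 * l * t) := by
      rw [le_div_iff₀ (by positivity)]; linarith
    nlinarith
  refine ⟨fun s z => bA q l e ((z - zc) ^ 2) s - η,
    fun s z => bA q l e ((z - zc) ^ 2) s * (-q / (s + e) + (z - zc) ^ 2 / (4 * l * (s + e) ^ 2)),
    fun s z => -(bA q l e ((z - zc) ^ 2) s * ((z - zc) / (2 * l * (s + e)))),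
    fun s z => bA q l e ((z - zc) ^ 2) s * (-1 / (2 * l * (s + e)) + (z - zc) ^ 2 / (4 * l ^ 2 * (s + e) ^ 2)),
    1 + 8 * l * t * |Real.log η|, ?_⟩
  refine ⟨fun s hs z => (bA_ds hl he0 hs).sub_const η, fun s hs z => (bA_dz hl he0 hs z).sub_const η,
    fun s hs z => bA_dzz hl he0 hs z,
    fun s hs f f' hf => (bA_tot hl he0 hs hf).sub_const η, ?_, ?_, ?_, ?_, ?_, ?_⟩
  · intro s hs z α h1 h2
    have hA : 0 < bA q l e ((z - zc) ^ 2) s := Real.exp_pos _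
    have hτ : 0 < s + e := by positivity
    have e1 : α * (bA q l e ((z - zc) ^ 2) s * (-1 / (2 * l * (s + e)) + (z - zc) ^ 2 / (4 * l ^ 2 * (s + e) ^ 2))) =
      bA q l e ((z - zc) ^ 2) s * (-(α / (2 * l)) / (s + e) + (α / l) * ((z - zc) ^ 2 / (4 * l * (s + e) ^ 2))) := by
      field_simp
    rw [e1]
    gcongr ?_ * (?_ + ?_)
    · rw [hq]
      gcongr
    · apply le_mul_of_one_le_left (by positivity)
      rw [le_div_iff₀ hl]; linarith
  · intro s hs z
    have := bA_le_one hq0.le hl he0 (sq_nonneg (z - zc)) hs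
    linarith
  · intro z hz
    have h1 : bA q l e ((z - zc) ^ 2) 0 ≤ Real.exp (-(X / (16 * l) * (1 + K))) := by
      rw [bA]
      apply Real.exp_le_exp.mpr
      rw [zero_add, sub_self, mul_zero, zero_sub]
      have h2 : t / 4 ≤ (z - zc) ^ 2 := by
        rw [← sq_abs (z - zc)]
        have h3 := Real.mul_self_sqrt ht.le
        have h4 := Real.sqrt_nonneg t
        nlinarith
      have h3 : X / (16 * l) * (1 + K) = (t / 4) / (4 * l * e) := by
        rw [he, hε]; field_simp; norm_num
      rw [h3]
      gcongr
    linarith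
  · intro s hs hst z hz
    have := hlogη s ((z - zc) ^ 2) hs hst (sq_nonneg _) ?_
    · linarith
    · rw [← sq_abs (z - zc)]
      have h1 : 8 * l * t * (-Real.log η) ≤ 8 * l * t * |Real.log η| := by
        gcongr; exact neg_le_abs _
      have h2 : 0 ≤ 8 * l * t * |Real.log η| := by positivity
      nlinarith
  · have : bA q l e ((z2 - zc) ^ 2) t - η = η := by rw [hη]; ring
    rw [this]; exact hη1
  · refine ContinuousOn.sub ?_ continuousOn_const
    refine Real.continuous_exp.comp_continuousOn ?_
    have hne : ∀ p ∈ Set.Ici (0:ℝ) ×ˢ (Set.univ : Set ℝ), p.1 + e ≠ 0 := by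
      rintro p ⟨hp, -⟩
      have : (0:ℝ) ≤ p.1 := hp
      positivity
    refine ContinuousOn.sub ?_ ?_
    · exact continuousOn_const.mul (continuousOn_const.sub ((continuousOn_fst.add continuousOn_const).log hne))
    · refine ContinuousOn.div (by fun_prop) (by fun_prop) fun p hp => ?_
      have := hne p hp
      positivity

/-! ### Part 20 -/
namespace Ctx
variable {c : Ctx} {ψ ψ' k : ℝ → ℝ}

theorem alpha_bound (c : Ctx) (x : ℝ) : c.τ0 ^ 2 / c.μ ≤ c.a x * c.Td x ^ 2 ∧ c.a x * c.Td x ^ 2 ≤ c.μ * c.τ1 ^ 2 := by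
  have h1 := c.Tdb x
  have h2 := c.τ00
  have h3 := c.ha x
  have h4 := c.apos x
  have h5 := c.μpos
  have h6 : c.Td x ^ 2 ≤ c.τ1 ^ 2 := by apply pow_le_pow_left₀ <;> linarith
  have h7 : c.τ0 ^ 2 ≤ c.Td x ^ 2 := by apply pow_le_pow_left₀ <;> linarith
  constructor
  · rw [div_eq_mul_one_div, mul_comm]
    apply mul_le_mul h3.1 h7 (by positivity) h4.le
  · apply mul_le_mul h3.2 h6 (by positivity) h5.le

theorem tB_ex (c : Ctx) : ∃ B : ℝ, 0 < B ∧ ∀ t, 0 < t → ∀ zc z2,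
    ∃ G Gs Gz Gzz R, Barrier (c.τ0 ^ 2 / c.μ) (c.μ * c.τ1 ^ 2) B t zc z2 G Gs Gz Gzz R :=
  barrier (by have := c.τ00; have := c.μpos; positivity) ((c.alpha_bound 0).1.trans (c.alpha_bound 0).2)

noncomputable def tB (c : Ctx) : ℝ := c.tB_ex.choose
theorem tB_pos (c : Ctx) : 0 < c.tB := c.tB_ex.choose_spec.1
theorem tB_spec (c : Ctx) : ∀ t, 0 < t → ∀ zc z2,
    ∃ G Gs Gz Gzz R, Barrier (c.τ0 ^ 2 / c.μ) (c.μ * c.τ1 ^ 2) c.tB t zc z2 G Gs Gz Gzz R := c.tB_ex.choose_spec.2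

theorem T_mono (c : Ctx) {x y : ℝ} (h : x ≤ y) : c.T x ≤ c.T y := by
  have := growth c.Tder (fun x => (c.Tdb x).1) h
  have h2 := c.τ00
  have : 0 ≤ c.τ0 * (y - x) := mul_nonneg h2.le (by linarith)
  linarith

/-- space operator applied to `φ * G(z)` -/
theorem phiG_d1 (c : Ctx) {g gz : ℝ → ℝ} (hg : ∀ z, HasDerivAt g (gz z) z) (s y x : ℝ) :
    HasDerivAt (fun x => c.φ x * g (c.z s y x))
      (c.φ' x * g (c.z s y x) + c.φ x * (gz (c.z s y x) * c.Td x)) x := by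
  have hz : HasDerivAt (fun x => c.z s y x) (c.Td x) x := ((c.Tder x).sub_const _).sub_const _
  exact (c.hφ.d1 x).mul ((hg (c.z s y x)).comp x hz)

theorem phiG_d2 (c : Ctx) {g gz gzz : ℝ → ℝ} (hg : ∀ z, HasDerivAt g (gz z) z)
    (hgz : ∀ z, HasDerivAt gz (gzz z) z) (s y x : ℝ) :
    HasDerivAt (fun x => c.a x * (c.φ' x * g (c.z s y x) + c.φ x * (gz (c.z s y x) * c.Td x)))
      (c.φ x * ((c.γ - c.r x) * g (c.z s y x) + c.a x * c.Td x ^ 2 * gzz (c.z s y x) - c.W * gz (c.z s y x))) x := by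
  have hp := fun x => (c.hφ.pos x).ne'
  have hz : HasDerivAt (fun x => c.z s y x) (c.Td x) x := ((c.Tder x).sub_const _).sub_const _
  have h1 := (hg (c.z s y x)).comp x hz
  have h2 := (hgz (c.z s y x)).comp x hz
  have h3 : HasDerivAt (fun x => c.a x * c.φ x * c.Td x) (-c.W * c.φ x - c.a x * c.Td x * c.φ' x) x := by
    have := (c.Teq x).div (c.hφ.d1 x) (hp x)
    refine (this.congr_of_eventuallyEq (Eventually.of_forall fun y => ?_)).congr_deriv ?_
    · have := hp y
      simp only [Pi.div_apply]; field_simp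
    · have := hp x
      field_simp
  have h4 := ((c.hφ.d2 x).mul h1).add (h3.mul h2)
  refine (h4.congr_of_eventuallyEq (Eventually.of_forall fun y => ?_)).congr_deriv ?_
  · simp only [Pi.add_apply, Pi.mul_apply, Function.comp]; ring
  · simp only [Function.comp]; ring

noncomputable def tpw (h : c.N ψ ψ' k) (G : ℝ → ℝ → ℝ) (y ε : ℝ) (s : ℝ) (p : ℝ × ℝ) : ℝ :=
  c.φ p.1 * h.S s p.2 - h.S s p.1 * (c.φ p.2 * G s (c.z s y p.2)) + ε * Real.exp (c.ΛE * s) * c.Ef p.1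

theorem tp_neg (h : c.N ψ ψ' k) (hψ : ∀ x, 0 ≤ ψ x) {B t zc z2 R y ε σ : ℝ} {G Gs Gz Gzz : ℝ → ℝ → ℝ}
    (hB : Barrier (c.τ0 ^ 2 / c.μ) (c.μ * c.τ1 ^ 2) B t zc z2 G Gs Gz Gzz R) (hε : 0 < ε)
    {s : ℝ} (hs : 0 < s) (p : ℝ × ℝ) (hp : 0 < σ * (p.1 - p.2)) (hneg : tpw h G y ε s p < 0)
    (hmin : ∀ q : ℝ × ℝ, 0 ≤ σ * (q.1 - q.2) → tpw h G y ε s p ≤ tpw h G y ε s q) :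
    ∃ d, HasDerivAt (fun τ => tpw h G y ε τ p) d s ∧ (2 * c.μ + |c.γ|) * tpw h G y ε s p ≤ d := by
  obtain ⟨x1, x2⟩ := p
  obtain ⟨Q1, hQ1, hs1⟩ := h.S_pde hs x1
  obtain ⟨Q2, hQ2, hs2⟩ := h.S_pde hs x2
  have hg := hB.dz s hs.le
  have hgz := hB.dzz s hs.le
  simp only at hp
  -- minimum in the first variable
  have hD1 : 0 ≤ (c.γ - c.r x1) * c.φ x1 * h.S s x2 - Q1 * (c.φ x2 * G s (c.z s y x2)) +
      ε * Real.exp (c.ΛE * s) * (c.kE ^ 2 / c.a x1 * c.Ef x1) := by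
    refine second_deriv_nonneg (a := c.a) (F := fun x => tpw h G y ε s (x, x2))
      (F' := fun x => c.φ' x * h.S s x2 - h.Sx s x * (c.φ x2 * G s (c.z s y x2)) + ε * Real.exp (c.ΛE * s) * c.Ef' x) (x := x1) c.apos ?_ ?_ ?_
    · refine Eventually.of_forall fun x => ?_
      exact (((c.hφ.d1 x).mul_const (h.S s x2)).sub ((h.S_d1 s x).mul_const (c.φ x2 * G s (c.z s y x2)))).add ((c.Ef_d1 x).const_mul (ε * Real.exp (c.ΛE * s)))
    · have := (((c.hφ.d2 x1).mul_const (h.S s x2)).sub (hQ1.mul_const (c.φ x2 * G s (c.z s y x2)))).add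
        ((c.Ef_d2 x1).const_mul (ε * Real.exp (c.ΛE * s)))
      refine this.congr_of_eventuallyEq (Eventually.of_forall fun x => ?_)
      simp only [Pi.add_apply, Pi.sub_apply]; ring
    · have : ∀ᶠ x in nhds x1, 0 < σ * (x - x2) :=
        (continuousAt_const.mul (continuousAt_id.sub continuousAt_const)).eventually (lt_mem_nhds hp)
      filter_upwards [this] with x hx
      exact hmin (x, x2) hx.le
  have hD2 : 0 ≤ c.φ x1 * Q2 - h.S s x1 * (c.φ x2 * ((c.γ - c.r x2) * G s (c.z s y x2) + c.a x2 * c.Td x2 ^ 2 * Gzz s (c.z s y x2) - c.W * Gz s (c.z s y x2))) := by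
    refine second_deriv_nonneg (a := c.a) (F := fun x => tpw h G y ε s (x1, x))
      (F' := fun x => c.φ x1 * h.Sx s x - h.S s x1 * (c.φ' x * G s (c.z s y x) + c.φ x * (Gz s (c.z s y x) * c.Td x))) (x := x2) c.apos ?_ ?_ ?_
    · refine Eventually.of_forall fun x => ?_
      exact (((h.S_d1 s x).const_mul (c.φ x1)).sub ((c.phiG_d1 hg s y x).const_mul (h.S s x1))).add_const (ε * Real.exp (c.ΛE * s) * c.Ef x1)
    · have := (hQ2.const_mul (c.φ x1)).sub ((c.phiG_d2 hg hgz s y x2).const_mul (h.S s x1))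
      refine this.congr_of_eventuallyEq (Eventually.of_forall fun x => ?_)
      simp only [Pi.sub_apply]; ring
    · have : ∀ᶠ x in nhds x2, 0 < σ * (x1 - x) :=
        (continuousAt_const.mul (continuousAt_const.sub continuousAt_id)).eventually (lt_mem_nhds hp)
      filter_upwards [this] with x hx
      exact hmin (x1, x) hx.le
  have hu1 := h.S_nonneg hψ hs.le x1
  have hα := c.alpha_bound x2
  have hin := hB.ineq s hs.le (c.z s y x2) _ hα.1 hα.2
  have hgs : HasDerivAt (fun τ => G τ (c.z τ y x2)) (Gs s (c.z s y x2) - c.W * Gz s (c.z s y x2)) s := by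
    have hz : HasDerivAt (fun τ => c.z τ y x2) (-c.W) s := by
      refine (((hasDerivAt_id s).const_mul c.W).const_sub (c.T x2 - c.T y)).congr_deriv (by ring)
    exact (hB.tot s hs.le _ _ hz).congr_deriv (by ring)
  have hd := (((hs2.const_mul (c.φ x1)).sub (hs1.mul (hgs.const_mul (c.φ x2)))).add
    (((((hasDerivAt_id s).const_mul c.ΛE).exp).const_mul ε).mul_const (c.Ef x1)))
  refine ⟨_, hd, ?_⟩
  simp only [tpw, id] at hneg ⊢
  have hφ2 := c.hφ.pos x2
  have hEf := c.Ef_one x1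
  have hEa := c.Ef_a x1
  have hr1 := abs_le.mp (c.hr x1)
  have hr2 := abs_le.mp (c.hr x2)
  have hγ1 := le_abs_self c.γ
  have hγ2 := neg_le_abs c.γ
  set p := ε * Real.exp (c.ΛE * s) * c.Ef x1 with hpdef
  have hp0 : 0 < p := by rw [hpdef]; have := Real.exp_pos (c.ΛE * s); positivity
  set w := c.φ x1 * h.S s x2 - h.S s x1 * (c.φ x2 * G s (c.z s y x2)) + p with hw
  have k1 : 0 ≤ h.S s x1 * c.φ x2 * (c.a x2 * c.Td x2 ^ 2 * Gzz s (c.z s y x2) - Gs s (c.z s y x2)) :=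
    mul_nonneg (mul_nonneg hu1 hφ2.le) (by linarith)
  have k2 : 0 ≤ p * (c.ΛE - c.kE ^ 2 / c.a x1 - (c.r x1 + c.r x2 - c.γ)) := by
    refine mul_nonneg hp0.le ?_
    unfold ΛE
    linarith
  have k3 : (2 * c.μ + |c.γ|) * w ≤ (c.r x1 + c.r x2 - c.γ) * w :=
    mul_le_mul_of_nonpos_right (by linarith) hneg.le
  refine k3.trans (le_of_sub_nonneg ?_)
  rw [hw]
  rw [hpdef] at k2 ⊢
  refine (add_nonneg (add_nonneg hD1 hD2) (add_nonneg k1 k2)).trans_eq ?_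
  ring
end Ctx

/-! ### Part 21 -/
namespace Ctx
variable {c : Ctx} {ψ ψ' k : ℝ → ℝ}

theorem tpw_cont (h : c.N ψ ψ' k) {B t zc z2 R y ε : ℝ} {G Gs Gz Gzz : ℝ → ℝ → ℝ}
    (hB : Barrier (c.τ0 ^ 2 / c.μ) (c.μ * c.τ1 ^ 2) B t zc z2 G Gs Gz Gzz R) :
    ContinuousOn (fun p : ℝ × ℝ × ℝ => tpw h G y ε p.1 p.2) (Set.Ici 0 ×ˢ Set.univ) := by
  have h1 := h.S_cont
  have h2 := c.φc
  have h3 := c.Ef_cont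
  have h4 := c.Tc
  have e1 : Continuous fun p : ℝ × ℝ × ℝ => h.S p.1 p.2.1 :=
    h1.comp (continuous_fst.prodMk (continuous_fst.comp continuous_snd))
  have e2 : Continuous fun p : ℝ × ℝ × ℝ => h.S p.1 p.2.2 :=
    h1.comp (continuous_fst.prodMk (continuous_snd.comp continuous_snd))
  have e3 : Continuous fun p : ℝ × ℝ × ℝ => (p.1, c.z p.1 y p.2.2) := by
    unfold z; fun_prop
  have e4 : ContinuousOn (fun p : ℝ × ℝ × ℝ => G p.1 (c.z p.1 y p.2.2)) (Set.Ici 0 ×ˢ Set.univ) :=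
    hB.cont.comp e3.continuousOn (fun p hp => ⟨hp.1, trivial⟩)
  unfold tpw
  refine ContinuousOn.add (ContinuousOn.sub ?_ (e1.continuousOn.mul (ContinuousOn.mul ?_ e4))) ?_
  · exact ((h2.comp (continuous_fst.comp continuous_snd)).mul e2).continuousOn
  · exact (h2.comp (continuous_snd.comp continuous_snd)).continuousOn
  · refine Continuous.continuousOn ?_
    exact (continuous_const.mul (by fun_prop)).mul (h3.comp (continuous_fst.comp continuous_snd))

theorem N.TP (h : c.N ψ ψ' k) (hψ : ∀ x, 0 ≤ ψ x) {t : ℝ} (ht : 0 < t) {y : ℝ}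
    (hs : ∀ x, ψ x ≠ 0 → |c.T x - c.T y| ≤ Real.sqrt t / 2) {σ : ℝ} (hσ : σ = 1 ∨ σ = -1)
    {zc : ℝ} (hzc : Real.sqrt t ≤ σ * zc) {x1 x2 : ℝ} (h12 : 0 ≤ σ * (x1 - x2)) :
    h.S t x1 * c.φ x2 * Real.exp (-(c.tB * (1 + (c.z t y x2 - zc) ^ 2 / t))) ≤ c.φ x1 * h.S t x2 := by
  obtain ⟨G, Gs, Gz, Gzz, R, hB⟩ := c.tB_spec t ht zc (c.z t y x2)
  have hφ := c.hφ.pos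
  have hS := fun s (hs : 0 ≤ s) x => h.S_nonneg hψ hs x
  have hΛ := c.ΛE_nonneg
  have hτ := c.τ00
  have key : ∀ ε : ℝ, 0 < ε → 0 ≤ tpw h G y ε t (x1, x2) := by
    intro ε hε
    have hmain := abs_max_principle {p : ℝ × ℝ | 0 ≤ σ * (p.1 - p.2)} (tpw h G y ε) t (2 * c.μ + |c.γ|) ht.le
      ?_ ?_ ?_ ?_
    · exact hmain t ⟨ht.le, le_rfl⟩ (x1, x2) h12
    · refine ContinuousOn.lowerSemicontinuousOn ?_
      exact (tpw_cont h hB).mono (Set.prod_mono (fun s hs => hs.1) (Set.subset_univ _))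
    · rintro ⟨p1, p2⟩ hp
      have hp : 0 ≤ σ * (p1 - p2) := hp
      simp only [tpw, h.S_zero]
      have e1 : 0 ≤ c.φ p1 * ψ p2 := mul_nonneg (hφ _).le (hψ _)
      have e2 : 0 ≤ ε * Real.exp (c.ΛE * 0) * c.Ef p1 :=
        mul_nonneg (by positivity) (by linarith [c.Ef_one p1])
      have e3 : ψ p1 * (c.φ p2 * G 0 (c.z 0 y p2)) ≤ 0 := by
        by_cases hz : ψ p1 = 0
        · simp [hz]
        · have h1 := hs p1 hz
          refine mul_nonpos_of_nonneg_of_nonpos (hψ _) (mul_nonpos_of_nonneg_of_nonpos (hφ _).le ?_)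
          apply hB.initv
          by_contra hlt
          push Not at hlt
          have h2 := abs_lt.mp hlt
          have h3 := abs_le.mp h1
          have h4 : c.z 0 y p2 = c.T p2 - c.T y := by simp [z]
          rw [h4] at h2
          rcases hσ with rfl | rfl
          · have := c.T_mono (show p2 ≤ p1 by linarith)
            linarith
          · have := c.T_mono (show p1 ≤ p2 by linarith)
            linarith
      linarith
    · -- compactness
      obtain ⟨M, hM0, hM⟩ := h.S_bdd t
      set L2 := (|R| + c.W * t + |zc|) / c.τ0 with hL2
      obtain ⟨A, hA⟩ := (isCompact_Icc (a := y - L2) (b := y + L2)).bddAbove_image c.φc.continuousOn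
      obtain ⟨L1, hL10, hL1⟩ := c.Ef_coer (M * |A| / ε)
      refine ⟨{p : ℝ × ℝ | 0 ≤ σ * (p.1 - p.2)} ∩ (Set.Icc (-L1) L1 ×ˢ Set.Icc (y - L2) (y + L2)), ?_,
        Set.inter_subset_left, ?_⟩
      · refine (isCompact_Icc.prod isCompact_Icc).inter_left ?_
        exact isClosed_le continuous_const (by fun_prop)
      · rintro s ⟨hs0, hst⟩ ⟨p1, p2⟩ hp hnot
        simp only [tpw]
        have e1 : 0 ≤ c.φ p1 * h.S s p2 := mul_nonneg (hφ _).le (hS s hs0 _)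
        have hexp : 1 ≤ Real.exp (c.ΛE * s) := Real.one_le_exp (by positivity)
        have e2 : 0 ≤ ε * Real.exp (c.ΛE * s) * c.Ef p1 :=
          mul_nonneg (by positivity) (by linarith [c.Ef_one p1])
        by_cases hG : G s (c.z s y p2) ≤ 0
        · have : h.S s p1 * (c.φ p2 * G s (c.z s y p2)) ≤ 0 :=
            mul_nonpos_of_nonneg_of_nonpos (hS s hs0 _) (mul_nonpos_of_nonneg_of_nonpos (hφ _).le hG)
          linarith
        · push Not at hG
          have h1 : |c.z s y p2 - zc| < R := by
            by_contra hlt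
            push Not at hlt
            linarith [hB.far s hs0 hst _ hlt]
          have h2 : |p2 - y| ≤ L2 := by
            rw [hL2, le_div_iff₀ hτ, mul_comm]
            refine (c.T_lip p2 y).trans ?_
            have h3 : c.T p2 - c.T y = (c.z s y p2 - zc) + (c.W * s + zc) := by unfold z; ring
            rw [h3]
            have h4 : c.W * s ≤ c.W * t := by have := c.W0; gcongr
            have h5 : 0 ≤ c.W * s := mul_nonneg c.W0.le hs0
            refine (abs_add_le _ _).trans ?_
            have := abs_add_le (c.W * s) zc
            rw [abs_of_nonneg h5] at this
            linarith [le_abs_self R]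
          have h3 := abs_le.mp h2
          have h4 : p2 ∈ Set.Icc (y - L2) (y + L2) := ⟨by linarith, by linarith⟩
          have h5 : L1 < |p1| := by
            by_contra hlt
            push Not at hlt
            have h6 := abs_le.mp hlt
            exact hnot ⟨hp, ⟨h6.1, h6.2⟩, h4⟩
          have h6 := hL1 p1 h5
          have h7 : c.φ p2 ≤ |A| := (hA (Set.mem_image_of_mem _ h4)).trans (le_abs_self _)
          have h8 : h.S s p1 ≤ M := (le_abs_self _).trans (hM s ⟨hs0, hst⟩ p1)
          have h9 := hB.le1 s hs0 (c.z s y p2)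
          have h10 : h.S s p1 * (c.φ p2 * G s (c.z s y p2)) ≤ M * (|A| * 1) := by
            have := hS s hs0 p1
            have := (hφ p2).le
            gcongr
          have h11 : M * |A| ≤ ε * 1 * c.Ef p1 := by
            rw [div_le_iff₀ hε] at h6; linarith
          have h12 : ε * 1 * c.Ef p1 ≤ ε * Real.exp (c.ΛE * s) * c.Ef p1 := by
            have := c.Ef_one p1
            gcongr
          linarith
    · rintro s hs0 hst ⟨p1, p2⟩ hp hneg hmin
      have hp : 0 ≤ σ * (p1 - p2) := hp
      have hp' : 0 < σ * (p1 - p2) := by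
        refine lt_of_le_of_ne hp fun h0 => ?_
        have : p1 = p2 := by rcases hσ with rfl | rfl <;> linarith
        subst this
        refine absurd hneg (not_lt.mpr ?_)
        simp only [tpw]
        have e2 : 0 ≤ ε * Real.exp (c.ΛE * s) * c.Ef p1 :=
          mul_nonneg (by positivity) (by linarith [c.Ef_one p1])
        have h9 := hB.le1 s hs0.le (c.z s y p1)
        have e3 : 0 ≤ h.S s p1 * c.φ p1 * (1 - G s (c.z s y p1)) :=
          mul_nonneg (mul_nonneg (hS s hs0.le _) (hφ _).le) (by linarith)
        linarith
      exact tp_neg h hψ hB hε hs0 (p1, p2) hp' hneg (fun q hq => hmin q hq)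
  have hlim : h.S t x1 * (c.φ x2 * G t (c.z t y x2)) ≤ c.φ x1 * h.S t x2 := by
    refine le_of_forall_pos_le_add fun δ hδ => ?_
    have hE := c.Ef_one x1
    have hpz : 0 < Real.exp (c.ΛE * t) * c.Ef x1 := mul_pos (Real.exp_pos _) (by linarith)
    have := key (δ / (Real.exp (c.ΛE * t) * c.Ef x1)) (by positivity)
    simp only [tpw] at this
    rw [mul_assoc (δ / _), div_mul_cancel₀ _ hpz.ne'] at this
    linarith
  refine le_trans ?_ hlim
  rw [mul_assoc]
  have := hS t ht.le x1
  have := (hφ x2).le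
  have := hB.low
  gcongr
end Ctx

/-! ### Part 22 -/
namespace Ctx
variable {c : Ctx} {ψ ψ' k : ℝ → ℝ}

theorem At_one (c : Ctx) : 1 ≤ c.At := by
  have := c.Cd_nonneg; have := c.A0_nonneg; have := c.C0_nonneg
  have : 0 ≤ c.Cd + (1 + c.Cd) ^ 2 * c.A0 + (1 + c.Cd) * c.C0 := by positivity
  unfold At; linarith

theorem N.TPa (h : c.N ψ ψ' k) (hψ : ∀ x, 0 ≤ ψ x) {t : ℝ} (ht : 0 < t) {y : ℝ}
    (hs : ∀ x, ψ x ≠ 0 → |c.T x - c.T y| ≤ Real.sqrt t / 2) {σ : ℝ} (hσ : σ = 1 ∨ σ = -1)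
    {x1 x2 : ℝ} (h12 : 0 ≤ σ * (x1 - x2)) (hz : -Real.sqrt t ≤ σ * c.z t y x2) :
    h.S t x1 * c.φ x2 * Real.exp (-(5 * c.tB)) ≤ c.φ x1 * h.S t x2 := by
  have hq : 0 < Real.sqrt t := Real.sqrt_pos.mpr ht
  have hqq : Real.sqrt t * Real.sqrt t = t := Real.mul_self_sqrt ht.le
  have hσ2 : σ * σ = 1 := by rcases hσ with rfl | rfl <;> norm_num
  set zc := σ * max (σ * c.z t y x2) (Real.sqrt t) with hzc
  have h1 : σ * zc = max (σ * c.z t y x2) (Real.sqrt t) := by rw [hzc, ← mul_assoc, hσ2, one_mul]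
  have := h.TP hψ ht hs hσ (zc := zc) (by rw [h1]; exact le_max_right _ _) h12
  refine le_trans ?_ this
  have h2 : (c.z t y x2 - zc) ^ 2 ≤ 4 * t := by
    have e1 : (c.z t y x2 - zc) ^ 2 = (σ * zc - σ * c.z t y x2) ^ 2 := by
      have : (σ * zc - σ * c.z t y x2) ^ 2 = (σ * σ) * (c.z t y x2 - zc) ^ 2 := by ring
      rw [this, hσ2, one_mul]
    rw [e1, h1]
    have e2 : 0 ≤ max (σ * c.z t y x2) (Real.sqrt t) - σ * c.z t y x2 := by
      linarith [le_max_left (σ * c.z t y x2) (Real.sqrt t)]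
    have e3 : max (σ * c.z t y x2) (Real.sqrt t) - σ * c.z t y x2 ≤ 2 * Real.sqrt t := by
      rw [sub_le_iff_le_add]
      exact max_le (by linarith) (by linarith)
    nlinarith
  have h3 : (c.z t y x2 - zc) ^ 2 / t ≤ 4 := by rw [div_le_iff₀ ht]; linarith
  have := h.S_nonneg hψ ht.le x1
  have := (c.hφ.pos x2).le
  have hB := c.tB_pos
  have : c.tB * (1 + (c.z t y x2 - zc) ^ 2 / t) ≤ 5 * c.tB := by nlinarith
  gcongr

theorem N.TPb (h : c.N ψ ψ' k) (hψ : ∀ x, 0 ≤ ψ x) {t : ℝ} (ht : 0 < t) {y : ℝ}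
    (hs : ∀ x, ψ x ≠ 0 → |c.T x - c.T y| ≤ Real.sqrt t / 2) (x1 x2 : ℝ) :
    h.S t x1 * c.φ x2 * Real.exp (-(c.tB * (3 + 2 * (c.z t y x2 ^ 2 / t)))) ≤ c.φ x1 * h.S t x2 := by
  have hq : 0 < Real.sqrt t := Real.sqrt_pos.mpr ht
  have hqq : Real.sqrt t * Real.sqrt t = t := Real.mul_self_sqrt ht.le
  obtain ⟨σ, hσ, h12⟩ : ∃ σ : ℝ, (σ = 1 ∨ σ = -1) ∧ 0 ≤ σ * (x1 - x2) := by
    rcases le_total x2 x1 with h | h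
    · exact ⟨1, Or.inl rfl, by linarith⟩
    · exact ⟨-1, Or.inr rfl, by linarith⟩
  have hσ2 : σ * σ = 1 := by rcases hσ with rfl | rfl <;> norm_num
  have := h.TP hψ ht hs hσ (zc := σ * Real.sqrt t) (by rw [← mul_assoc, hσ2, one_mul]) h12
  refine le_trans ?_ this
  have h2 : (c.z t y x2 - σ * Real.sqrt t) ^ 2 ≤ 2 * t + 2 * c.z t y x2 ^ 2 := by
    have : (σ * Real.sqrt t) ^ 2 = t := by rw [mul_pow, sq, sq, hσ2, hqq, one_mul]
    nlinarith [sq_nonneg (c.z t y x2 + σ * Real.sqrt t)]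
  have h3 : (c.z t y x2 - σ * Real.sqrt t) ^ 2 / t ≤ 2 + 2 * (c.z t y x2 ^ 2 / t) := by
    rw [div_le_iff₀ ht, add_mul, mul_assoc, div_mul_cancel₀ _ ht.ne']; linarith
  have := h.S_nonneg hψ ht.le x1
  have := (c.hφ.pos x2).le
  have hB := c.tB_pos
  have : c.tB * (1 + (c.z t y x2 - σ * Real.sqrt t) ^ 2 / t) ≤ c.tB * (3 + 2 * (c.z t y x2 ^ 2 / t)) :=
    mul_le_mul_of_nonneg_left (by linarith) hB.le
  gcongr

noncomputable def CU (c : Ctx) : ℝ := c.τ1 / c.m0 * Real.exp (5 * c.tB + c.At + 1)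
noncomputable def DU (c : Ctx) : ℝ := 8 * c.At
noncomputable def KL (c : Ctx) : ℝ := 2 * c.At + Real.log 2
noncomputable def cL (c : Ctx) : ℝ := c.τ0 * Real.exp (-(3 * c.tB)) / (8 * c.KL * c.m1)

theorem N.upper_aux (h : c.N ψ ψ' k) (hψ : ∀ x, 0 ≤ ψ x) {t : ℝ} (ht : 0 < t) {y : ℝ}
    (hs : ∀ x, ψ x ≠ 0 → |c.T x - c.T y| ≤ Real.sqrt t / 2) {x0 α : ℝ}
    (hJ : ∀ x ∈ Set.Icc α (α + Real.sqrt t / c.τ1), h.S t x0 * c.φ x * Real.exp (-(5 * c.tB)) ≤ c.φ x0 * h.S t x ∧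
      |c.z t y x0| - Real.sqrt t ≤ |c.z t y x|) :
    h.S t x0 ≤ c.CU / Real.sqrt t * c.φ x0 * Real.exp (-(c.z t y x0 ^ 2) / (c.DU * t) + c.γ * t) * ∫ x, c.φt x * ψ x := by
  have hq : 0 < Real.sqrt t := Real.sqrt_pos.mpr ht
  have hqq : Real.sqrt t * Real.sqrt t = t := Real.mul_self_sqrt ht.le
  have hA := c.At_one
  have hτ := c.τ10
  have hm := c.m00
  have hφ0 := c.hφ.pos x0
  set ζ := |c.z t y x0| / Real.sqrt t with hζ
  have hζ0 : 0 ≤ ζ := by positivity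
  set l := ζ / (2 * c.At) with hl
  have hl0 : 0 ≤ l := by positivity
  obtain ⟨hi, hle⟩ := h.tail hψ ht hs hl0
  set M0 := ∫ x, c.φt x * ψ x with hM0
  have hM00 : 0 ≤ M0 := integral_nonneg fun x => mul_nonneg (c.hφt.pos x).le (hψ x)
  have hS0 := h.S_nonneg hψ ht.le x0
  set V := c.m0 * (h.S t x0 / c.φ x0) * Real.exp (-(5 * c.tB)) * Real.exp (l * ζ - l) with hV
  have h1 : V * (Real.sqrt t / c.τ1) ≤ ∫ x, c.φt x * h.S t x * Real.exp (l * |c.z t y x| / Real.sqrt t) := by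
    have e0 : ∫ x in Set.Icc α (α + Real.sqrt t / c.τ1), V = V * (Real.sqrt t / c.τ1) := by
      rw [setIntegral_const, Measure.real, Real.volume_Icc, add_sub_cancel_left, ENNReal.toReal_ofReal (by positivity), smul_eq_mul, mul_comm]
    rw [← e0]
    refine (setIntegral_mono_on (integrableOn_const (by simp)) hi.integrableOn measurableSet_Icc ?_).trans
      (setIntegral_le_integral hi (Eventually.of_forall fun x => ?_))
    · intro x hx
      obtain ⟨k1, k2⟩ := hJ x hx
      rw [hV]
      have k3 : l * ζ - l ≤ l * |c.z t y x| / Real.sqrt t := by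
        rw [le_div_iff₀ hq, hζ]
        have : (l * (|c.z t y x0| / Real.sqrt t) - l) * Real.sqrt t = l * (|c.z t y x0| - Real.sqrt t) := by
          field_simp
        rw [this]; gcongr
      have k4 : c.m0 * (h.S t x0 / c.φ x0) * Real.exp (-(5 * c.tB)) ≤ c.φt x * h.S t x := by
        calc c.m0 * (h.S t x0 / c.φ x0) * Real.exp (-(5 * c.tB))
            ≤ (c.φ x * c.φt x) * (h.S t x0 / c.φ x0) * Real.exp (-(5 * c.tB)) := by
              have := c.mlow x
              gcongr
          _ = c.φt x * ((h.S t x0 * c.φ x * Real.exp (-(5 * c.tB))) / c.φ x0) := by ring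
          _ ≤ c.φt x * h.S t x := by
              refine mul_le_mul_of_nonneg_left ?_ (c.hφt.pos x).le
              rw [div_le_iff₀ hφ0]; linarith
      have k5 : 0 ≤ c.φt x * h.S t x := mul_nonneg (c.hφt.pos x).le (h.S_nonneg hψ ht.le x)
      gcongr
    · exact mul_nonneg (mul_nonneg (c.hφt.pos x).le (h.S_nonneg hψ ht.le x)) (Real.exp_pos _).le
  have h2 := h1.trans hle
  have h3 : h.S t x0 = V * (Real.sqrt t / c.τ1) * (c.τ1 / (c.m0 * Real.sqrt t) * c.φ x0 * Real.exp (5 * c.tB - l * ζ + l)) := by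
    have e1 : Real.exp (-(5 * c.tB)) * Real.exp (l * ζ - l) * Real.exp (5 * c.tB - l * ζ + l) = 1 := by
      rw [← Real.exp_add, ← Real.exp_add, Real.exp_eq_one_iff]; ring
    calc h.S t x0 = h.S t x0 * 1 := (mul_one _).symm
      _ = h.S t x0 * (Real.exp (-(5 * c.tB)) * Real.exp (l * ζ - l) * Real.exp (5 * c.tB - l * ζ + l)) := by rw [e1]
      _ = _ := by rw [hV]; field_simp
  rw [h3]
  have h4 : Real.exp (c.γ * t + c.At * (1 + l ^ 2)) * Real.exp (5 * c.tB - l * ζ + l) ≤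
      Real.exp (5 * c.tB + c.At + 1) * Real.exp (-(c.z t y x0 ^ 2) / (c.DU * t) + c.γ * t) := by
    rw [← Real.exp_add, ← Real.exp_add]
    apply Real.exp_le_exp.mpr
    have e1 : c.z t y x0 ^ 2 / (c.DU * t) = ζ ^ 2 / (8 * c.At) := by
      rw [hζ, div_pow, sq_abs, DU, sq (Real.sqrt t), hqq]
      field_simp
    rw [neg_div, e1]
    have e2 : ζ = l * (2 * c.At) := by rw [hl]; field_simp
    have e3 : ζ ^ 2 / (8 * c.At) = c.At * l ^ 2 / 2 := by
      rw [e2]; field_simp; ring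
    rw [e3]
    have e4 : l * ζ = 2 * (c.At * l ^ 2) := by rw [e2]; ring
    rw [e4]
    have : l ^ 2 ≤ c.At * l ^ 2 := le_mul_of_one_le_left (sq_nonneg _) hA
    nlinarith [sq_nonneg (l - 1)]
  have h5 : 0 ≤ c.τ1 / (c.m0 * Real.sqrt t) * c.φ x0 := by positivity
  calc V * (Real.sqrt t / c.τ1) * (c.τ1 / (c.m0 * Real.sqrt t) * c.φ x0 * Real.exp (5 * c.tB - l * ζ + l))
      ≤ (Real.exp (c.γ * t + c.At * (1 + l ^ 2)) * M0) * (c.τ1 / (c.m0 * Real.sqrt t) * c.φ x0 * Real.exp (5 * c.tB - l * ζ + l)) := by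
        refine mul_le_mul_of_nonneg_right h2 ?_
        positivity
    _ = (Real.exp (c.γ * t + c.At * (1 + l ^ 2)) * Real.exp (5 * c.tB - l * ζ + l)) * (M0 * (c.τ1 / (c.m0 * Real.sqrt t) * c.φ x0)) := by ring
    _ ≤ (Real.exp (5 * c.tB + c.At + 1) * Real.exp (-(c.z t y x0 ^ 2) / (c.DU * t) + c.γ * t)) * (M0 * (c.τ1 / (c.m0 * Real.sqrt t) * c.φ x0)) :=
        mul_le_mul_of_nonneg_right h4 (by positivity)
    _ = _ := by rw [CU]; field_simp

theorem N.upper (h : c.N ψ ψ' k) (hψ : ∀ x, 0 ≤ ψ x) {t : ℝ} (ht : 0 < t) {y : ℝ}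
    (hs : ∀ x, ψ x ≠ 0 → |c.T x - c.T y| ≤ Real.sqrt t / 2) (x0 : ℝ) :
    h.S t x0 ≤ c.CU / Real.sqrt t * c.φ x0 * Real.exp (-(c.z t y x0 ^ 2) / (c.DU * t) + c.γ * t) * ∫ x, c.φt x * ψ x := by
  have hτ := c.τ10
  have hq : 0 < Real.sqrt t := Real.sqrt_pos.mpr ht
  have hδ : c.τ1 * (Real.sqrt t / c.τ1) = Real.sqrt t := by field_simp
  have hzd : ∀ x, c.z t y x0 - c.z t y x = c.T x0 - c.T x := fun x => by unfold z; ring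
  rcases le_total 0 (c.z t y x0) with h0 | h0
  · refine h.upper_aux hψ ht hs (α := x0 - Real.sqrt t / c.τ1) fun x hx => ?_
    have hx1 : x ≤ x0 := by linarith [hx.2]
    have h1 : |x0 - x| ≤ Real.sqrt t / c.τ1 := by rw [abs_of_nonneg (by linarith)]; linarith [hx.1]
    have h2 : |c.T x0 - c.T x| ≤ Real.sqrt t := by
      refine (c.T_lip' x0 x).trans (le_trans ?_ hδ.le)
      gcongr
    rw [← hzd] at h2
    refine ⟨h.TPa hψ ht hs (Or.inl rfl) (by linarith) ?_, ?_⟩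
    · linarith [(abs_le.mp h2).2]
    · linarith [abs_sub_abs_le_abs_sub (c.z t y x0) (c.z t y x)]
  · refine h.upper_aux hψ ht hs (α := x0) fun x hx => ?_
    have h1 : |x0 - x| ≤ Real.sqrt t / c.τ1 := by
      rw [abs_sub_comm, abs_of_nonneg (by linarith [hx.1])]; linarith [hx.2]
    have h2 : |c.T x0 - c.T x| ≤ Real.sqrt t := by
      refine (c.T_lip' x0 x).trans (le_trans ?_ hδ.le)
      gcongr
    rw [← hzd] at h2
    refine ⟨h.TPa hψ ht hs (Or.inr rfl) (by linarith [hx.1]) ?_, ?_⟩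
    · linarith [(abs_le.mp h2).1]
    · linarith [abs_sub_abs_le_abs_sub (c.z t y x0) (c.z t y x)]

theorem N.lower (h : c.N ψ ψ' k) (hψ : ∀ x, 0 ≤ ψ x) {t : ℝ} (ht : 0 < t) {y : ℝ}
    (hs : ∀ x, ψ x ≠ 0 → |c.T x - c.T y| ≤ Real.sqrt t / 2) (x0 : ℝ) :
    c.cL / Real.sqrt t * c.φ x0 * Real.exp (-(2 * c.tB * (c.z t y x0 ^ 2)) / t + c.γ * t) * ∫ x, c.φt x * ψ x ≤ h.S t x0 := by
  have hτ := c.τ00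
  have hm := c.m10
  have hq : 0 < Real.sqrt t := Real.sqrt_pos.mpr ht
  have hA := c.At_one
  have hKL : 0 < c.KL := by have := Real.log_pos (show (1:ℝ) < 2 by norm_num); unfold KL; linarith
  have hφ0 := c.hφ.pos x0
  have hS0 := h.S_nonneg hψ ht.le x0
  obtain ⟨hi, hle⟩ := h.tail hψ ht hs (l := 1) (by norm_num)
  obtain ⟨hi0, he0⟩ := h.S_mass hψ ht.le
  set M0 := ∫ x, c.φt x * ψ x with hM0
  set Q := c.m1 * (h.S t x0 / c.φ x0 * Real.exp (c.tB * (3 + 2 * (c.z t y x0 ^ 2 / t)))) with hQ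
  have hQ0 : 0 ≤ Q := by positivity
  obtain ⟨p, hp⟩ : ∃ p, ∀ x, |c.z t y x| ≤ c.KL * Real.sqrt t → |x - p| ≤ 2 * c.KL * Real.sqrt t / c.τ0 := by
    by_cases hex : ∃ p, |c.z t y p| ≤ c.KL * Real.sqrt t
    · obtain ⟨p, hp⟩ := hex
      refine ⟨p, fun x hx => ?_⟩
      rw [le_div_iff₀ hτ, mul_comm]
      refine (c.T_lip x p).trans ?_
      have : c.T x - c.T p = c.z t y x - c.z t y p := by unfold z; ring
      rw [this]
      refine (abs_sub _ _).trans ?_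
      linarith
    · push Not at hex
      exact ⟨0, fun x hx => absurd hx (not_le.mpr (hex x))⟩
  set ℓ := 2 * c.KL * Real.sqrt t / c.τ0 with hℓ
  have hℓ0 : 0 ≤ ℓ := by positivity
  have hpt : ∀ x, c.φt x * h.S t x ≤ (Set.Icc (p - ℓ) (p + ℓ)).indicator (fun _ => Q) x +
      Real.exp (-c.KL) * (c.φt x * h.S t x * Real.exp (1 * |c.z t y x| / Real.sqrt t)) := by
    intro x
    have hft := c.hφt.pos x
    have hSx := h.S_nonneg hψ ht.le x
    by_cases hx : |c.z t y x| ≤ c.KL * Real.sqrt t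
    · have h1 := abs_le.mp (hp x hx)
      rw [Set.indicator_of_mem (by constructor <;> linarith)]
      have h2 := h.TPb hψ ht hs x x0
      have h3 : h.S t x ≤ c.φ x * (h.S t x0 / c.φ x0 * Real.exp (c.tB * (3 + 2 * (c.z t y x0 ^ 2 / t)))) := by
        rw [Real.exp_neg] at h2
        have e := Real.exp_pos (c.tB * (3 + 2 * (c.z t y x0 ^ 2 / t)))
        rw [mul_assoc, ← div_eq_mul_inv, ← le_div_iff₀ (by positivity)] at h2
        refine h2.trans_eq ?_
        field_simp
      have h4 : c.φt x * h.S t x ≤ Q := by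
        calc c.φt x * h.S t x ≤ c.φt x * (c.φ x * (h.S t x0 / c.φ x0 * Real.exp (c.tB * (3 + 2 * (c.z t y x0 ^ 2 / t))))) := by gcongr
          _ = (c.φ x * c.φt x) * (h.S t x0 / c.φ x0 * Real.exp (c.tB * (3 + 2 * (c.z t y x0 ^ 2 / t)))) := by ring
          _ ≤ Q := by
            rw [hQ]
            have := c.mup x
            gcongr
      have : 0 ≤ Real.exp (-c.KL) * (c.φt x * h.S t x * Real.exp (1 * |c.z t y x| / Real.sqrt t)) := by positivity
      linarith
    · push Not at hx
      have h1 : 0 ≤ (Set.Icc (p - ℓ) (p + ℓ)).indicator (fun _ => Q) x := Set.indicator_nonneg (fun _ _ => hQ0) x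
      have h2 : 1 ≤ Real.exp (-c.KL) * Real.exp (1 * |c.z t y x| / Real.sqrt t) := by
        rw [← Real.exp_add]
        apply Real.one_le_exp
        rw [one_mul]
        have : c.KL ≤ |c.z t y x| / Real.sqrt t := by rw [le_div_iff₀ hq]; exact hx.le
        linarith
      have h3 : c.φt x * h.S t x * 1 ≤ c.φt x * h.S t x * (Real.exp (-c.KL) * Real.exp (1 * |c.z t y x| / Real.sqrt t)) :=
        mul_le_mul_of_nonneg_left h2 (by positivity)
      linarith
  have hintg : Integrable ((Set.Icc (p - ℓ) (p + ℓ)).indicator (fun _ => Q)) :=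
    (integrable_indicator_iff measurableSet_Icc).mpr (integrableOn_const (by simp))
  have h1 := integral_mono hi0 (hintg.add (hi.const_mul (Real.exp (-c.KL)))) hpt
  rw [integral_add' hintg (hi.const_mul _), integral_const_mul, he0, integral_indicator measurableSet_Icc, setIntegral_const,
    Measure.real, Real.volume_Icc, ENNReal.toReal_ofReal (by linarith), smul_eq_mul] at h1
  have h2 : Real.exp (-c.KL) * (∫ x, c.φt x * h.S t x * Real.exp (1 * |c.z t y x| / Real.sqrt t)) ≤ Real.exp (c.γ * t) * M0 / 2 := by
    refine (mul_le_mul_of_nonneg_left hle (Real.exp_pos _).le).trans_eq ?_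
    rw [← mul_assoc, ← Real.exp_add]
    have : -c.KL + (c.γ * t + c.At * (1 + 1 ^ 2)) = c.γ * t - Real.log 2 := by unfold KL; ring
    rw [this, Real.exp_sub, Real.exp_log (by norm_num)]; ring
  have h3 : Real.exp (c.γ * t) * M0 ≤ 4 * ℓ * Q := by linarith
  have e1 : Real.exp (-(2 * c.tB * (c.z t y x0 ^ 2)) / t + c.γ * t) = Real.exp (3 * c.tB) * (Real.exp (c.tB * (3 + 2 * (c.z t y x0 ^ 2 / t))))⁻¹ * Real.exp (c.γ * t) := by
    rw [← Real.exp_neg, ← Real.exp_add, ← Real.exp_add]; congr 1; ring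
  have e2 := Real.exp_pos (c.tB * (3 + 2 * (c.z t y x0 ^ 2 / t)))
  have e3 : Real.exp (-(3 * c.tB)) * Real.exp (3 * c.tB) = 1 := by rw [← Real.exp_add]; simp
  rw [e1]
  set Y := Real.exp (c.tB * (3 + 2 * (c.z t y x0 ^ 2 / t))) with hY
  calc c.cL / Real.sqrt t * c.φ x0 * (Real.exp (3 * c.tB) * Y⁻¹ * Real.exp (c.γ * t)) * M0
      = (c.τ0 / (8 * c.KL * c.m1 * Real.sqrt t) * c.φ x0 * Y⁻¹) * (Real.exp (c.γ * t) * M0) * (Real.exp (-(3 * c.tB)) * Real.exp (3 * c.tB)) := by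
        rw [cL]; field_simp
    _ = (c.τ0 / (8 * c.KL * c.m1 * Real.sqrt t) * c.φ x0 * Y⁻¹) * (Real.exp (c.γ * t) * M0) := by rw [e3, mul_one]
    _ ≤ (c.τ0 / (8 * c.KL * c.m1 * Real.sqrt t) * c.φ x0 * Y⁻¹) * (4 * ℓ * Q) := by
        refine mul_le_mul_of_nonneg_left h3 (by positivity)
    _ = h.S t x0 := by
        rw [hQ, hℓ]; field_simp; norm_num
end Ctx

/-! ### Part 23 -/
structure Ctx.Fund (c : Ctx) (f : ℝ → ℝ → ℝ) (y : ℝ) : Prop where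
  nn : ∀ t, 0 < t → ∀ x, 0 ≤ f t x
  cx : ∀ t, 0 < t → Continuous (f t)
  ct : ∀ t, 0 < t → ∀ x, ContinuousAt (fun τ => f τ x) t
  lsc : LowerSemicontinuousOn (fun p : ℝ × ℝ => f p.1 p.2) (Set.Ioi 0 ×ˢ Set.univ)
  sup : ∃ fx, c.Super f fx
  int : ∀ t, 0 < t → Integrable (fun x => c.φt x * f t x)
  mass : ∀ t, 0 < t → ∫ x, c.φt x * f t x = Real.exp (c.γ * t) * c.φt y
  initv : ∀ ψ : ℝ → ℝ, Continuous ψ → (∃ B : ℝ, ∀ x, |ψ x| ≤ B) →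
    Tendsto (fun t => ∫ x : ℝ, f t x * ψ x) (nhdsWithin 0 (Set.Ioi 0)) (nhds (ψ y))

namespace Ctx
variable {c : Ctx} {f : ℝ → ℝ → ℝ} {y : ℝ}

theorem Fund.shift_le (hf : c.Fund f y) {ψ ψ' k : ℝ → ℝ} (h : c.N ψ ψ' k) {s t : ℝ} (hs : 0 < s) (ht : 0 < t)
    (hle : ∀ x, ψ x ≤ f s x) (x : ℝ) : h.S t x ≤ f (s + t) x := by
  obtain ⟨fx, hfx⟩ := hf.sup
  have hsup : c.Super (fun τ x => f (s + τ) x) (fun τ x => fx (s + τ) x) := by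
    intro τ hτ x
    obtain ⟨h1, Q, d, h2, h3, h4⟩ := hfx (s + τ) (by linarith) x
    exact ⟨h1, Q, d, h2, h3.comp_const_add s τ, h4⟩
  refine h.S_le hsup ht.le ?_ ⟨0, fun σ hσ x => ?_⟩ (fun x => by simpa using hle x) x
  · have hc : Continuous fun p : ℝ × ℝ => (s + p.1, p.2) := by fun_prop
    intro p hp z hz
    have hp1 : 0 ≤ p.1 := hp.1.1
    have := hf.lsc (s + p.1, p.2) ⟨by simp only [Set.mem_Ioi]; linarith, trivial⟩ z hz
    have ht : Tendsto (fun p : ℝ × ℝ => (s + p.1, p.2)) (nhdsWithin p (Set.Icc 0 t ×ˢ Set.univ))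
        (nhdsWithin (s + p.1, p.2) (Set.Ioi 0 ×ˢ Set.univ)) := by
      refine tendsto_nhdsWithin_iff.mpr ⟨hc.continuousAt.tendsto.mono_left nhdsWithin_le_nhds, ?_⟩
      filter_upwards [self_mem_nhdsWithin] with q hq
      have : 0 ≤ q.1 := hq.1.1
      exact ⟨by simp only [Set.mem_Ioi]; linarith, trivial⟩
    exact ht.eventually this
  · have := hf.nn (s + σ) (by linarith [hσ.1]) x
    simpa using this

theorem Fund.key (hf : c.Fund f y) {t : ℝ} (ht : 0 < t) {δ : ℝ} (hδ : 0 < δ) :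
    ∀ᶠ s in nhdsWithin 0 (Set.Ioi 0), 0 < s ∧ ∃ ψ ψ' k, ∃ h : c.N ψ ψ' k, (∀ x, 0 ≤ ψ x) ∧
      (∀ x, ψ x ≠ 0 → |c.T x - c.T y| ≤ Real.sqrt t / 2) ∧ c.φt y - δ ≤ ∫ x, c.φt x * ψ x ∧
      ∫ x, c.φt x * ψ x ≤ Real.exp (c.γ * s) * c.φt y ∧ ∀ x, h.S t x ≤ f (s + t) x := by
  have hq : 0 < Real.sqrt t := Real.sqrt_pos.mpr ht
  have hτ := c.τ10
  set d := Real.sqrt t / 2 / c.τ1 with hd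
  have hd0 : 0 < d := by positivity
  set χ : ℝ → ℝ := fun x => max 0 (1 - |x - y| / d) with hχ
  have hχc : Continuous χ := by
    rw [hχ]; exact continuous_const.max (continuous_const.sub (((continuous_id.sub continuous_const).abs).div_const _))
  have hχ0 : ∀ x, 0 ≤ χ x := fun x => le_max_left _ _
  have hχ1 : ∀ x, χ x ≤ 1 := fun x => max_le zero_le_one (by have : 0 ≤ |x - y| / d := by positivity
                                                             linarith)
  have hχy : χ y = 1 := by simp [hχ]
  have hχs : ∀ x, x ∉ Set.Icc (y - d) (y + d) → χ x = 0 := by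
    intro x hx
    have : d < |x - y| := by
      by_contra hlt
      push Not at hlt
      have := abs_le.mp hlt
      exact hx ⟨by linarith, by linarith⟩
    apply max_eq_left
    have : 1 < |x - y| / d := by rw [lt_div_iff₀ hd0]; linarith
    linarith
  have hφχcs : HasCompactSupport fun x => c.φt x * χ x :=
    HasCompactSupport.intro (isCompact_Icc (a := y - d) (b := y + d)) fun x hx => by simp [hχs x hx]
  have hφχc : Continuous fun x => c.φt x * χ x := c.φtc.mul hχc
  have hlim := hf.initv _ hφχc (by
    obtain ⟨B, hB⟩ := hφχcs.exists_bound_of_continuous hφχc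
    exact ⟨B, fun x => hB x⟩)
  rw [hχy, mul_one] at hlim
  have hev := hlim.eventually (lt_mem_nhds (show c.φt y - δ / 2 < c.φt y by linarith))
  filter_upwards [hev, self_mem_nhdsWithin] with s hs1 hs0
  have hs0 : 0 < s := hs0
  refine ⟨hs0, ?_⟩
  set Iφ := ∫ x in Set.Icc (y - d) (y + d), c.φt x with hIφ
  have hIφ0 : 0 ≤ Iφ := integral_nonneg fun x => (c.hφt.pos x).le
  have hgc : Continuous fun x => f s x * χ x := (hf.cx s hs0).mul hχc
  have hgcs : HasCompactSupport fun x => f s x * χ x :=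
    HasCompactSupport.intro (isCompact_Icc (a := y - d) (b := y + d)) fun x hx => by simp [hχs x hx]
  obtain ⟨ψ, ψ', k, h, hψ⟩ := c.density (g := fun x => f s x * χ x) hgc hgcs
    (fun x => mul_nonneg (hf.nn s hs0 x) (hχ0 x)) (ε := δ / 2 / (Iφ + 1)) (by positivity)
  have hψ0 : ∀ x, x ∉ Set.Icc (y - d) (y + d) → ψ x = 0 := fun x hx => by
    have h1 := (hψ x).1
    have h2 := (hψ x).2.1
    rw [hχs x hx, mul_zero] at h2
    linarith
  have hψf : ∀ x, ψ x ≤ f s x := fun x =>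
    (hψ x).2.1.trans (mul_le_of_le_one_right (hf.nn s hs0 x) (hχ1 x))
  have hiψ : Integrable fun x => c.φt x * ψ x := by
    have := h.int_mul c.φtc
    exact this.congr (Eventually.of_forall fun x => by simp only; ring)
  have hcφ := c.φtc
  refine ⟨ψ, ψ', k, h, fun x => (hψ x).1, ?_, ?_, ?_, hf.shift_le h hs0 ht hψf⟩
  · intro x hx
    have hx : x ∈ Set.Icc (y - d) (y + d) := by
      by_contra hn; exact hx (hψ0 x hn)
    have h1 : |x - y| ≤ d := by rw [abs_le]; constructor <;> linarith [hx.1, hx.2]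
    refine (c.T_lip' x y).trans ?_
    rw [hd, le_div_iff₀ hτ] at h1
    linarith
  · have hi2 : Integrable fun x => f s x * (c.φt x * χ x) :=
      ((hf.cx s hs0).mul hφχc).integrable_of_hasCompactSupport hφχcs.mul_left
    have hi3 : Integrable ((Set.Icc (y - d) (y + d)).indicator fun x => δ / 2 / (Iφ + 1) * c.φt x) :=
      (integrable_indicator_iff measurableSet_Icc).mpr ((hcφ.continuousOn.integrableOn_Icc).const_mul _)
    have h1 := integral_mono hi2 (hiψ.add hi3) (fun x => by
      have h2 := (hψ x).2.2
      have hft := c.hφt.pos x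
      simp only [Pi.add_apply]
      by_cases hx : x ∈ Set.Icc (y - d) (y + d)
      · rw [Set.indicator_of_mem hx]
        have := mul_le_mul_of_nonneg_left h2 hft.le
        linarith
      · rw [Set.indicator_of_notMem hx, hχs x hx, hψ0 x hx]; simp)
    rw [integral_add' hiψ hi3, integral_indicator measurableSet_Icc, integral_const_mul] at h1
    have h2 : δ / 2 / (Iφ + 1) * Iφ ≤ δ / 2 := by
      rw [div_mul_eq_mul_div, div_le_iff₀ (by linarith)]
      nlinarith
    linarith
  · rw [← hf.mass s hs0]
    refine integral_mono hiψ (hf.int s hs0) fun x => ?_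
    exact mul_le_mul_of_nonneg_left (hψf x) (c.hφt.pos x).le

theorem cL_pos (c : Ctx) : 0 < c.cL := by
  have := c.τ00; have := c.m10; have := c.At_one
  have hKL : 0 < c.KL := by have := Real.log_pos (show (1:ℝ) < 2 by norm_num); unfold KL; linarith
  unfold cL; positivity
theorem CU_pos (c : Ctx) : 0 < c.CU := by
  have := c.τ10; have := c.m00
  unfold CU; positivity
theorem DU_pos (c : Ctx) : 0 < c.DU := by
  have := c.At_one
  unfold DU; positivity

theorem Fund.lower (hf : c.Fund f y) {t : ℝ} (ht : 0 < t) (x : ℝ) :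
    c.cL / Real.sqrt t * c.φ x * Real.exp (-(2 * c.tB * (c.z t y x ^ 2)) / t + c.γ * t) * c.φt y ≤ f t x := by
  have hq : 0 < Real.sqrt t := Real.sqrt_pos.mpr ht
  have hc := c.cL_pos
  have hφ := c.hφ.pos x
  set Γ := c.cL / Real.sqrt t * c.φ x * Real.exp (-(2 * c.tB * (c.z t y x ^ 2)) / t + c.γ * t) with hΓ
  have hΓ0 : 0 < Γ := by positivity
  refine le_of_forall_pos_le_add fun ε hε => ?_
  have hlim : Tendsto (fun s => f (s + t) x) (nhdsWithin 0 (Set.Ioi 0)) (nhds (f t x)) := by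
    have h1 := hf.ct t ht x
    have h2 : Tendsto (fun s : ℝ => s + t) (nhdsWithin 0 (Set.Ioi 0)) (nhds t) := by
      have : Continuous fun s : ℝ => s + t := by fun_prop
      have := this.tendsto 0
      rw [zero_add] at this
      exact this.mono_left nhdsWithin_le_nhds
    exact h1.tendsto.comp h2
  have := ge_of_tendsto hlim (b := Γ * (c.φt y - ε / Γ)) (by
    filter_upwards [hf.key ht (δ := ε / Γ) (by positivity)] with s hs
    obtain ⟨hs0, ψ, ψ', k, h, h1, h2, h3, h4, h5⟩ := hs
    refine le_trans ?_ ((h.lower h1 ht h2 x).trans (h5 x))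
    exact mul_le_mul_of_nonneg_left h3 hΓ0.le)
  rw [mul_sub, mul_div_cancel₀ _ hΓ0.ne'] at this
  linarith

theorem Fund.upper (hf : c.Fund f y) {t : ℝ} (ht : 0 < t) (x : ℝ) :
    f t x ≤ c.CU / Real.sqrt t * c.φ x * Real.exp (-(c.z t y x ^ 2) / (c.DU * t) + c.γ * t) * c.φt y := by
  have hq : 0 < Real.sqrt t := Real.sqrt_pos.mpr ht
  have hCU := c.CU_pos
  set Γ : ℝ → ℝ := fun x => c.CU / Real.sqrt t * c.φ x * Real.exp (-(c.z t y x ^ 2) / (c.DU * t) + c.γ * t) with hΓ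
  have hΓ0 : ∀ x, 0 < Γ x := fun x => by
    have := c.hφ.pos x
    simp only [hΓ]; positivity
  have hΓc : Continuous Γ := by
    have := c.φc; have := c.Tc
    simp only [hΓ, z]
    fun_prop
  have hft := c.hφt.pos
  by_contra hcon
  push Not at hcon
  have hcon : Γ x * c.φt y < f t x := hcon
  obtain ⟨η, hη0, hη⟩ : ∃ η : ℝ, 0 < η ∧ Γ x * (c.φt y + 2 * η) < f t x := by
    have hp := hΓ0 x
    refine ⟨(f t x - Γ x * c.φt y) / (4 * Γ x), div_pos (by linarith) (by positivity), ?_⟩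
    have : Γ x * (c.φt y + 2 * ((f t x - Γ x * c.φt y) / (4 * Γ x))) = Γ x * c.φt y + (f t x - Γ x * c.φt y) / 2 := by
      field_simp; ring
    rw [this]; linarith
  have hev : ∀ᶠ q : ℝ × ℝ in nhds (t, x), Γ q.2 * (c.φt y + 2 * η) < f q.1 q.2 := by
    have hl : LowerSemicontinuousOn (fun p : ℝ × ℝ => f p.1 p.2 + -(Γ p.2 * (c.φt y + 2 * η))) (Set.Ioi 0 ×ˢ Set.univ) :=
      hf.lsc.add ((Continuous.lowerSemicontinuous (f := fun p : ℝ × ℝ => -(Γ p.2 * (c.φt y + 2 * η))) (by fun_prop)).lowerSemicontinuousOn _)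
    have := hl (t, x) ⟨ht, trivial⟩ 0 (by simp only; linarith)
    rw [(isOpen_Ioi.prod isOpen_univ).nhdsWithin_eq (show (t, x) ∈ Set.Ioi (0:ℝ) ×ˢ (Set.univ : Set ℝ) from ⟨ht, trivial⟩)] at this
    filter_upwards [this] with q hq
    linarith
  rw [nhds_prod_eq, eventually_prod_iff] at hev
  obtain ⟨pa, hpa, pb, hpb, hab⟩ := hev
  obtain ⟨ρ, hρ, hρb⟩ := Metric.nhds_basis_closedBall.mem_iff.mp hpb
  rw [Real.closedBall_eq_Icc] at hρb
  set I := Set.Icc (x - ρ) (x + ρ) with hI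
  set J := ∫ v in I, c.φt v * (Γ v * η) with hJ
  have hφtc := c.φtc
  have hcJ : Continuous fun v => c.φt v * (Γ v * η) := by fun_prop
  have hJ0 : 0 < J := by
    rw [hJ, hI, integral_Icc_eq_integral_Ioc, ← intervalIntegral.integral_of_le (by linarith)]
    refine intervalIntegral.intervalIntegral_pos_of_pos (hcJ.intervalIntegrable _ _) (fun v => ?_) (by linarith)
    exact mul_pos (hft v) (mul_pos (hΓ0 v) hη0)
  set δ := min η (J / (4 * Real.exp (c.γ * t))) with hδ
  have hδ0 : 0 < δ := lt_min hη0 (by positivity)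
  have hpa' : ∀ᶠ s in nhdsWithin 0 (Set.Ioi 0), pa (s + t) := by
    have : Continuous fun s : ℝ => s + t := by fun_prop
    have := this.tendsto 0
    rw [zero_add] at this
    exact (this.mono_left nhdsWithin_le_nhds).eventually hpa
  have hexp : ∀ᶠ s in nhdsWithin 0 (Set.Ioi 0), Real.exp (c.γ * s) * c.φt y < c.φt y + δ := by
    have : Continuous fun s : ℝ => Real.exp (c.γ * s) * c.φt y := by fun_prop
    have := this.tendsto 0
    rw [mul_zero, Real.exp_zero, one_mul] at this
    exact (this.mono_left nhdsWithin_le_nhds).eventually (gt_mem_nhds (by linarith))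
  obtain ⟨s, ⟨hs0, ψ, ψ', k, h, h1, h2, h3, h4, h5⟩, hs2, hs3⟩ := ((hf.key ht hδ0).and (hpa'.and hexp)).exists
  have hst : 0 < s + t := by linarith
  obtain ⟨hi1, hm1⟩ := h.S_mass h1 ht.le
  have hi2 := hf.int (s + t) hst
  have hm2 := hf.mass (s + t) hst
  have hi3 : Integrable fun v => c.φt v * f (s + t) v - c.φt v * h.S t v := hi2.sub hi1
  have hJle : J ≤ ∫ v, (c.φt v * f (s + t) v - c.φt v * h.S t v) := by
    refine (setIntegral_mono_on (hcJ.continuousOn.integrableOn_Icc) hi3.integrableOn measurableSet_Icc ?_).trans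
      (setIntegral_le_integral hi3 (Eventually.of_forall fun v => ?_))
    · intro v hv
      have k1 : Γ v * (c.φt y + 2 * η) < f (s + t) v := hab hs2 (hρb hv)
      have k2 : h.S t v ≤ Γ v * ∫ x, c.φt x * ψ x := h.upper h1 ht h2 v
      have k3 : Γ v * ∫ x, c.φt x * ψ x ≤ Γ v * (c.φt y + η) :=
        mul_le_mul_of_nonneg_left (by linarith [min_le_left η (J / (4 * Real.exp (c.γ * t)))]) (hΓ0 v).le
      rw [← mul_sub]
      refine mul_le_mul_of_nonneg_left ?_ (hft v).le
      linarith
    · have := mul_le_mul_of_nonneg_left (h5 v) (hft v).le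
      simp only [Pi.zero_apply]
      linarith
  rw [integral_sub hi2 hi1, hm1, hm2, mul_add, Real.exp_add] at hJle
  have hE := Real.exp_pos (c.γ * t)
  have hd2 : δ * (4 * Real.exp (c.γ * t)) ≤ J := by
    rw [← le_div_iff₀ (by positivity)]; exact min_le_right _ _
  have k4 : Real.exp (c.γ * t) * (Real.exp (c.γ * s) * c.φt y - ∫ x, c.φt x * ψ x) ≤ Real.exp (c.γ * t) * (2 * δ) :=
    mul_le_mul_of_nonneg_left (by linarith) hE.le
  have k5 : Real.exp (c.γ * s) * Real.exp (c.γ * t) * c.φt y - Real.exp (c.γ * t) * ∫ x, c.φt x * ψ x =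
    Real.exp (c.γ * t) * (Real.exp (c.γ * s) * c.φt y - ∫ x, c.φt x * ψ x) := by ring
  rw [k5] at hJle
  linarith
end Ctx

/-! ### Part 24 -/
theorem Ctx.final (c : Ctx) {U : ℝ → ℝ → ℝ → ℝ} (hF : ∀ y, c.Fund (fun t x => U t x y) y) :
    ∃ C : ℝ, 0 < C ∧ ∀ t : ℝ, 0 < t → ∀ x y : ℝ,
      1 / (C * Real.sqrt t) * (c.φ x / c.φ y) *
        Real.exp (-C * |c.T x - c.T y - c.W * t| ^ 2 / t + c.γ * t) ≤ U t x y ∧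
      U t x y ≤ C / Real.sqrt t * (c.φ x / c.φ y) *
        Real.exp (-|c.T x - c.T y - c.W * t| ^ 2 / (C * t) + c.γ * t) := by
  have h1 := c.cL_pos
  have h2 := c.CU_pos
  have h3 := c.DU_pos
  have h4 := c.tB_pos
  have h5 := c.m00
  have h6 := c.m10
  have h7 : 0 < 1 / (c.cL * c.m0) := by positivity
  have h8 : 0 < c.CU * c.m1 := by positivity
  set C := 1 / (c.cL * c.m0) + 2 * c.tB + c.CU * c.m1 + c.DU with hC
  have hC0 : 0 < C := by rw [hC]; positivity
  have hC1 : 1 / (c.cL * c.m0) ≤ C := by rw [hC]; linarith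
  have hC2 : 2 * c.tB ≤ C := by rw [hC]; linarith
  have hC3 : c.CU * c.m1 ≤ C := by rw [hC]; linarith
  have hC4 : c.DU ≤ C := by rw [hC]; linarith
  refine ⟨C, hC0, fun t ht x y => ?_⟩
  have hq : 0 < Real.sqrt t := Real.sqrt_pos.mpr ht
  have hx := c.hφ.pos x
  have hy := c.hφ.pos y
  have hyt := c.hφt.pos y
  have hl := (hF y).lower ht x
  have hu := (hF y).upper ht x
  rw [sq_abs]
  change 1 / (C * Real.sqrt t) * (c.φ x / c.φ y) * Real.exp (-C * (c.z t y x) ^ 2 / t + c.γ * t) ≤ U t x y ∧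
      U t x y ≤ C / Real.sqrt t * (c.φ x / c.φ y) * Real.exp (-(c.z t y x) ^ 2 / (C * t) + c.γ * t)
  constructor
  · refine le_trans ?_ hl
    have e1 : 1 / C ≤ c.cL * c.m0 := by
      rw [div_le_iff₀ (by positivity)] at hC1
      rw [div_le_iff₀ hC0]; linarith
    have e2 : c.m0 / c.φ y ≤ c.φt y := by
      rw [div_le_iff₀ hy]; linarith [c.mlow y]
    have e3 : -C * (c.z t y x) ^ 2 / t + c.γ * t ≤ -(2 * c.tB * (c.z t y x ^ 2)) / t + c.γ * t := by
      have : -C * (c.z t y x) ^ 2 ≤ -(2 * c.tB * (c.z t y x ^ 2)) := by nlinarith [sq_nonneg (c.z t y x)]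
      gcongr
    calc 1 / (C * Real.sqrt t) * (c.φ x / c.φ y) * Real.exp (-C * (c.z t y x) ^ 2 / t + c.γ * t)
        = (1 / C) * (1 / Real.sqrt t * c.φ x / c.φ y * Real.exp (-C * (c.z t y x) ^ 2 / t + c.γ * t)) := by field_simp
      _ ≤ (c.cL * c.m0) * (1 / Real.sqrt t * c.φ x / c.φ y * Real.exp (-(2 * c.tB * (c.z t y x ^ 2)) / t + c.γ * t)) := by
          gcongr
      _ = c.cL / Real.sqrt t * c.φ x * Real.exp (-(2 * c.tB * (c.z t y x ^ 2)) / t + c.γ * t) * (c.m0 / c.φ y) := by field_simp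
      _ ≤ _ := by gcongr
  · refine hu.trans ?_
    have e2 : c.φt y ≤ c.m1 / c.φ y := by
      rw [le_div_iff₀ hy]; linarith [c.mup y]
    have e3 : -(c.z t y x ^ 2) / (c.DU * t) + c.γ * t ≤ -(c.z t y x) ^ 2 / (C * t) + c.γ * t := by
      have : (c.z t y x) ^ 2 / (C * t) ≤ (c.z t y x) ^ 2 / (c.DU * t) := by gcongr
      rw [neg_div, neg_div]; linarith
    calc c.CU / Real.sqrt t * c.φ x * Real.exp (-(c.z t y x ^ 2) / (c.DU * t) + c.γ * t) * c.φt y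
        ≤ c.CU / Real.sqrt t * c.φ x * Real.exp (-(c.z t y x) ^ 2 / (C * t) + c.γ * t) * (c.m1 / c.φ y) := by gcongr
      _ = (c.CU * c.m1) * (1 / Real.sqrt t * (c.φ x / c.φ y) * Real.exp (-(c.z t y x) ^ 2 / (C * t) + c.γ * t)) := by field_simp
      _ ≤ C * (1 / Real.sqrt t * (c.φ x / c.φ y) * Real.exp (-(c.z t y x) ^ 2 / (C * t) + c.γ * t)) := by gcongr
      _ = _ := by ring

theorem gauss_main {μ : ℝ} (hμ : 1 ≤ μ) {a r : ℝ → ℝ}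
    (hac : Continuous a) (hrc : Continuous r)
    (ha : ∀ x, 1 / μ ≤ a x ∧ a x ≤ μ) (hr : ∀ x, |r x| ≤ μ)
    {γ : ℝ} (hγ : gammaBar a r < γ)
    {φ φ' φt φt' : ℝ → ℝ}
    (p1 : ∀ x, 0 < φ x) (p2 : φ 0 = 1) (p3 : ∀ x, HasDerivAt φ (φ' x) x)
    (p4 : ∀ x, HasDerivAt (fun y => a y * φ' y) ((γ - r x) * φ x) x) (p5 : Tendsto φ atTop (nhds 0))
    (q1 : ∀ x, 0 < φt x) (q2 : φt 0 = 1) (q3 : ∀ x, HasDerivAt φt (φt' x) x)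
    (q4 : ∀ x, HasDerivAt (fun y => a y * φt' y) ((γ - r x) * φt x) x) (q5 : Tendsto φt atBot (nhds 0))
    {φd φd' : ℝ → ℝ}
    (hφdD : ∀ x, HasDerivAt φd (φd' x) x)
    (hφdEq : ∀ x, HasDerivAt (fun y => a y * φd' y) (φ x - (r x - γ) * φd x) x)
    (hφdB : ∃ K : ℝ, ∀ x : ℝ, x ≠ 0 → |φd x / (x * φ x)| ≤ K)
    {W : ℝ} (hW : W = a 0 * (φt' 0 * φ 0 - φ' 0 * φt 0))
    {Tγ : ℝ → ℝ} (hTγ : ∀ x, Tγ x = -W * φd x / φ x)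
    {U : ℝ → ℝ → ℝ → ℝ}
    (hU : ∀ y : ℝ, ∃ Ut Ux q : ℝ → ℝ → ℝ, ∀ t ∈ Set.Ioi (0 : ℝ), ∀ x : ℝ,
      0 ≤ U t x y ∧
      HasDerivAt (fun τ => U τ x y) (Ut t x) t ∧
      HasDerivAt (fun ξ => U t ξ y) (Ux t x) x ∧
      HasDerivAt (fun ξ => a ξ * Ux t ξ) (q t x) x ∧
      Ut t x = q t x + r x * U t x y)
    (hinit : ∀ y : ℝ, ∀ ψ : ℝ → ℝ, Continuous ψ → (∃ B : ℝ, ∀ x, |ψ x| ≤ B) →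
      Tendsto (fun t => ∫ x : ℝ, U t x y * ψ x) (nhdsWithin 0 (Set.Ioi 0)) (nhds (ψ y)))
    (hsg : ∀ s t : ℝ, 0 < s → 0 < t → ∀ x y : ℝ,
      U (t + s) x y = ∫ z : ℝ, U t x z * U s z y)
    (hUadj : ∀ t : ℝ, 0 < t → ∀ y : ℝ,
      ∫ x : ℝ, φt x * U t x y = Real.exp (γ * t) * φt y) :
    ∃ C : ℝ, 0 < C ∧ ∀ t : ℝ, 0 < t → ∀ x y : ℝ,
      1 / (C * Real.sqrt t) * (φ x / φ y) *
        Real.exp (-C * |Tγ x - Tγ y - W * t| ^ 2 / t + γ * t) ≤ U t x y ∧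
      U t x y ≤ C / Real.sqrt t * (φ x / φ y) *
        Real.exp (-|Tγ x - Tγ y - W * t| ^ 2 / (C * t) + γ * t) := by
  have hμ0 : 0 < μ := by linarith
  have hφ : PosSol a (fun x => γ - r x) φ φ' := ⟨p1, p3, p4⟩
  have hφt : PosSol a (fun x => γ - r x) φt φt' := ⟨q1, q3, q4⟩
  have hk : ∀ x, |(fun x => γ - r x) x| ≤ |γ| + μ := fun x =>
    (abs_sub _ _).trans (by linarith [hr x])
  set P := 2 * (|γ| + μ) * μ + 1 with hPdef
  have hP0 : 0 < P := by positivity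
  have hP2 : 2 * (|γ| + μ) * μ ≤ P ^ 2 := by
    have : 0 ≤ 2 * (|γ| + μ) * μ := by positivity
    rw [hPdef]; nlinarith
  have hpair : Pair μ γ (γ - gammaBar a r) P W a r φ φ' φt φt' :=
    ⟨hμ, hac, hrc, ha, hr, hφ, hφt, p5, q5, p2, q2, fun x => by rw [hW]; exact wronskian_const hφ hφt x,
      hP0, hφ.bound hμ ha hk hP0 hP2, hφt.bound hμ ha hk hP0 hP2, by linarith,
      fun η η' h1 h2 h3 => hardy_ineq hμ hac hrc ha hr hφ h1 h2 h3⟩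
  obtain ⟨c, rfl, rfl, rfl, rfl, rfl, rfl, rfl⟩ := hpair.ctx hφdD hφdEq hφdB hTγ
  have hnn : ∀ t, 0 < t → ∀ x y, 0 ≤ U t x y := fun t ht x y => by
    obtain ⟨Ut, Ux, q, h⟩ := hU y
    exact (h t ht x).1
  have hcx : ∀ t, 0 < t → ∀ y, Continuous fun x => U t x y := fun t ht y => by
    obtain ⟨Ut, Ux, q, h⟩ := hU y
    exact continuous_iff_continuousAt.mpr fun x => (h t ht x).2.2.1.continuousAt
  have hct : ∀ t, 0 < t → ∀ x y, ContinuousAt (fun τ => U τ x y) t := fun t ht x y => by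
    obtain ⟨Ut, Ux, q, h⟩ := hU y
    exact (h t ht x).2.1.continuousAt
  refine c.final fun y => ?_
  refine ⟨fun t ht x => hnn t ht x y, fun t ht => hcx t ht y, fun t ht x => hct t ht x y,
    fund_lsc hnn hcx hct q1 c.φtc hUadj hsg y, ?_, fun t ht => fund_integrable hnn hcx q1 c.φtc hUadj ht y,
    fun t ht => hUadj t ht y, hinit y⟩
  obtain ⟨Ut, Ux, q, h⟩ := hU y
  refine ⟨Ux, fun s hs x => ?_⟩
  obtain ⟨-, h2, h3, h4, h5⟩ := h s hs x
  exact ⟨h3, q s x, Ut s x, h4, h2, h5.ge⟩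

/-- Theorem 1.5 (Gaussian estimates for the general parabolic equation): with
`γ > γ̲`, eigenfunctions `φ = φ_γ`, `φ̃ = φ̃_γ`, the derivative `φ̇ = φ̇_γ` of the
eigenfunction with respect to `γ` (characterized by `(aφ̇')' + (r−γ)φ̇ = φ`, `φ̇(0) = 0`
and `φ̇/(xφ)` bounded), `W = a(0)(φ̃'(0)φ(0) − φ'(0)φ̃(0))` and `T_γ = −Wφ̇/φ`, every
fundamental solution `U` of `u_t − (au_x)_x = ru` satisfies two-sided Gaussian bounds. -/
theorem gaussian_estimates_general_parabolic (μ : ℝ) (hμ : 1 ≤ μ) (a r : ℝ → ℝ)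
    (hac : Continuous a) (hrc : Continuous r)
    (ha : ∀ x, 1 / μ ≤ a x ∧ a x ≤ μ) (hr : ∀ x, |r x| ≤ μ)
    (γ : ℝ) (hγ : gammaBar a r < γ)
    (φ φ' φt φt' : ℝ → ℝ)
    (hφ : IsGenPrincEig a r γ Filter.atTop φ φ')
    (hφt : IsGenPrincEig a r γ Filter.atBot φt φt')
    (φd φd' : ℝ → ℝ) (hφd0 : φd 0 = 0)
    (hφdD : ∀ x, HasDerivAt φd (φd' x) x)
    (hφdEq : ∀ x, HasDerivAt (fun y => a y * φd' y) (φ x - (r x - γ) * φd x) x)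
    (hφdB : ∃ K : ℝ, ∀ x : ℝ, x ≠ 0 → |φd x / (x * φ x)| ≤ K)
    (W : ℝ) (hW : W = a 0 * (φt' 0 * φ 0 - φ' 0 * φt 0))
    (Tγ : ℝ → ℝ) (hTγ : ∀ x, Tγ x = -W * φd x / φ x)
    (U : ℝ → ℝ → ℝ → ℝ) (hU : IsFundSolOrig a r U)
    (hUadj : ∀ t : ℝ, 0 < t → ∀ y : ℝ,
      ∫ x : ℝ, φt x * U t x y = Real.exp (γ * t) * φt y) :
    ∃ C : ℝ, 0 < C ∧ ∀ t : ℝ, 0 < t → ∀ x y : ℝ,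
      1 / (C * Real.sqrt t) * (φ x / φ y) *
        Real.exp (-C * |Tγ x - Tγ y - W * t| ^ 2 / t + γ * t) ≤ U t x y ∧
      U t x y ≤ C / Real.sqrt t * (φ x / φ y) *
        Real.exp (-|Tγ x - Tγ y - W * t| ^ 2 / (C * t) + γ * t) := by
  obtain ⟨hnn', hinit, hsg⟩ := hU
  exact gauss_main hμ hac hrc ha hr hγ hφ.1 hφ.2.1 hφ.2.2.1 hφ.2.2.2.1 hφ.2.2.2.2
    hφt.1 hφt.2.1 hφt.2.2.1 hφt.2.2.2.1 hφt.2.2.2.2 hφdD hφdEq hφdB hW hTγ hnn' hinit hsg hUadj
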